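/- Let k ≥ 1 be an integer and let G be a triangulation of the plane. Then G has either a 0-nest of size k, or a standard tree-decomposition of width at most 12k − 1. -/

import Mathlib

open Set Bornology

noncomputable section

namespace CrossingPaper

/-- Points of the plane. -/
abbrev Plane : Type := ℝ × ℝ

/-- A drawing of a (simple) graph `G` in the plane: each vertex is mapped to a point
(injectively), and each edge `e = uv` is mapped to an arc with ends `vmap u`, `vmap v`
whose interior `emap e` avoids all vertex images; any two distinct edges intersect in
finitely many points. -/
structure Drawing {V : Type} (G : SimpleGraph V) where
  vmap : V → Plane
  emap : Sym2 V → Set Plane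
  vmap_inj : Function.Injective vmap
  arc : ∀ e ∈ G.edgeSet, ∀ u v : V, e = s(u, v) →
    ∃ f : ℝ → Plane, ContinuousOn f (Icc 0 1) ∧ InjOn f (Icc 0 1) ∧
      f 0 = vmap u ∧ f 1 = vmap v ∧ emap e = f '' Ioo 0 1
  avoid : ∀ e ∈ G.edgeSet, ∀ v : V, vmap v ∉ emap e
  finite_inter : ∀ e ∈ G.edgeSet, ∀ e' ∈ G.edgeSet, e ≠ e' → (emap e ∩ emap e').Finite

variable {V : Type} {G : SimpleGraph V}

/-- The set of crossings of a drawing: points lying on (the interiors of) two distinct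
edges. -/
def Drawing.crossings (γ : Drawing G) : Set Plane :=
  {p | ∃ e ∈ G.edgeSet, ∃ e' ∈ G.edgeSet, e ≠ e' ∧ p ∈ γ.emap e ∧ p ∈ γ.emap e'}

/-- The crossing number of a graph: the minimum number of crossings over all drawings. -/
def crossingNumber (G : SimpleGraph V) : ℕ :=
  sInf {n | ∃ γ : Drawing G, γ.crossings.Finite ∧ γ.crossings.ncard = n}

/-- `G` is `k`-crossing-critical: `cr(G) ≥ k` and `cr(G - e) < k` for every edge `e`. -/
def CrossingCritical (G : SimpleGraph V) (k : ℕ) : Prop :=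
  k ≤ crossingNumber G ∧
    ∀ e ∈ G.edgeSet, crossingNumber (G.deleteEdges {e}) < k

/-- The image of a subgraph under a drawing. -/
def Drawing.image (γ : Drawing G) (H : G.Subgraph) : Set Plane :=
  γ.vmap '' H.verts ∪ ⋃ e ∈ H.edgeSet, γ.emap e

/-- The image of a whole drawing. -/
def Drawing.totalImage (γ : Drawing G) : Set Plane :=
  range γ.vmap ∪ ⋃ e ∈ G.edgeSet, γ.emap e

/-- The union of all bounded complementary components of a set in the plane: for a
Jordan curve this is the open disk bounded by the curve. -/
def boundedSide (s : Set Plane) : Set Plane :=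
  {p | p ∉ s ∧ IsBounded (connectedComponentIn sᶜ p)}

/-- For a Jordan curve, the closed disk bounded by the curve. -/
def closedRegion (s : Set Plane) : Set Plane :=
  s ∪ boundedSide s

/-- A subgraph is a cycle: connected, finite, and every vertex has exactly two
neighbours. -/
def IsCycleSubgraph (H : G.Subgraph) : Prop :=
  H.Connected ∧ H.verts.Finite ∧ ∀ v ∈ H.verts, (H.neighborSet v).ncard = 2

/-- A subgraph is crossing-free in a drawing if none of its edges is crossed by
another edge of `G`. -/
def Drawing.CrossingFree (γ : Drawing G) (H : G.Subgraph) : Prop :=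
  ∀ e ∈ H.edgeSet, ∀ e' ∈ G.edgeSet, e ≠ e' → γ.emap e ∩ γ.emap e' = ∅

/-- A sequence of cycles `C 0, …, C (t-1)` is a nest in `γ`: the cycles are pairwise
edge-disjoint, each is crossing-free in `γ`, and the image of each cycle is contained
in the closed disk bounded by the image of the previous one. -/
def Drawing.IsNest (γ : Drawing G) {t : ℕ} (C : Fin t → G.Subgraph) : Prop :=
  (∀ i, IsCycleSubgraph (C i)) ∧
  (∀ i j, i ≠ j → Disjoint (C i).edgeSet (C j).edgeSet) ∧
  (∀ i, γ.CrossingFree (C i)) ∧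
  (∀ i : ℕ, ∀ h : i + 1 < t,
    γ.image (C ⟨i + 1, h⟩) ⊆ closedRegion (γ.image (C ⟨i, by omega⟩)))

/-- An `s`-nest: a nest such that any two distinct cycles intersect exactly in a fixed
set `X` of `s` vertices. -/
def Drawing.IsSNest (γ : Drawing G) (s : ℕ) {t : ℕ} (C : Fin t → G.Subgraph) : Prop :=
  γ.IsNest C ∧ ∃ X : Set V, X.Finite ∧ X.ncard = s ∧
    ∀ i j, i ≠ j → (C i).verts ∩ (C j).verts = X

/-- A nest `C 0, …, C (t-1)` in `γ` is clean if every crossing of `γ` lies either in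
the open disk bounded by the image of the last cycle or outside the closed disk
bounded by the image of the first cycle. -/
def Drawing.IsCleanNest (γ : Drawing G) {t : ℕ} (C : Fin t → G.Subgraph) : Prop :=
  ∀ h : 0 < t, ∀ p ∈ γ.crossings,
    p ∈ boundedSide (γ.image (C ⟨t - 1, by omega⟩)) ∨
      p ∉ closedRegion (γ.image (C ⟨0, h⟩))

/-- A drawing is generic: no point lies on three distinct edges, and no two adjacent
edges cross. -/
def Drawing.Generic (γ : Drawing G) : Prop :=
  (∀ p : Plane, ∀ e₁ ∈ G.edgeSet, ∀ e₂ ∈ G.edgeSet, ∀ e₃ ∈ G.edgeSet,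
    p ∈ γ.emap e₁ → p ∈ γ.emap e₂ → p ∈ γ.emap e₃ → e₁ = e₂ ∨ e₁ = e₃ ∨ e₂ = e₃) ∧
  (∀ e ∈ G.edgeSet, ∀ e' ∈ G.edgeSet, e ≠ e' → (∃ v : V, v ∈ e ∧ v ∈ e') →
    γ.emap e ∩ γ.emap e' = ∅)

/-- The faces of a (crossing-free) drawing: the connected components of the complement
of its image. -/
def Drawing.faces (γ : Drawing G) : Set (Set Plane) :=
  {F | ∃ x, x ∉ γ.totalImage ∧ F = connectedComponentIn γ.totalImageᶜ x}

/-- The length of (the boundary of) a face: the number of edges of the graph drawn on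
its frontier. -/
def Drawing.faceLength (γ : Drawing G) (F : Set Plane) : ℕ :=
  {e | e ∈ G.edgeSet ∧ γ.emap e ⊆ frontier F}.ncard

/-- A drawing is a plane triangulation if it has no crossings and every face (including
the outer face) is bounded by a triangle of the graph. -/
def Drawing.IsPlaneTriangulation (γ : Drawing G) : Prop :=
  γ.crossings = ∅ ∧
  ∀ F ∈ γ.faces, ∃ T : G.Subgraph, IsCycleSubgraph T ∧ T.verts.ncard = 3 ∧
    frontier F = γ.image T



section Part1
/-! ### Topological preliminaries -/

lemma rank_plane : 1 < Module.rank ℝ Plane := by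
  apply Module.one_lt_rank_of_one_lt_finrank
  simp [Module.finrank_prod]

lemma isPreconnected_annulus (x : Plane) {T : Set ℝ} (hT : IsPreconnected T)
    (hT0 : ∀ t ∈ T, 0 < t) : IsPreconnected {y : Plane | ‖y - x‖ ∈ T} := by
  have h1 := (isPreconnected_sphere rank_plane (0 : Plane) 1).prod hT
  have h2 := h1.image (fun p : Plane × ℝ => x + p.2 • p.1) (by fun_prop)
  convert h2 using 1
  ext y
  simp only [mem_ofPred_eq, mem_image, mem_prod, mem_sphere_iff_norm, sub_zero]
  constructor
  · intro hy
    have h0 := hT0 _ hy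
    refine ⟨(‖y - x‖⁻¹ • (y - x), ‖y - x‖), ⟨?_, hy⟩, ?_⟩
    · rw [norm_smul, norm_inv, norm_norm, inv_mul_cancel₀ h0.ne']
    · rw [smul_smul, mul_inv_cancel₀ h0.ne', one_smul]; abel
  · rintro ⟨⟨s, t⟩, ⟨hs, ht⟩, rfl⟩
    simp only at hs ht ⊢
    have h0 := hT0 _ ht
    rw [add_sub_cancel_left, norm_smul, hs, mul_one, Real.norm_of_nonneg h0.le]
    exact ht

lemma isPreconnected_ball_diff (x : Plane) (r : ℝ) :
    IsPreconnected (Metric.ball x r \ {x}) := by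
  convert isPreconnected_annulus x (T := Ioo 0 r) isPreconnected_Ioo (fun t ht => ht.1) using 1
  ext y
  simp only [mem_sdiff, Metric.mem_ball, mem_singleton_iff, mem_ofPred_eq, mem_Ioo, norm_pos_iff,
    sub_ne_zero, dist_eq_norm, ne_eq]
  tauto

lemma isPreconnected_compl_closedBall (x : Plane) {r : ℝ} (hr : 0 ≤ r) :
    IsPreconnected (Metric.closedBall x r)ᶜ := by
  convert isPreconnected_annulus x (T := Ioi r) isPreconnected_Ioi
    (fun t ht => lt_of_le_of_lt hr ht) using 1
  ext y
  simp [dist_eq_norm]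

lemma not_isBounded_compl_closedBall (x : Plane) (r : ℝ) :
    ¬ IsBounded (Metric.closedBall x r)ᶜ := by
  intro h
  have := h.union (Metric.isBounded_closedBall (x := x) (r := r))
  rw [compl_union_self] at this
  exact NormedSpace.unbounded_univ ℝ Plane this

/-- Two points of unbounded components of the complement of a bounded set lie in the same
component. -/
lemma exists_outer {K : Set Plane} (hK : IsBounded K) :
    ∃ o, o ∉ K ∧ ¬ IsBounded (connectedComponentIn Kᶜ o) ∧
      ∀ y, y ∉ K → y ∉ connectedComponentIn Kᶜ o → IsBounded (connectedComponentIn Kᶜ y) := by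
  obtain ⟨r, hr0, hr⟩ := hK.subset_closedBall_lt 0 (0 : Plane)
  have hne : ((Metric.closedBall (0 : Plane) r)ᶜ).Nonempty := by
    by_contra h
    rw [not_nonempty_iff_eq_empty] at h
    have := not_isBounded_compl_closedBall 0 r
    rw [h] at this
    exact this isBounded_empty
  obtain ⟨o, ho⟩ := hne
  have hsub : (Metric.closedBall (0 : Plane) r)ᶜ ⊆ connectedComponentIn Kᶜ o :=
    (isPreconnected_compl_closedBall 0 hr0.le).subset_connectedComponentIn ho
      (compl_subset_compl.mpr hr)
  refine ⟨o, fun h => ho (hr h), fun h => not_isBounded_compl_closedBall 0 r (h.subset hsub), ?_⟩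
  intro y hy hyo
  refine (Metric.isBounded_closedBall (x := (0 : Plane)) (r := r)).subset ?_
  intro z hz
  by_contra hzr
  apply hyo
  have h1 := connectedComponentIn_eq hz
  have h2 := connectedComponentIn_eq (hsub hzr)
  rw [h2, ← h1]
  exact mem_connectedComponentIn hy

/-- Every nonvanishing complex function on a nice simply connected space has a logarithm. -/
lemma exists_log {X : Type*} [TopologicalSpace X] [SimplyConnectedSpace X]
    [LocallyPathConnectedSpace X] (f : X → ℂ) (hf : Continuous f) (h0 : ∀ x, f x ≠ 0) :
    ∃ g : X → ℂ, Continuous g ∧ ∀ x, Complex.exp (g x) = f x := by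
  obtain ⟨x₀⟩ : Nonempty X := inferInstance
  obtain ⟨g, ⟨-, hg⟩, -⟩ := Complex.isCoveringMapOn_exp.existsUnique_continuousMap_lifts
    ⟨f, hf⟩ (a₀ := x₀) (Complex.exp_log (h0 x₀)) (fun a => h0 a)
  exact ⟨g, g.continuous, fun x => congrFun hg x⟩

/-- `K` has the logarithm property. -/
def LP (K : Set Plane) : Prop :=
  ∀ f : Plane → ℂ, ContinuousOn f K → (∀ z ∈ K, f z ≠ 0) →
    ∃ g : Plane → ℂ, ContinuousOn g K ∧ ∀ z ∈ K, Complex.exp (g z) = f z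

lemma arc_inv {f : ℝ → Plane} (hf : ContinuousOn f (Icc 0 1)) (hi : InjOn f (Icc 0 1)) :
    ∃ t : Plane → ℝ, ContinuousOn t (f '' Icc 0 1) ∧ ∀ s ∈ Icc (0 : ℝ) 1, t (f s) = s := by
  refine ⟨Function.invFunOn f (Icc 0 1), ?_, fun s hs => hi.leftInvOn_invFunOn hs⟩
  intro z hz
  have key : ∀ C : Set ℝ, IsClosed C →
      IsClosed (f '' (Icc 0 1 ∩ C)) := fun C hC =>
    ((isCompact_Icc.inter_right hC).image_of_continuousOn (hf.mono inter_subset_left)).isClosed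
  refine (continuousOn_iff_isClosed.mpr ?_) z hz
  intro C hC
  refine ⟨_, key C hC, ?_⟩
  ext w
  constructor
  · rintro ⟨h1, s, hs, rfl⟩
    rw [mem_preimage, hi.leftInvOn_invFunOn hs] at h1
    exact ⟨⟨s, ⟨hs, h1⟩, rfl⟩, ⟨s, hs, rfl⟩⟩
  · rintro ⟨⟨s, ⟨hs, h1⟩, rfl⟩, -⟩
    refine ⟨?_, ⟨s, hs, rfl⟩⟩
    rw [mem_preimage, hi.leftInvOn_invFunOn hs]; exact h1

lemma LP_arc {f : ℝ → Plane} (hf : ContinuousOn f (Icc 0 1)) (hi : InjOn f (Icc 0 1)) :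
    LP (f '' Icc 0 1) := by
  intro F hF hF0
  have hc : ContinuousOn (fun s => F (f s)) (Icc 0 1) :=
    hF.comp hf (mapsTo_image f _)
  obtain ⟨g, hg, hgF⟩ := exists_log (fun s : ℝ => F (f (projIcc (0 : ℝ) 1 zero_le_one s)))
    (by
      have := (continuousOn_iff_continuous_domRestrict.mp hc).comp
        (continuous_projIcc (h := (zero_le_one : (0 : ℝ) ≤ 1)))
      exact this)
    (fun s => hF0 _ ⟨_, (projIcc (0 : ℝ) 1 zero_le_one s).2, rfl⟩)
  obtain ⟨t, ht, hts⟩ := arc_inv hf hi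
  refine ⟨fun z => g (t z), hg.comp_continuousOn ht, ?_⟩
  rintro _ ⟨s, hs, rfl⟩
  rw [hgF, hts s hs, projIcc_of_mem _ hs]

lemma interior_arc {f : ℝ → Plane} (hf : ContinuousOn f (Icc 0 1)) (hi : InjOn f (Icc 0 1)) :
    interior (f '' Icc 0 1) = ∅ := by
  by_contra hne
  obtain ⟨x, hx⟩ := nonempty_iff_ne_empty.mpr hne
  obtain ⟨t, ht, hts⟩ := arc_inv hf hi
  have htinj : InjOn t (f '' Icc 0 1) := by
    rintro _ ⟨a, ha, rfl⟩ _ ⟨b, hb, rfl⟩ h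
    rw [hts a ha, hts b hb] at h
    rw [h]
  -- a parameter in the open interval whose image is interior
  obtain ⟨s, hs, hsx⟩ : ∃ s ∈ Ioo (0 : ℝ) 1, f s ∈ interior (f '' Icc 0 1) := by
    obtain ⟨s, hs, rfl⟩ := interior_subset hx
    have h1 : ∀ᶠ u in nhdsWithin s (Icc 0 1), f u ∈ interior (f '' Icc 0 1) :=
      (hf s hs).eventually (isOpen_interior.mem_nhds hx)
    have h2 : s ∈ closure (Ioo (0 : ℝ) 1) := by
      rw [closure_Ioo zero_ne_one]; exact hs
    have h3 : (nhdsWithin s (Ioo (0 : ℝ) 1)).NeBot := mem_closure_iff_nhdsWithin_neBot.mp h2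
    have h4 := h1.filter_mono (nhdsWithin_mono s Ioo_subset_Icc_self)
    obtain ⟨u, hu, hu'⟩ := (h4.and self_mem_nhdsWithin).exists
    exact ⟨u, hu', hu⟩
  obtain ⟨ε, hε, hB⟩ := Metric.isOpen_iff.mp isOpen_interior _ hsx
  replace hB := hB.trans interior_subset
  have hcs : ContinuousAt f s := (hf s (Ioo_subset_Icc_self hs)).continuousAt (Icc_mem_nhds hs.1 hs.2)
  have hev : ∀ᶠ u in nhds s, f u ∈ Metric.ball (f s) ε ∧ u ∈ Ioo (0 : ℝ) 1 :=
    (hcs.eventually (Metric.ball_mem_nhds _ hε)).and (Ioo_mem_nhds hs.1 hs.2)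
  obtain ⟨δ, hδ, hev⟩ := Metric.eventually_nhds_iff.mp hev
  have ha := hev (y := s - δ / 2) (by rw [Real.dist_eq, abs_lt]; constructor <;> linarith)
  have hc := hev (y := s + δ / 2) (by rw [Real.dist_eq, abs_lt]; constructor <;> linarith)
  have hne : ∀ u ∈ Ioo (0 : ℝ) 1, u ≠ s → f u ≠ f s := fun u hu hus h =>
    hus (hi (Ioo_subset_Icc_self hu) (Ioo_subset_Icc_self hs) h)
  have him := (isPreconnected_ball_diff (f s) ε).image t (ht.mono (sdiff_subset.trans hB))
  have := him.ordConnected.out (x := s - δ / 2)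
    ⟨f (s - δ / 2), ⟨ha.1, hne _ ha.2 (by linarith)⟩, hts _ (Ioo_subset_Icc_self ha.2)⟩
    (y := s + δ / 2)
    ⟨f (s + δ / 2), ⟨hc.1, hne _ hc.2 (by linarith)⟩, hts _ (Ioo_subset_Icc_self hc.2)⟩
    (show s ∈ Icc (s - δ / 2) (s + δ / 2) from ⟨by linarith, by linarith⟩)
  obtain ⟨b, ⟨hb, hbs⟩, hbt⟩ := this
  apply hbs
  apply htinj (hB hb) ⟨s, Ioo_subset_Icc_self hs, rfl⟩
  rw [hbt, hts _ (Ioo_subset_Icc_self hs)]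

end Part1


section Part2
/-- The identification of the plane with the complex numbers. -/
def toC : Plane ≃L[ℝ] ℂ := Complex.equivRealProdCLM.symm

/-- `f` has a continuous logarithm on `K`. -/
def HasLog (K : Set Plane) (f : Plane → ℂ) : Prop :=
  ∃ g : Plane → ℂ, ContinuousOn g K ∧ ∀ z ∈ K, Complex.exp (g z) = f z

lemma HasLog.mono {K L : Set Plane} {f : Plane → ℂ} (h : HasLog K f) (hL : L ⊆ K) :
    HasLog L f := by
  obtain ⟨g, hg, h⟩ := h
  exact ⟨g, hg.mono hL, fun z hz => h z (hL hz)⟩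

lemma HasLog.mul {K : Set Plane} {f f' : Plane → ℂ} (h : HasLog K f) (h' : HasLog K f') :
    HasLog K (fun z => f z * f' z) := by
  obtain ⟨g, hg, h⟩ := h
  obtain ⟨g', hg', h'⟩ := h'
  exact ⟨fun z => g z + g' z, hg.add hg', fun z hz => by rw [Complex.exp_add, h z hz, h' z hz]⟩

lemma HasLog.zpow {K : Set Plane} {f : Plane → ℂ} (h : HasLog K f) (n : ℤ) :
    HasLog K (fun z => f z ^ n) := by
  obtain ⟨g, hg, h⟩ := h
  exact ⟨fun z => n * g z, continuousOn_const.mul hg,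
    fun z hz => by rw [Complex.exp_int_mul, h z hz]⟩

lemma HasLog.congr {K : Set Plane} {f f' : Plane → ℂ} (h : HasLog K f) (h' : EqOn f f' K) :
    HasLog K f' := by
  obtain ⟨g, hg, h⟩ := h
  exact ⟨g, hg, fun z hz => by rw [h z hz, h' hz]⟩

lemma sub_ne {K : Set Plane} {x z : Plane} (hx : x ∉ K) (hz : z ∈ K) : toC z - toC x ≠ 0 := by
  rw [sub_ne_zero]
  intro h
  exact hx (toC.injective h ▸ hz)

lemma hasLog_near {K : Set Plane} (hK : IsClosed K) {x : Plane} (hx : x ∉ K) :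
    ∀ᶠ y in nhds x, HasLog K (fun z => (toC z - toC y) / (toC z - toC x)) := by
  have h1 : IsOpen (toC.symm ⁻¹' Kᶜ) := hK.isOpen_compl.preimage toC.symm.continuous
  obtain ⟨δ, hδ, hB⟩ := Metric.isOpen_iff.mp h1 (toC x) (by simpa using hx)
  have h2 : ∀ᶠ y in nhds x, toC y ∈ Metric.ball (toC x) δ :=
    toC.continuous.continuousAt.eventually (Metric.ball_mem_nhds _ hδ)
  filter_upwards [h2] with y hy
  refine ⟨fun z => Complex.log ((toC z - toC y) / (toC z - toC x)), ?_, ?_⟩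
  · apply ContinuousOn.clog
    · apply ContinuousOn.div
      · exact (toC.continuous.sub continuous_const).continuousOn
      · exact (toC.continuous.sub continuous_const).continuousOn
      · intro z hz; exact sub_ne hx hz
    · intro z hz
      left
      have hz0 := sub_ne hx hz
      have h3 : (toC z - toC y) / (toC z - toC x) = 1 - (toC y - toC x) / (toC z - toC x) := by
        field_simp; ring
      rw [h3, Complex.sub_re, Complex.one_re]
      have h4 : ‖(toC y - toC x) / (toC z - toC x)‖ < 1 := by
        rw [norm_div, div_lt_one (norm_pos_iff.mpr hz0)]
        rw [mem_ball_iff_norm] at hy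
        by_contra hcon
        have : toC z ∈ Metric.ball (toC x) δ := by
          rw [mem_ball_iff_norm]; linarith
        have := hB this
        simp only [mem_preimage, ContinuousLinearEquiv.symm_apply_apply] at this
        exact this hz
      have := Complex.re_le_norm ((toC y - toC x) / (toC z - toC x))
      linarith
  · intro z hz
    apply Complex.exp_log
    apply div_ne_zero
    · rw [sub_ne_zero]
      intro h
      rw [← h] at hy
      have := hB hy
      simp only [mem_preimage, ContinuousLinearEquiv.symm_apply_apply] at this
      exact this hz
    · exact sub_ne hx hz

/-- If `x` and `y` lie in a connected set avoiding the closed set `K`, then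
`(z - x) / (z - y)` has a continuous logarithm on `K`. -/
lemma hasLog_of_connected {K : Set Plane} (hK : IsClosed K) {S : Set Plane}
    (hS : IsPreconnected S) (hSK : S ⊆ Kᶜ) {x y : Plane} (hx : x ∈ S) (hy : y ∈ S) :
    HasLog K (fun z => (toC z - toC x) / (toC z - toC y)) := by
  refine hS.induction₂ (fun x y => HasLog K (fun z => (toC z - toC x) / (toC z - toC y)))
    ?_ ?_ ?_ hx hy
  · intro a ha
    have h := hasLog_near hK (hSK ha)
    refine Filter.Eventually.filter_mono nhdsWithin_le_nhds ?_
    filter_upwards [h] with b hb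
    refine (hb.zpow (-1)).congr ?_
    intro z hz
    simp
  · intro a b c ha hb hc hab hbc
    refine (hab.mul hbc).congr ?_
    intro z hz
    have := sub_ne (hSK ha) hz
    have := sub_ne (hSK hb) hz
    have := sub_ne (hSK hc) hz
    simp only
    field_simp
  · intro a b ha hb h
    refine (h.zpow (-1)).congr ?_
    intro z hz
    simp

lemma log_unique {X : Type*} [TopologicalSpace X] {S : Set X} (hS : IsPreconnected S)
    {g g' : X → ℂ} (hg : ContinuousOn g S) (hg' : ContinuousOn g' S)
    (h : ∀ z ∈ S, Complex.exp (g z) = Complex.exp (g' z)) {a b : X} (ha : a ∈ S) (hb : b ∈ S) :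
    g a - g' a = g b - g' b := by
  have key : ∀ z ∈ S, ∃ n : ℤ, g z - g' z = n * (2 * Real.pi * Complex.I) := by
    intro z hz
    obtain ⟨n, hn⟩ := Complex.exp_eq_exp_iff_exists_int.mp (h z hz)
    exact ⟨n, by rw [hn]; ring⟩
  have hc : ContinuousOn (fun z => (g z - g' z).im / (2 * Real.pi)) S :=
    (Complex.continuous_im.comp_continuousOn (hg.sub hg')).div_const _
  have hval : ∀ (z : X) (n : ℤ), g z - g' z = n * (2 * Real.pi * Complex.I) →
      (g z - g' z).im / (2 * Real.pi) = n := by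
    intro z n hn
    rw [hn]
    have : ((n : ℂ) * (2 * Real.pi * Complex.I)).im = n * (2 * Real.pi) := by
      simp
    rw [this]
    have := Real.pi_pos
    field_simp
  have him := (hS.image _ hc).ordConnected
  have main : ∀ a b, a ∈ S → b ∈ S → ∀ n m : ℤ, g a - g' a = n * (2 * Real.pi * Complex.I) →
      g b - g' b = m * (2 * Real.pi * Complex.I) → ¬ n < m := by
    intro a b ha hb n m hn hm hlt
    have hlt' : (n : ℝ) + 1 ≤ m := by exact_mod_cast hlt
    have h1 := him.out ⟨a, ha, hval a n hn⟩ ⟨b, hb, hval b m hm⟩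
      (show (n : ℝ) + 1 / 2 ∈ Icc (n : ℝ) m from ⟨by linarith, by linarith⟩)
    obtain ⟨c, hc, hcc⟩ := h1
    obtain ⟨l, hl⟩ := key c hc
    simp only at hcc
    rw [hval c l hl] at hcc
    have h2 : (n : ℝ) < l := by linarith
    have h3 : (l : ℝ) < n + 1 := by linarith
    have h2' : n < l := by exact_mod_cast h2
    have h3' : l < n + 1 := by exact_mod_cast h3
    omega
  obtain ⟨n, hn⟩ := key a ha
  obtain ⟨m, hm⟩ := key b hb
  have h1 := main a b ha hb n m hn hm
  have h2 := main b a hb ha m n hm hn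
  have : n = m := by omega
  rw [hn, hm, this]

/-- The winding obstruction. -/
lemma winding {K : Set Plane} (hK : IsClosed K) {x : Plane} (hx : x ∉ K)
    (hb : IsBounded (connectedComponentIn Kᶜ x)) (q : Plane → ℂ)
    (hq : ContinuousOn q (closure (connectedComponentIn Kᶜ x)))
    (hq0 : ∀ z ∈ closure (connectedComponentIn Kᶜ x), q z ≠ 0) (m : ℤ)
    (hlog : HasLog K (fun z => (toC z - toC x) ^ m * q z)) : m = 0 := by
  classical
  set U := connectedComponentIn Kᶜ x with hU
  have hUo : IsOpen U := hK.isOpen_compl.connectedComponentIn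
  have hxU : x ∈ U := mem_connectedComponentIn hx
  obtain ⟨g, hg, hgK⟩ := hlog
  obtain ⟨G, hG⟩ := ContinuousMap.exists_restrict_eq hK
    (⟨K.domRestrict g, continuousOn_iff_continuous_domRestrict.mp hg⟩ : C(K, ℂ))
  have hG' : ∀ z ∈ K, G z = g z := fun z hz => DFunLike.congr_fun hG ⟨z, hz⟩
  have hfr : frontier U ⊆ K := by
    intro z hz
    by_contra hzK
    have hzc : z ∈ closure U := hz.1
    have hV : IsOpen (connectedComponentIn Kᶜ z) := hK.isOpen_compl.connectedComponentIn
    obtain ⟨w, hw1, hw2⟩ := mem_closure_iff.mp hzc _ hV (mem_connectedComponentIn hzK)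
    have e1 := connectedComponentIn_eq hw1
    have e2 := connectedComponentIn_eq hw2
    have : z ∈ U := by
      rw [hU, e2, ← e1]; exact mem_connectedComponentIn hzK
    exact hz.2 (by rwa [hUo.interior_eq])
  let Fn : Plane → ℂ := U.piecewise (fun z => Complex.exp (G z) / q z)
    (fun z => (toC z - toC x) ^ m)
  have hFc : Continuous Fn := by
    apply continuous_piecewise
    · intro z hz
      have hzK := hfr hz
      have := hq0 z hz.1
      rw [hG' z hzK, hgK z hzK]
      field_simp
    · exact (Complex.continuous_exp.comp G.continuous).continuousOn.div hq hq0
    · rw [hUo.isClosed_compl.closure_eq]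
      apply ContinuousOn.zpow₀
      · exact (toC.continuous.sub continuous_const).continuousOn
      · intro z hz
        left
        rw [sub_ne_zero]
        intro h
        exact hz (toC.injective h ▸ hxU)
  have hF0 : ∀ z, Fn z ≠ 0 := by
    intro z
    by_cases hz : z ∈ U
    · simp only [Fn, piecewise_eq_of_mem _ _ _ hz]
      exact div_ne_zero (Complex.exp_ne_zero _) (hq0 z (subset_closure hz))
    · simp only [Fn, piecewise_eq_of_notMem _ _ _ hz]
      apply zpow_ne_zero
      rw [sub_ne_zero]
      intro h
      exact hz (toC.injective h ▸ hxU)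
  obtain ⟨h, hh, hhF⟩ := exists_log Fn hFc hF0
  -- a large circle
  have hbC : IsBounded (toC '' U) := by
    have := (toC : Plane →L[ℝ] ℂ).lipschitz.isBounded_image hb
    exact this
  obtain ⟨r, hr0, hr⟩ := hbC.subset_ball_lt 0 (toC x)
  let c : ℝ → Plane := fun t => toC.symm (toC x + r * Complex.exp (t * Complex.I))
  have hcc : Continuous c := by fun_prop
  have hcU : ∀ t, c t ∉ U := by
    intro t ht
    have := hr ⟨_, ht, rfl⟩
    simp only [c, ContinuousLinearEquiv.apply_symm_apply, mem_ball_iff_norm, add_sub_cancel_left,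
      norm_mul, Complex.norm_exp_ofReal_mul_I, mul_one, Complex.norm_real,
      Real.norm_of_nonneg hr0.le] at this
    exact lt_irrefl _ this
  have hval : ∀ t, Complex.exp (h (c t)) = Complex.exp (m * (Real.log r + t * Complex.I)) := by
    intro t
    rw [hhF]
    simp only [Fn, piecewise_eq_of_notMem _ _ _ (hcU t)]
    rw [Complex.exp_int_mul, Complex.exp_add]
    simp only [c, ContinuousLinearEquiv.apply_symm_apply, add_sub_cancel_left]
    rw [← Complex.ofReal_exp, Real.exp_log hr0]
  have huniq := log_unique (S := (univ : Set ℝ)) isPreconnected_univ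
    (g := fun t => h (c t)) (g' := fun t : ℝ => (m : ℂ) * (Real.log r + t * Complex.I))
    (hh.comp hcc).continuousOn (by fun_prop) (fun z _ => hval z) (mem_univ (0 : ℝ))
    (mem_univ (2 * Real.pi))
  have hc0 : c (2 * Real.pi) = c 0 := by
    simp only [c]
    congr 3
    push_cast
    rw [Complex.exp_two_pi_mul_I]
    simp
  rw [hc0] at huniq
  have h1 : (m : ℂ) * ((2 * Real.pi : ℝ) * Complex.I) = 0 := by
    have : (m : ℂ) * (Real.log r + (0 : ℝ) * Complex.I) =
        (m : ℂ) * (Real.log r + (2 * Real.pi : ℝ) * Complex.I) := by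
      linear_combination -huniq
    rw [Complex.ofReal_zero] at this
    linear_combination -this
  rcases mul_eq_zero.mp h1 with h2 | h2
  · exact_mod_cast h2
  · exfalso
    have := Complex.two_pi_I_ne_zero
    push_cast at h2
    exact this h2

end Part2


section Part3
variable {V : Type} {G : SimpleGraph V}

/-! ### Closed edges and basic facts about drawings without crossings -/

/-- The closed edge. -/
def Drawing.cl (γ : Drawing G) (e : Sym2 V) : Set Plane :=
  γ.emap e ∪ γ.vmap '' {v | v ∈ e}

lemma Drawing.cl_arc (γ : Drawing G) {u v : V} (he : G.Adj u v) :
    ∃ f : ℝ → Plane, ContinuousOn f (Icc 0 1) ∧ InjOn f (Icc 0 1) ∧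
      f 0 = γ.vmap u ∧ f 1 = γ.vmap v ∧ γ.emap s(u, v) = f '' Ioo 0 1 ∧
      γ.cl s(u, v) = f '' Icc 0 1 := by
  obtain ⟨f, h1, h2, h3, h4, h5⟩ := γ.arc s(u, v) he u v rfl
  refine ⟨f, h1, h2, h3, h4, h5, ?_⟩
  rw [Drawing.cl, h5, ← Ioo_union_both (zero_le_one (α := ℝ)), image_union, image_pair, h3, h4]
  congr 1
  ext z
  simp only [Sym2.mem_iff, mem_image, mem_ofPred_eq, mem_insert_iff, mem_singleton_iff]
  constructor
  · rintro ⟨w, rfl | rfl, rfl⟩ <;> simp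
  · rintro (rfl | rfl)
    · exact ⟨u, Or.inl rfl, rfl⟩
    · exact ⟨v, Or.inr rfl, rfl⟩

lemma Drawing.isCompact_cl (γ : Drawing G) {e : Sym2 V} (he : e ∈ G.edgeSet) :
    IsCompact (γ.cl e) := by
  induction e with | _ u v
  obtain ⟨f, h1, h2, h3, h4, h5, h6⟩ := γ.cl_arc he
  rw [h6]
  exact isCompact_Icc.image_of_continuousOn h1

lemma Drawing.isPreconnected_cl (γ : Drawing G) {e : Sym2 V} (he : e ∈ G.edgeSet) :
    IsPreconnected (γ.cl e) := by
  induction e with | _ u v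
  obtain ⟨f, h1, h2, h3, h4, h5, h6⟩ := γ.cl_arc he
  rw [h6]
  exact isPreconnected_Icc.image _ h1

lemma Drawing.interior_cl (γ : Drawing G) {e : Sym2 V} (he : e ∈ G.edgeSet) :
    interior (γ.cl e) = ∅ := by
  induction e with | _ u v
  obtain ⟨f, h1, h2, h3, h4, h5, h6⟩ := γ.cl_arc he
  rw [h6]
  exact interior_arc h1 h2

lemma Drawing.LP_cl (γ : Drawing G) {e : Sym2 V} (he : e ∈ G.edgeSet) : LP (γ.cl e) := by
  induction e with | _ u v
  obtain ⟨f, h1, h2, h3, h4, h5, h6⟩ := γ.cl_arc he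
  rw [h6]
  exact LP_arc h1 h2

lemma Drawing.emap_nonempty (γ : Drawing G) {e : Sym2 V} (he : e ∈ G.edgeSet) :
    (γ.emap e).Nonempty := by
  induction e with | _ u v
  obtain ⟨f, h1, h2, h3, h4, h5, h6⟩ := γ.cl_arc he
  rw [h5]
  exact (nonempty_Ioo.mpr zero_lt_one).image _

lemma Drawing.emap_disj {γ : Drawing G} (hX : γ.crossings = ∅) {e e' : Sym2 V}
    (he : e ∈ G.edgeSet) (he' : e' ∈ G.edgeSet) {z : Plane} (hz : z ∈ γ.emap e)
    (hz' : z ∈ γ.emap e') : e = e' := by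
  by_contra h
  have : z ∈ γ.crossings := ⟨e, he, e', he', h, hz, hz'⟩
  rw [hX] at this
  exact this

/-- The image without one open edge. -/
def Drawing.J (γ : Drawing G) (e : Sym2 V) : Set Plane :=
  range γ.vmap ∪ ⋃ e' ∈ G.edgeSet \ {e}, γ.cl e'

lemma Drawing.total_eq (γ : Drawing G) :
    γ.totalImage = range γ.vmap ∪ ⋃ e ∈ G.edgeSet, γ.cl e := by
  ext z
  simp only [Drawing.totalImage, Drawing.cl, mem_union, mem_iUnion]
  constructor
  · rintro (h | ⟨e, he, h⟩)
    · exact Or.inl h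
    · exact Or.inr ⟨e, he, Or.inl h⟩
  · rintro (h | ⟨e, he, h | ⟨v, hv, rfl⟩⟩)
    · exact Or.inl h
    · exact Or.inr ⟨e, he, h⟩
    · exact Or.inl ⟨v, rfl⟩

lemma Drawing.total_eq_J (γ : Drawing G) {e : Sym2 V} (he : e ∈ G.edgeSet) :
    γ.totalImage = γ.J e ∪ γ.cl e := by
  rw [γ.total_eq, Drawing.J]
  ext z
  simp only [mem_union, mem_iUnion, mem_sdiff, mem_singleton_iff]
  constructor
  · rintro (h | ⟨e', he', h⟩)
    · exact Or.inl (Or.inl h)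
    · by_cases hee : e' = e
      · subst hee; exact Or.inr h
      · exact Or.inl (Or.inr ⟨e', ⟨he', hee⟩, h⟩)
  · rintro ((h | ⟨e', ⟨he', -⟩, h⟩) | h)
    · exact Or.inl h
    · exact Or.inr ⟨e', he', h⟩
    · exact Or.inr ⟨e, he, h⟩

lemma Drawing.vmap_mem_cl (γ : Drawing G) {e : Sym2 V} (he : e ∈ G.edgeSet) {v : V} :
    γ.vmap v ∈ γ.cl e ↔ v ∈ e := by
  constructor
  · rintro (h | ⟨w, hw, h⟩)
    · exact absurd h (γ.avoid e he v)
    · exact γ.vmap_inj h ▸ hw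
  · intro h
    exact Or.inr ⟨v, h, rfl⟩

lemma Drawing.J_inter_cl {γ : Drawing G} (hX : γ.crossings = ∅) {e : Sym2 V}
    (he : e ∈ G.edgeSet) : γ.J e ∩ γ.cl e = γ.vmap '' {v | v ∈ e} := by
  ext z
  constructor
  · rintro ⟨h1, h2 | h2⟩
    · exfalso
      rcases h1 with ⟨v, rfl⟩ | h1
      · exact γ.avoid e he v h2
      · simp only [mem_iUnion, mem_sdiff, mem_singleton_iff] at h1
        obtain ⟨e', ⟨he', hne⟩, h | ⟨v, hv, rfl⟩⟩ := h1
        · exact hne (Drawing.emap_disj hX he' he h h2)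
        · exact γ.avoid e he v h2
    · exact h2
  · rintro ⟨v, hv, rfl⟩
    exact ⟨Or.inl ⟨v, rfl⟩, Or.inr ⟨v, hv, rfl⟩⟩

lemma Drawing.notMem_J {γ : Drawing G} (hX : γ.crossings = ∅) {e : Sym2 V}
    (he : e ∈ G.edgeSet) {z : Plane} (hz : z ∈ γ.emap e) : z ∉ γ.J e := by
  intro h
  have : z ∈ γ.J e ∩ γ.cl e := ⟨h, Or.inl hz⟩
  rw [Drawing.J_inter_cl hX he] at this
  obtain ⟨v, -, rfl⟩ := this
  exact γ.avoid e he v hz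

lemma Drawing.mem_emap_of {γ : Drawing G} {e : Sym2 V} (he : e ∈ G.edgeSet) {z : Plane}
    (hz : z ∈ γ.totalImage) (hJ : z ∉ γ.J e) : z ∈ γ.emap e := by
  rw [γ.total_eq_J he] at hz
  rcases hz with h | h | ⟨v, hv, rfl⟩
  · exact absurd h hJ
  · exact h
  · exact absurd (Or.inl ⟨v, rfl⟩) hJ

variable [Finite V]

lemma Drawing.isCompact_total (γ : Drawing G) : IsCompact γ.totalImage := by
  rw [γ.total_eq]
  refine (finite_range _).isCompact.union ?_
  exact (toFinite G.edgeSet).isCompact_biUnion (fun e he => γ.isCompact_cl he)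

lemma Drawing.isClosed_total (γ : Drawing G) : IsClosed γ.totalImage := γ.isCompact_total.isClosed

lemma Drawing.isCompact_J (γ : Drawing G) (e : Sym2 V) : IsCompact (γ.J e) := by
  refine (finite_range _).isCompact.union ?_
  exact (toFinite (G.edgeSet \ {e})).isCompact_biUnion (fun e he => γ.isCompact_cl he.1)

lemma Drawing.interior_total (γ : Drawing G) : interior γ.totalImage = ∅ := by
  rw [γ.total_eq]
  have h1 : interior (⋃ e ∈ G.edgeSet, γ.cl e) = ∅ := by
    have : ∀ s : Set (Sym2 V), s.Finite → s ⊆ G.edgeSet → interior (⋃ e ∈ s, γ.cl e) = ∅ := by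
      intro s hs
      induction s, hs using Set.Finite.induction_on with
      | empty => intro _; simp
      | @insert a s ha hs ih =>
        intro hsub
        rw [biUnion_insert, interior_union_isClosed_of_interior_empty]
        · exact γ.interior_cl (hsub (mem_insert _ _))
        · exact (γ.isCompact_cl (hsub (mem_insert _ _))).isClosed
        · exact ih ((subset_insert _ _).trans hsub)
    exact this _ (toFinite _) subset_rfl
  rw [union_comm, interior_union_isClosed_of_interior_empty]
  · exact h1
  · exact ((toFinite G.edgeSet).isCompact_biUnion (fun e he => γ.isCompact_cl he)).isClosed
  · exact interior_eq_empty_iff_dense_compl.mpr ((finite_range γ.vmap).countable.dense_compl ℝ)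

end Part3


section Part4
variable {V : Type} {G : SimpleGraph V}

/-! ### Faces of a plane triangulation -/

/-- The vertices on the boundary of a face. -/
def Drawing.fv (γ : Drawing G) (F : Set Plane) : Set V := {v | γ.vmap v ∈ frontier F}

/-- The edge `e` is on the boundary of the face `F`. -/
def Drawing.inc (γ : Drawing G) (e : Sym2 V) (F : Set Plane) : Prop :=
  e ∈ G.edgeSet ∧ ∀ v ∈ e, v ∈ γ.fv F

lemma Drawing.face_spec {γ : Drawing G} (htri : γ.IsPlaneTriangulation) {F : Set Plane}
    (hF : F ∈ γ.faces) :
    (γ.fv F).ncard = 3 ∧ (∀ a ∈ γ.fv F, ∀ b ∈ γ.fv F, a ≠ b → G.Adj a b) ∧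
      frontier F = γ.vmap '' (γ.fv F) ∪ ⋃ e ∈ {e | γ.inc e F}, γ.emap e := by
  obtain ⟨T, ⟨hT1, hT2, hT3⟩, hT4, hT5⟩ := htri.2 F hF
  have hv : γ.fv F = T.verts := by
    ext v
    simp only [Drawing.fv, mem_ofPred_eq, hT5, Drawing.image]
    constructor
    · rintro (⟨w, hw, h⟩ | h)
      · exact γ.vmap_inj h ▸ hw
      · simp only [mem_iUnion] at h
        obtain ⟨e, he, h⟩ := h
        exact absurd h (γ.avoid e (T.edgeSet_subset he) v)
    · intro h
      exact Or.inl ⟨v, h, rfl⟩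
  have hadj : ∀ a ∈ T.verts, ∀ b ∈ T.verts, a ≠ b → T.Adj a b := by
    intro a ha b hb hab
    have hsub : T.neighborSet a ⊆ T.verts \ {a} := by
      intro c hc
      exact ⟨T.edge_vert (SimpleGraph.Subgraph.Adj.symm hc), fun h => T.loopless.irrefl a (by
        have : T.Adj a c := hc
        rwa [mem_singleton_iff.mp h] at this)⟩
    have hcard : (T.verts \ {a}).ncard = 2 := by
      rw [ncard_sdiff_singleton_of_mem ha, hT4]
    have heq : T.neighborSet a = T.verts \ {a} :=
      eq_of_subset_of_ncard_le hsub (by rw [hcard, hT3 a ha]) (hT2.subset sdiff_subset)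
    have : b ∈ T.neighborSet a := by
      rw [heq]; exact ⟨hb, fun h => hab (mem_singleton_iff.mp h).symm⟩
    exact this
  refine ⟨hv ▸ hT4, fun a ha b hb hab => (hadj a (hv ▸ ha) b (hv ▸ hb) hab).adj_sub, ?_⟩
  have hE : {e | γ.inc e F} = T.edgeSet := by
    ext e
    induction e with | _ a b
    simp only [Drawing.inc, hv, mem_ofPred_eq, Sym2.mem_iff, forall_eq_or_imp, forall_eq,
      SimpleGraph.mem_edgeSet, SimpleGraph.Subgraph.mem_edgeSet]
    constructor
    · rintro ⟨h, ha, hb⟩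
      exact hadj a ha b hb h.ne
    · intro h
      exact ⟨h.adj_sub, T.edge_vert h, T.edge_vert h.symm⟩
  rw [hE, hv, hT5, Drawing.image]

lemma Drawing.inc_of_mem {γ : Drawing G} (htri : γ.IsPlaneTriangulation) {F : Set Plane}
    (hF : F ∈ γ.faces) {e : Sym2 V} (he : e ∈ G.edgeSet) {z : Plane} (hz : z ∈ γ.emap e)
    (hzF : z ∈ frontier F) : γ.inc e F := by
  obtain ⟨-, -, h⟩ := Drawing.face_spec htri hF
  rw [h] at hzF
  rcases hzF with ⟨v, -, rfl⟩ | h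
  · exact absurd hz (γ.avoid e he v)
  · simp only [mem_iUnion] at h
    obtain ⟨e', he', h⟩ := h
    have := Drawing.emap_disj htri.1 he he'.1 hz h
    rw [this]; exact he'

lemma Drawing.emap_subset_frontier {γ : Drawing G} (htri : γ.IsPlaneTriangulation) {F : Set Plane}
    (hF : F ∈ γ.faces) {e : Sym2 V} (he : γ.inc e F) : γ.emap e ⊆ frontier F := by
  obtain ⟨-, -, h⟩ := Drawing.face_spec htri hF
  rw [h]
  intro z hz
  right
  simp only [mem_iUnion]
  exact ⟨e, he, hz⟩

lemma Drawing.frontier_subset_total {γ : Drawing G} (htri : γ.IsPlaneTriangulation) {F : Set Plane}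
    (hF : F ∈ γ.faces) : frontier F ⊆ γ.totalImage := by
  obtain ⟨-, -, h⟩ := Drawing.face_spec htri hF
  rw [h]
  rintro z (⟨v, -, rfl⟩ | h)
  · exact Or.inl ⟨v, rfl⟩
  · simp only [mem_iUnion] at h
    obtain ⟨e, he, h⟩ := h
    right
    simp only [mem_iUnion]
    exact ⟨e, he.1, h⟩

lemma Drawing.face_subset {γ : Drawing G} {F : Set Plane} (hF : F ∈ γ.faces) :
    F ⊆ γ.totalImageᶜ := by
  obtain ⟨x, -, rfl⟩ := hF
  exact connectedComponentIn_subset _ _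

lemma Drawing.face_eq {γ : Drawing G} {F : Set Plane} (hF : F ∈ γ.faces) {z : Plane} (hz : z ∈ F) :
    F = connectedComponentIn γ.totalImageᶜ z := by
  obtain ⟨x, -, rfl⟩ := hF
  exact connectedComponentIn_eq hz

lemma Drawing.face_eq_of_mem {γ : Drawing G} {F F' : Set Plane} (hF : F ∈ γ.faces)
    (hF' : F' ∈ γ.faces) {z : Plane} (hz : z ∈ F) (hz' : z ∈ F') : F = F' := by
  rw [Drawing.face_eq hF hz, Drawing.face_eq hF' hz']

lemma Drawing.exists_face (γ : Drawing G) {z : Plane} (hz : z ∉ γ.totalImage) :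
    ∃ F ∈ γ.faces, z ∈ F :=
  ⟨_, ⟨z, hz, rfl⟩, mem_connectedComponentIn hz⟩

lemma Drawing.face_nonempty {γ : Drawing G} {F : Set Plane} (hF : F ∈ γ.faces) : F.Nonempty := by
  obtain ⟨x, hx, rfl⟩ := hF
  exact ⟨x, mem_connectedComponentIn hx⟩

variable [Finite V]

lemma Drawing.face_isOpen {γ : Drawing G} {F : Set Plane} (hF : F ∈ γ.faces) : IsOpen F := by
  obtain ⟨x, -, rfl⟩ := hF
  exact γ.isClosed_total.isOpen_compl.connectedComponentIn

/-- A point of the closure of a face not on the image is in the face. -/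
lemma Drawing.mem_face_of_closure {γ : Drawing G} {F : Set Plane} (hF : F ∈ γ.faces) {z : Plane}
    (hz : z ∈ closure F) (hzI : z ∉ γ.totalImage) : z ∈ F := by
  obtain ⟨F', hF', hzF'⟩ := γ.exists_face hzI
  obtain ⟨w, hw, hw'⟩ := mem_closure_iff.mp hz F' (Drawing.face_isOpen hF') hzF'
  rw [Drawing.face_eq_of_mem hF hF' hw' hw]
  exact hzF'

lemma Drawing.mem_frontier_of_closure {γ : Drawing G} {F : Set Plane} (hF : F ∈ γ.faces)
    {z : Plane} (hz : z ∈ closure F) (hzI : z ∈ γ.totalImage) : z ∈ frontier F := by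
  rw [(Drawing.face_isOpen hF).frontier_eq]
  exact ⟨hz, fun h => Drawing.face_subset hF h hzI⟩

lemma Drawing.exists_ball {γ : Drawing G} (hX : γ.crossings = ∅) {e : Sym2 V}
    (he : e ∈ G.edgeSet) {p : Plane} (hp : p ∈ γ.emap e) :
    ∃ r > 0, Metric.ball p r ⊆ (γ.J e)ᶜ :=
  Metric.isOpen_iff.mp (γ.isCompact_J e).isClosed.isOpen_compl p (Drawing.notMem_J hX he hp)

lemma Drawing.inc_of_ball {γ : Drawing G} (htri : γ.IsPlaneTriangulation) {F : Set Plane}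
    (hF : F ∈ γ.faces) {e : Sym2 V} (he : e ∈ G.edgeSet) {p : Plane} (hp : p ∈ γ.emap e)
    {r : ℝ} (hr : 0 < r) (hB : Metric.ball p r ⊆ (γ.J e)ᶜ) (hne : (Metric.ball p r ∩ F).Nonempty) :
    γ.inc e F := by
  have hpI : p ∈ γ.totalImage := by
    right; simp only [mem_iUnion]; exact ⟨e, he, hp⟩
  obtain ⟨z, hzB, hzF⟩ : (Metric.ball p r ∩ frontier F).Nonempty := by
    by_contra hcon
    have hpF : p ∉ closure F := fun h =>
      hcon ⟨p, Metric.mem_ball_self hr, Drawing.mem_frontier_of_closure hF h hpI⟩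
    obtain ⟨w, -, hw1, hw2⟩ := (convex_ball p r).isPreconnected F (closure F)ᶜ
      (Drawing.face_isOpen hF) isClosed_closure.isOpen_compl (by
        intro w hw
        by_contra hwn
        simp only [mem_union, mem_compl_iff, not_or, not_not] at hwn
        refine hcon ⟨w, hw, ?_⟩
        rw [(Drawing.face_isOpen hF).frontier_eq]
        exact ⟨hwn.2, hwn.1⟩) hne ⟨p, Metric.mem_ball_self hr, hpF⟩
    exact hw2 (subset_closure hw1)
  exact Drawing.inc_of_mem htri hF he
    (Drawing.mem_emap_of he (Drawing.frontier_subset_total htri hF hzF) (hB hzB)) hzF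

lemma Drawing.exists_inc {γ : Drawing G} (htri : γ.IsPlaneTriangulation) {e : Sym2 V}
    (he : e ∈ G.edgeSet) : ∃ F ∈ γ.faces, γ.inc e F := by
  obtain ⟨p, hp⟩ := γ.emap_nonempty he
  obtain ⟨r, hr, hB⟩ := Drawing.exists_ball htri.1 he hp
  obtain ⟨z, hz, hzI⟩ : ∃ z ∈ Metric.ball p r, z ∉ γ.totalImage := by
    by_contra! h
    have : p ∈ interior γ.totalImage :=
      mem_interior.mpr ⟨_, h, Metric.isOpen_ball, Metric.mem_ball_self hr⟩
    rw [γ.interior_total] at this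
    exact this
  obtain ⟨F, hF, hzF⟩ := γ.exists_face hzI
  exact ⟨F, hF, Drawing.inc_of_ball htri hF he hp hr hB ⟨z, hz, hzF⟩⟩

/-- Gluing logarithms. -/
lemma glue_log {A B : Set Plane} (hA : IsClosed A) (hB : IsClosed B) {u v : Plane}
    (hAB : A ∩ B ⊆ {u, v}) (hu : u ∈ A ∩ B) {q gA gB : Plane → ℂ} (hgA : ContinuousOn gA A)
    (hgB : ContinuousOn gB B) (hA' : ∀ z ∈ A, Complex.exp (gA z) = q z)
    (hB' : ∀ z ∈ B, Complex.exp (gB z) = q z) (huv : gA u - gB u = gA v - gB v) :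
    HasLog (A ∪ B) q := by
  classical
  let g : Plane → ℂ := fun z => if z ∈ A then gA z else gB z + (gA u - gB u)
  have hg1 : EqOn g gA A := fun z hz => by simp [g, hz]
  have hg2 : EqOn g (fun z => gB z + (gA u - gB u)) B := by
    intro z hz
    by_cases hzA : z ∈ A
    · rcases hAB ⟨hzA, hz⟩ with rfl | h
      · simp [g, hzA]
      · rw [mem_singleton_iff] at h
        subst h
        simp [g, hzA, huv]
    · simp [g, hzA]
  refine ⟨g, ?_, ?_⟩
  · exact (hgA.congr hg1).union_of_isClosed ((hgB.add continuousOn_const).congr hg2) hA hB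
  · rintro z (hz | hz)
    · rw [hg1 hz, hA' z hz]
    · rw [hg2 hz]
      simp only
      rw [Complex.exp_add, hB' z hz, Complex.exp_sub, hA' u hu.1, hB' u hu.2, div_self, mul_one]
      rw [← hA' u hu.1]
      exact Complex.exp_ne_zero _

lemma LP_union {A B : Set Plane} (hA : IsClosed A) (hB : IsClosed B) {u : Plane}
    (hAB : A ∩ B = {u}) (hLA : LP A) (hLB : LP B) : LP (A ∪ B) := by
  intro f hf hf0
  obtain ⟨gA, h1, h2⟩ := hLA f (hf.mono subset_union_left) (fun z hz => hf0 z (Or.inl hz))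
  obtain ⟨gB, h3, h4⟩ := hLB f (hf.mono subset_union_right) (fun z hz => hf0 z (Or.inr hz))
  exact glue_log hA hB (u := u) (v := u) (by rw [hAB]; simp) (by rw [hAB]; simp) h1 h3 h2 h4 rfl

lemma notMem_closure_comp {K : Set Plane} (hK : IsClosed K) {x y : Plane} (hy : y ∉ K)
    (hxy : y ∉ connectedComponentIn Kᶜ x) : y ∉ closure (connectedComponentIn Kᶜ x) := by
  intro h
  obtain ⟨w, hw1, hw2⟩ := mem_closure_iff.mp h _ hK.isOpen_compl.connectedComponentIn
    (mem_connectedComponentIn hy)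
  apply hxy
  rw [connectedComponentIn_eq hw2, ← connectedComponentIn_eq hw1]
  exact mem_connectedComponentIn hy

lemma bounded_or_bounded {K : Set Plane} (hK : IsBounded K) {x y : Plane} (hx : x ∉ K) (hy : y ∉ K)
    (hxy : y ∉ connectedComponentIn Kᶜ x) :
    IsBounded (connectedComponentIn Kᶜ x) ∨ IsBounded (connectedComponentIn Kᶜ y) := by
  obtain ⟨o, ho, -, h⟩ := exists_outer hK
  by_contra! hcon
  have h1 : x ∈ connectedComponentIn Kᶜ o := by
    by_contra h1; exact hcon.1 (h x hx h1)
  have h2 : y ∈ connectedComponentIn Kᶜ o := by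
    by_contra h1; exact hcon.2 (h y hy h1)
  rw [← connectedComponentIn_eq h1] at hxy
  exact hxy h2

/-- Winding obstruction with three points. -/
lemma winding3 {K : Set Plane} (hK : IsClosed K) {x y w : Plane} (hx : x ∉ K) (hy : y ∉ K)
    (hw : w ∉ K) (hxy : y ∉ connectedComponentIn Kᶜ x) (hxw : w ∉ connectedComponentIn Kᶜ x)
    (hb : IsBounded (connectedComponentIn Kᶜ x)) (a b c : ℤ)
    (hlog : HasLog K (fun z => (toC z - toC x) ^ a * ((toC z - toC y) ^ b * (toC z - toC w) ^ c))) :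
    a = 0 := by
  have h1 := notMem_closure_comp hK hy hxy
  have h2 := notMem_closure_comp hK hw hxw
  have hc : ∀ y : Plane, Continuous fun z => toC z - toC y :=
    fun y => toC.continuous.sub continuous_const
  refine winding hK hx hb (fun z => (toC z - toC y) ^ b * (toC z - toC w) ^ c) ?_ ?_ a hlog
  · refine ContinuousOn.mul ?_ ?_
    · exact (hc y).continuousOn.zpow₀ _ (fun z hz => Or.inl (sub_ne h1 hz))
    · exact (hc w).continuousOn.zpow₀ _ (fun z hz => Or.inl (sub_ne h2 hz))
  · intro z hz
    exact mul_ne_zero (zpow_ne_zero _ (sub_ne h1 hz)) (zpow_ne_zero _ (sub_ne h2 hz))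

lemma LP_no_sep {K : Set Plane} (hK : IsCompact K) (hL : LP K) {x y : Plane} (hx : x ∉ K)
    (hy : y ∉ K) : y ∈ connectedComponentIn Kᶜ x := by
  by_contra hxy
  have hyx : x ∉ connectedComponentIn Kᶜ y := by
    intro h
    rw [← connectedComponentIn_eq h] at hxy
    exact hxy (mem_connectedComponentIn hy)
  have hc : ∀ y : Plane, Continuous fun z => toC z - toC y :=
    fun y => toC.continuous.sub continuous_const
  have hl : ∀ x y : Plane, x ∉ K → y ∉ K → HasLog K (fun z => (toC z - toC x) ^ (1 : ℤ) *
      ((toC z - toC y) ^ (0 : ℤ) * (toC z - toC y) ^ (-1 : ℤ))) := by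
    intro x y hx hy
    refine hL _ ?_ ?_
    · refine ContinuousOn.mul ?_ (ContinuousOn.mul ?_ ?_)
      · exact (hc x).continuousOn.zpow₀ _ (fun z hz => Or.inl (sub_ne hx hz))
      · exact (hc y).continuousOn.zpow₀ _ (fun z hz => Or.inl (sub_ne hy hz))
      · exact (hc y).continuousOn.zpow₀ _ (fun z hz => Or.inl (sub_ne hy hz))
    · intro z hz
      exact mul_ne_zero (zpow_ne_zero _ (sub_ne hx hz))
        (mul_ne_zero (zpow_ne_zero _ (sub_ne hy hz)) (zpow_ne_zero _ (sub_ne hy hz)))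
  rcases bounded_or_bounded hK.isBounded hx hy hxy with h | h
  · exact one_ne_zero (winding3 hK.isClosed hx hy hy hxy hxy h 1 0 (-1) (hl x y hx hy))
  · exact one_ne_zero (winding3 hK.isClosed hy hx hx hyx hyx h 1 0 (-1) (hl y x hy hx))

end Part4


section Part5
variable {V : Type} {G : SimpleGraph V} [Finite V]

/-- No edge borders three faces. -/
lemma Drawing.at_most_two {γ : Drawing G} (htri : γ.IsPlaneTriangulation) {e : Sym2 V}
    {F₁ F₂ F₃ : Set Plane} (h₁ : F₁ ∈ γ.faces) (h₂ : F₂ ∈ γ.faces) (h₃ : F₃ ∈ γ.faces)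
    (i₁ : γ.inc e F₁) (i₂ : γ.inc e F₂) (i₃ : γ.inc e F₃) (h12 : F₁ ≠ F₂) (h13 : F₁ ≠ F₃)
    (h23 : F₂ ≠ F₃) : False := by
  have he := i₁.1
  obtain ⟨p, hp⟩ := γ.emap_nonempty he
  obtain ⟨r, hr, hB⟩ := Drawing.exists_ball htri.1 he hp
  have pick : ∀ F ∈ γ.faces, γ.inc e F → ∃ x ∈ F, x ∈ Metric.ball p r := by
    intro F hF hi
    have : p ∈ closure F := frontier_subset_closure (Drawing.emap_subset_frontier htri hF hi hp)
    obtain ⟨x, hx1, hx2⟩ := mem_closure_iff.mp this _ Metric.isOpen_ball (Metric.mem_ball_self hr)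
    exact ⟨x, hx2, hx1⟩
  obtain ⟨x₁, hx₁, hb₁⟩ := pick F₁ h₁ i₁
  obtain ⟨x₂, hx₂, hb₂⟩ := pick F₂ h₂ i₂
  obtain ⟨x₃, hx₃, hb₃⟩ := pick F₃ h₃ i₃
  have hI₁ := Drawing.face_subset h₁ hx₁
  have hI₂ := Drawing.face_subset h₂ hx₂
  have hI₃ := Drawing.face_subset h₃ hx₃
  set I := γ.totalImage with hI
  have hIc : IsClosed I := γ.isClosed_total
  have hJc : IsClosed (γ.J e) := (γ.isCompact_J e).isClosed
  have hcc : IsClosed (γ.cl e) := (γ.isCompact_cl he).isClosed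
  have hIJ : I = γ.J e ∪ γ.cl e := γ.total_eq_J he
  have hc : ∀ y : Plane, Continuous fun z => toC z - toC y :=
    fun y => toC.continuous.sub continuous_const
  have hJI : γ.J e ⊆ I := by rw [hIJ]; exact subset_union_left
  have hcI : γ.cl e ⊆ I := by rw [hIJ]; exact subset_union_right
  -- the ends
  obtain ⟨u, v, huv⟩ : ∃ u v, e = s(u, v) := by
    induction e with | _ u v
    exact ⟨u, v, rfl⟩
  have hJcl : γ.J e ∩ γ.cl e = {γ.vmap u, γ.vmap v} := by
    rw [Drawing.J_inter_cl htri.1 he, huv]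
    ext z
    simp only [Sym2.mem_iff, mem_image, mem_ofPred_eq, mem_insert_iff, mem_singleton_iff]
    constructor
    · rintro ⟨w, rfl | rfl, rfl⟩ <;> simp
    · rintro (rfl | rfl)
      · exact ⟨u, Or.inl rfl, rfl⟩
      · exact ⟨v, Or.inr rfl, rfl⟩
  have huJ : γ.vmap u ∈ γ.J e ∩ γ.cl e := by rw [hJcl]; simp
  have hvJ : γ.vmap v ∈ γ.J e ∩ γ.cl e := by rw [hJcl]; simp
  -- the logarithms
  have logs : ∀ x, x ∈ Metric.ball p r → x ∉ I → ∃ (a b : Plane → ℂ) (d : ℤ),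
      ContinuousOn a (γ.J e) ∧ ContinuousOn b (γ.cl e) ∧
      (∀ z ∈ γ.J e, Complex.exp (a z) = (toC z - toC x) / (toC z - toC x₃)) ∧
      (∀ z ∈ γ.cl e, Complex.exp (b z) = (toC z - toC x) / (toC z - toC x₃)) ∧
      (a (γ.vmap u) - b (γ.vmap u)) - (a (γ.vmap v) - b (γ.vmap v)) =
        d * (2 * Real.pi * Complex.I) := by
    intro x hxb hxI
    obtain ⟨a, ha, ha'⟩ := hasLog_of_connected hJc (convex_ball p r).isPreconnected hB hxb hb₃
    obtain ⟨b, hb, hb'⟩ := γ.LP_cl he (fun z => (toC z - toC x) / (toC z - toC x₃))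
      ((hc x).continuousOn.div (hc x₃).continuousOn (fun z hz => sub_ne hI₃ (hcI hz)))
      (fun z hz => div_ne_zero (sub_ne hxI (hcI hz)) (sub_ne hI₃ (hcI hz)))
    obtain ⟨n, hn⟩ := Complex.exp_eq_exp_iff_exists_int.mp
      ((ha' _ huJ.1).trans (hb' _ huJ.2).symm)
    obtain ⟨m, hm⟩ := Complex.exp_eq_exp_iff_exists_int.mp
      ((ha' _ hvJ.1).trans (hb' _ hvJ.2).symm)
    refine ⟨a, b, n - m, ha, hb, ha', hb', ?_⟩
    push_cast
    rw [hn, hm]; ring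
  obtain ⟨a₁, b₁, d₁, ha₁, hbc₁, hea₁, heb₁, hd₁⟩ := logs x₁ hb₁ hI₁
  obtain ⟨a₂, b₂, d₂, ha₂, hbc₂, hea₂, heb₂, hd₂⟩ := logs x₂ hb₂ hI₂
  obtain ⟨n₁, n₂, hn, hnd⟩ : ∃ n₁ n₂ : ℤ, (n₁ ≠ 0 ∨ n₂ ≠ 0) ∧ n₁ * d₁ + n₂ * d₂ = 0 := by
    by_cases h : d₁ = 0
    · exact ⟨1, 0, Or.inl one_ne_zero, by rw [h]; ring⟩
    · exact ⟨d₂, -d₁, Or.inr (neg_ne_zero.mpr h), by ring⟩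
  have hnd' : (n₁ : ℂ) * d₁ + n₂ * d₂ = 0 := by exact_mod_cast hnd
  have hlog : HasLog I (fun z => ((toC z - toC x₁) / (toC z - toC x₃)) ^ n₁ *
      ((toC z - toC x₂) / (toC z - toC x₃)) ^ n₂) := by
    rw [hIJ]
    refine glue_log hJc hcc (u := γ.vmap u) (v := γ.vmap v) hJcl.subset huJ
      (gA := fun z => n₁ * a₁ z + n₂ * a₂ z) (gB := fun z => n₁ * b₁ z + n₂ * b₂ z)
      ((continuousOn_const.mul ha₁).add (continuousOn_const.mul ha₂))
      ((continuousOn_const.mul hbc₁).add (continuousOn_const.mul hbc₂)) ?_ ?_ ?_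
    · intro z hz
      rw [Complex.exp_add, Complex.exp_int_mul, Complex.exp_int_mul, hea₁ z hz, hea₂ z hz]
    · intro z hz
      rw [Complex.exp_add, Complex.exp_int_mul, Complex.exp_int_mul, heb₁ z hz, heb₂ z hz]
    · linear_combination n₁ * hd₁ + n₂ * hd₂ + (2 * Real.pi * Complex.I) * hnd'
  have hf₁ : F₁ = connectedComponentIn Iᶜ x₁ := Drawing.face_eq h₁ hx₁
  have hf₂ : F₂ = connectedComponentIn Iᶜ x₂ := Drawing.face_eq h₂ hx₂
  have hf₃ : F₃ = connectedComponentIn Iᶜ x₃ := Drawing.face_eq h₃ hx₃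
  have sep : ∀ {F F' : Set Plane}, F ∈ γ.faces → F' ∈ γ.faces → F ≠ F' → ∀ {x x'}, x ∈ F → x' ∈ F' →
      F = connectedComponentIn Iᶜ x → x' ∉ connectedComponentIn Iᶜ x := by
    intro F F' hF hF' hne x x' hx hx' hfx h
    rw [← hfx] at h
    exact hne (Drawing.face_eq_of_mem hF hF' h hx')
  have hexp : ∀ z ∈ I, ((toC z - toC x₁) / (toC z - toC x₃)) ^ n₁ *
      ((toC z - toC x₂) / (toC z - toC x₃)) ^ n₂ =
      (toC z - toC x₁) ^ n₁ * ((toC z - toC x₂) ^ n₂ * (toC z - toC x₃) ^ (-n₁ - n₂)) := by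
    intro z hz
    have h0 := sub_ne hI₃ hz
    rw [div_zpow, div_zpow, zpow_sub₀ h0, zpow_neg]
    field_simp
  -- at least two of three exponents vanish
  have z₁ : IsBounded F₁ → n₁ = 0 := fun hb =>
    winding3 hIc hI₁ hI₂ hI₃ (sep h₁ h₂ h12 hx₁ hx₂ hf₁) (sep h₁ h₃ h13 hx₁ hx₃ hf₁)
      (hf₁ ▸ hb) n₁ n₂ (-n₁ - n₂) (hlog.congr hexp)
  have z₂ : IsBounded F₂ → n₂ = 0 := fun hb =>
    winding3 hIc hI₂ hI₁ hI₃ (sep h₂ h₁ h12.symm hx₂ hx₁ hf₂) (sep h₂ h₃ h23 hx₂ hx₃ hf₂)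
      (hf₂ ▸ hb) n₂ n₁ (-n₁ - n₂) (hlog.congr (fun z hz => (hexp z hz).trans (by ring)))
  have z₃ : IsBounded F₃ → -n₁ - n₂ = 0 := fun hb =>
    winding3 hIc hI₃ hI₁ hI₂ (sep h₃ h₁ h13.symm hx₃ hx₁ hf₃) (sep h₃ h₂ h23.symm hx₃ hx₂ hf₃)
      (hf₃ ▸ hb) (-n₁ - n₂) n₁ n₂ (hlog.congr (fun z hz => (hexp z hz).trans (by ring)))
  have hIb : IsBounded I := γ.isCompact_total.isBounded
  have b12 := bounded_or_bounded hIb hI₁ hI₂ (sep h₁ h₂ h12 hx₁ hx₂ hf₁)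
  have b13 := bounded_or_bounded hIb hI₁ hI₃ (sep h₁ h₃ h13 hx₁ hx₃ hf₁)
  have b23 := bounded_or_bounded hIb hI₂ hI₃ (sep h₂ h₃ h23 hx₂ hx₃ hf₂)
  rw [← hf₁, ← hf₂] at b12
  rw [← hf₁, ← hf₃] at b13
  rw [← hf₂, ← hf₃] at b23
  rcases b12 with b1 | b2
  · have := z₁ b1
    rcases b23 with b2 | b3
    · have := z₂ b2; omega
    · have := z₃ b3; omega
  · have := z₂ b2
    rcases b13 with b1 | b3
    · have := z₁ b1; omega
    · have := z₃ b3; omega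

/-- Every edge borders a second face. -/
lemma Drawing.at_least_two {γ : Drawing G} (htri : γ.IsPlaneTriangulation)
    (hV : 3 < Nat.card V) {e : Sym2 V} {F : Set Plane} (hF : F ∈ γ.faces) (hi : γ.inc e F) :
    ∃ F' ∈ γ.faces, γ.inc e F' ∧ F' ≠ F := by
  by_contra! hcon
  have he := hi.1
  obtain ⟨hcard, hadj, hfr⟩ := Drawing.face_spec htri hF
  obtain ⟨a, b, hab⟩ : ∃ u v, e = s(u, v) := by
    induction e with | _ u v
    exact ⟨u, v, rfl⟩
  have haF : a ∈ γ.fv F := hi.2 a (by simp [hab])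
  have hbF : b ∈ γ.fv F := hi.2 b (by simp [hab])
  have hne : a ≠ b := by
    rw [hab] at he; exact G.ne_of_adj he
  obtain ⟨w, hw, hwa, hwb⟩ : ∃ w ∈ γ.fv F, w ≠ a ∧ w ≠ b := by
    by_contra! h
    have : γ.fv F ⊆ {a, b} := by
      intro w hw
      by_cases hwa : w = a
      · simp [hwa]
      · simp [h w hw hwa]
    have := ncard_le_ncard this
    rw [hcard, ncard_pair hne] at this
    omega
  have hfv : γ.fv F = {a, b, w} := by
    symm
    apply eq_of_subset_of_ncard_le
    · intro z hz
      rcases hz with rfl | rfl | rfl <;> assumption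
    · rw [hcard, ncard_eq_three.mpr ⟨a, b, w, hne, hwa.symm, hwb.symm, rfl⟩]
    · exact toFinite _
  have haw : G.Adj a w := hadj a haF w hw hwa.symm
  have hbw : G.Adj b w := hadj b hbF w hw hwb.symm
  set P := γ.cl s(a, w) ∪ γ.cl s(b, w) with hP
  have hcl : γ.cl s(a, w) ∩ γ.cl s(b, w) = {γ.vmap w} := by
    ext z
    constructor
    · rintro ⟨h1 | ⟨c, hc, rfl⟩, h2 | ⟨d, hd, h2⟩⟩
      · have := Drawing.emap_disj htri.1 (e := s(a, w)) (e' := s(b, w)) haw hbw h1 h2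
        simp only [Sym2.eq_iff] at this
        tauto
      · subst h2; exact absurd h1 (γ.avoid _ haw d)
      · exact absurd h2 (γ.avoid _ hbw c)
      · have := γ.vmap_inj h2
        subst this
        simp only [Sym2.mem_iff, mem_ofPred_eq] at hc hd
        rcases hd with rfl | rfl
        · rcases hc with h | h
          · exact absurd h.symm hne
          · exact absurd h.symm hwb
        · rfl
    · rintro rfl
      exact ⟨Or.inr ⟨w, by simp, rfl⟩, Or.inr ⟨w, by simp, rfl⟩⟩
  have hPc : IsCompact P := (γ.isCompact_cl haw).union (γ.isCompact_cl hbw)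
  have hPL : LP P := LP_union (γ.isCompact_cl haw).isClosed (γ.isCompact_cl hbw).isClosed hcl
    (γ.LP_cl haw) (γ.LP_cl hbw)
  have hPI : P ⊆ γ.totalImage := by
    rw [γ.total_eq]
    rintro z (h | h) <;> right <;> simp only [mem_iUnion]
    · exact ⟨_, haw, h⟩
    · exact ⟨_, hbw, h⟩
  have hfrP : frontier F = γ.emap e ∪ P := by
    apply subset_antisymm
    · rw [hfr]
      rintro z (⟨c, hc, rfl⟩ | h)
      · right
        rw [hfv] at hc
        rcases hc with rfl | rfl | rfl
        · left; right; exact ⟨_, by simp, rfl⟩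
        · right; right; exact ⟨_, by simp, rfl⟩
        · left; right; exact ⟨_, by simp, rfl⟩
      · simp only [mem_iUnion] at h
        obtain ⟨e', he', hz⟩ := h
        obtain ⟨he', hev⟩ := he'
        rw [hfv] at hev
        induction e' with | _ c d
        have hcd : c ≠ d := G.ne_of_adj he'
        have hc := hev c (by simp)
        have hd := hev d (by simp)
        simp only [mem_insert_iff, mem_singleton_iff] at hc hd
        rcases hc with rfl | rfl | rfl <;> rcases hd with rfl | rfl | rfl
        · exact absurd rfl hcd
        · left; rw [hab]; exact hz
        · right; left; left; exact hz
        · left; rw [hab, Sym2.eq_swap]; exact hz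
        · exact absurd rfl hcd
        · right; right; left; exact hz
        · right; left; left; rw [Sym2.eq_swap]; exact hz
        · right; right; left; rw [Sym2.eq_swap]; exact hz
        · exact absurd rfl hcd
    · rintro z (h | (h | ⟨c, hc, rfl⟩) | (h | ⟨c, hc, rfl⟩))
      · exact Drawing.emap_subset_frontier htri hF hi h
      · exact Drawing.emap_subset_frontier htri hF
          ⟨haw, by simp only [Sym2.mem_iff]; rintro v (rfl | rfl) <;> assumption⟩ h
      · simp only [Sym2.mem_iff, mem_ofPred_eq] at hc
        rcases hc with rfl | rfl
        · exact haF
        · exact hw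
      · exact Drawing.emap_subset_frontier htri hF
          ⟨hbw, by simp only [Sym2.mem_iff]; rintro v (rfl | rfl) <;> assumption⟩ h
      · simp only [Sym2.mem_iff, mem_ofPred_eq] at hc
        rcases hc with rfl | rfl
        · exact hbF
        · exact hw
  have hFo := Drawing.face_isOpen hF
  have hclF : closure F = F ∪ γ.emap e ∪ P := by
    rw [closure_eq_self_union_frontier, hfrP, union_assoc]
  -- `F ∪ emap e` is open
  have hopen : IsOpen (F ∪ γ.emap e) := by
    rw [Metric.isOpen_iff]
    rintro z (hz | hz)
    · obtain ⟨r, hr, h⟩ := Metric.isOpen_iff.mp hFo z hz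
      exact ⟨r, hr, h.trans subset_union_left⟩
    · obtain ⟨r, hr, h⟩ := Drawing.exists_ball htri.1 he hz
      refine ⟨r, hr, ?_⟩
      intro y hy
      by_cases hyI : y ∈ γ.totalImage
      · exact Or.inr (Drawing.mem_emap_of he hyI (h hy))
      · left
        obtain ⟨F', hF', hyF'⟩ := γ.exists_face hyI
        have := hcon F' hF' (Drawing.inc_of_ball htri hF' he hz hr h ⟨y, hy, hyF'⟩)
        rw [← this]; exact hyF'
  obtain ⟨x, hx⟩ := Drawing.face_nonempty hF
  have hxP : x ∉ P := fun h => Drawing.face_subset hF hx (hPI h)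
  have hall : ∀ y, y ∉ P → y ∈ F ∪ γ.emap e := by
    intro y hyP
    by_contra hy
    have hcomp := LP_no_sep hPc hPL hxP hyP
    obtain ⟨z, hz, hz1, hz2⟩ := (isPreconnected_connectedComponentIn (F := Pᶜ) (x := x))
      (F ∪ γ.emap e) (closure F)ᶜ hopen isClosed_closure.isOpen_compl (by
        intro z hz
        have hzP : z ∉ P := connectedComponentIn_subset _ _ hz
        by_cases h : z ∈ F ∪ γ.emap e
        · exact Or.inl h
        · right
          rw [hclF]
          rintro (h' | h')
          · exact h h'
          · exact hzP h')
      ⟨x, mem_connectedComponentIn hxP, Or.inl hx⟩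
      ⟨y, hcomp, by
        rw [hclF]
        rintro (h' | h')
        · exact hy h'
        · exact hyP h'⟩
    apply hz2
    rw [hclF]
    exact Or.inl hz1
  have hVsub : (univ : Set V) ⊆ γ.fv F := by
    intro v _
    by_cases hv : γ.vmap v ∈ P
    · change γ.vmap v ∈ frontier F
      rw [hfrP]; exact Or.inr hv
    · rcases hall _ hv with h | h
      · exact absurd (Or.inl ⟨v, rfl⟩) (Drawing.face_subset hF h)
      · exact absurd h (γ.avoid e he v)
  have := ncard_le_ncard hVsub
  rw [hcard, ncard_univ] at this
  omega

lemma Drawing.exists_inc_of_face {γ : Drawing G} (htri : γ.IsPlaneTriangulation)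
    {F : Set Plane} (hF : F ∈ γ.faces) : ∃ e ∈ G.edgeSet, γ.inc e F := by
  obtain ⟨hcard, hadj, -⟩ := Drawing.face_spec htri hF
  obtain ⟨a, b, c, hab, -, -, h⟩ := ncard_eq_three.mp hcard
  have ha : a ∈ γ.fv F := by rw [h]; simp
  have hb : b ∈ γ.fv F := by rw [h]; simp
  refine ⟨s(a, b), hadj a ha b hb hab, hadj a ha b hb hab, ?_⟩
  simp only [Sym2.mem_iff]
  rintro v (rfl | rfl) <;> assumption

lemma Drawing.faces_finite {γ : Drawing G} (htri : γ.IsPlaneTriangulation) : γ.faces.Finite := by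
  have h1 : γ.faces ⊆ ⋃ e ∈ G.edgeSet, {F | F ∈ γ.faces ∧ γ.inc e F} := by
    intro F hF
    obtain ⟨e, he, hi⟩ := Drawing.exists_inc_of_face htri hF
    simp only [mem_iUnion]
    exact ⟨e, he, hF, hi⟩
  refine Finite.subset (Finite.biUnion (toFinite _) ?_) h1
  intro e he
  obtain ⟨F₁, h₁, i₁⟩ := Drawing.exists_inc htri he
  by_cases h : ∃ F₂ ∈ γ.faces, γ.inc e F₂ ∧ F₂ ≠ F₁
  · obtain ⟨F₂, h₂, i₂, hne⟩ := h
    refine (toFinite {F₁, F₂}).subset ?_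
    rintro F ⟨hF, hi⟩
    by_contra hcon
    simp only [mem_insert_iff, mem_singleton_iff, not_or] at hcon
    exact Drawing.at_most_two htri hF h₁ h₂ hi i₁ i₂ hcon.1 hcon.2 hne.symm
  · push Not at h
    refine (toFinite {F₁}).subset ?_
    rintro F ⟨hF, hi⟩
    exact h F hF hi

lemma Drawing.cover {γ : Drawing G} (htri : γ.IsPlaneTriangulation) (z : Plane) :
    ∃ F ∈ γ.faces, z ∈ closure F := by
  have hcl : IsClosed (⋃ F ∈ γ.faces, closure F) :=
    (Drawing.faces_finite htri).isClosed_biUnion (fun F _ => isClosed_closure)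
  have hd : Dense (γ.totalImageᶜ) := interior_eq_empty_iff_dense_compl.mp γ.interior_total
  have hsub : γ.totalImageᶜ ⊆ ⋃ F ∈ γ.faces, closure F := by
    intro w hw
    obtain ⟨F, hF, hwF⟩ := γ.exists_face hw
    simp only [mem_iUnion]
    exact ⟨F, hF, subset_closure hwF⟩
  have := (hcl.closure_subset_iff.mpr hsub) (hd z)
  simpa only [mem_iUnion, exists_prop] using this

end Part5


section Part6
variable {V : Type} {G : SimpleGraph V} [Finite V]

/-- The union of the closures of a set of faces. -/
def Drawing.reg (γ : Drawing G) (S : Set (Set Plane)) : Set Plane :=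
  ⋃ F ∈ γ.faces ∩ S, closure F

lemma Drawing.isClosed_reg {γ : Drawing G} (htri : γ.IsPlaneTriangulation) (S : Set (Set Plane)) :
    IsClosed (γ.reg S) :=
  ((Drawing.faces_finite htri).subset inter_subset_left).isClosed_biUnion
    (fun F _ => isClosed_closure)

lemma Drawing.reg_cover {γ : Drawing G} (htri : γ.IsPlaneTriangulation) (S : Set (Set Plane))
    (z : Plane) : z ∈ γ.reg S ∪ γ.reg Sᶜ := by
  obtain ⟨F, hF, hz⟩ := Drawing.cover htri z
  by_cases h : F ∈ S
  · left; simp only [Drawing.reg, mem_iUnion]; exact ⟨F, ⟨hF, h⟩, hz⟩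
  · right; simp only [Drawing.reg, mem_iUnion]; exact ⟨F, ⟨hF, h⟩, hz⟩

/-- A common point of the two regions is either a vertex or on a common edge. -/
lemma Drawing.reg_inter {γ : Drawing G} (htri : γ.IsPlaneTriangulation) {S : Set (Set Plane)}
    {z : Plane} (h1 : z ∈ γ.reg S) (h2 : z ∈ γ.reg Sᶜ) :
    ∃ F ∈ γ.faces, ∃ F' ∈ γ.faces, F ∈ S ∧ F' ∉ S ∧ z ∈ frontier F ∧ z ∈ frontier F' ∧
    ((∃ v, z = γ.vmap v ∧ v ∈ γ.fv F ∧ v ∈ γ.fv F') ∨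
      ∃ e ∈ G.edgeSet, z ∈ γ.emap e ∧ γ.inc e F ∧ γ.inc e F') := by
  simp only [Drawing.reg, mem_iUnion] at h1 h2
  obtain ⟨F, ⟨hF, hFS⟩, hz⟩ := h1
  obtain ⟨F', ⟨hF', hFS'⟩, hz'⟩ := h2
  have hzI : z ∈ γ.totalImage := by
    by_contra h
    have a := Drawing.mem_face_of_closure hF hz h
    have b := Drawing.mem_face_of_closure hF' hz' h
    exact hFS' (Drawing.face_eq_of_mem hF hF' a b ▸ hFS)
  have f := Drawing.mem_frontier_of_closure hF hz hzI
  have f' := Drawing.mem_frontier_of_closure hF' hz' hzI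
  refine ⟨F, hF, F', hF', hFS, hFS', f, f', ?_⟩
  rcases hzI with ⟨v, rfl⟩ | h
  · exact Or.inl ⟨v, rfl, f, f'⟩
  · simp only [mem_iUnion] at h
    obtain ⟨e, he, hze⟩ := h
    exact Or.inr ⟨e, he, hze, Drawing.inc_of_mem htri hF he hze f,
      Drawing.inc_of_mem htri hF' he hze f'⟩

lemma Drawing.link {γ : Drawing G} (htri : γ.IsPlaneTriangulation) {S : Set (Set Plane)} {v : V}
    (hS : ∀ e ∈ G.edgeSet, v ∈ e → ∀ F ∈ γ.faces, ∀ F' ∈ γ.faces, γ.inc e F → γ.inc e F' →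
      F ∈ S → F' ∈ S) {F F' : Set Plane} (hF : F ∈ γ.faces) (hF' : F' ∈ γ.faces)
    (hv : v ∈ γ.fv F) (hv' : v ∈ γ.fv F') (hFS : F ∈ S) : F' ∈ S := by
  by_contra hFS'
  have hK : IsClosed (γ.vmap '' {v}ᶜ ∪ ⋃ e ∈ {e | e ∈ G.edgeSet ∧ v ∉ e}, γ.cl e) := by
    refine (toFinite _).isClosed.union ?_
    exact (toFinite {e | e ∈ G.edgeSet ∧ v ∉ e}).isClosed_biUnion
      (fun e he => (γ.isCompact_cl he.1).isClosed)
  have hvK : γ.vmap v ∉ γ.vmap '' {v}ᶜ ∪ ⋃ e ∈ {e | e ∈ G.edgeSet ∧ v ∉ e}, γ.cl e := by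
    rintro (⟨w, hw, h⟩ | h)
    · exact hw (γ.vmap_inj h)
    · simp only [mem_iUnion] at h
      obtain ⟨e, ⟨he, hve⟩, h⟩ := h
      exact hve ((γ.vmap_mem_cl he).mp h)
  obtain ⟨r, hr, hB⟩ := Metric.isOpen_iff.mp hK.isOpen_compl _ hvK
  have pick : ∀ F ∈ γ.faces, v ∈ γ.fv F → ∃ x ∈ F, x ∈ Metric.ball (γ.vmap v) r \ {γ.vmap v} := by
    intro F hF hv
    have : γ.vmap v ∈ closure F := frontier_subset_closure hv
    obtain ⟨x, hx1, hx2⟩ := mem_closure_iff.mp this _ Metric.isOpen_ball (Metric.mem_ball_self hr)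
    refine ⟨x, hx2, hx1, ?_⟩
    rintro rfl
    exact Drawing.face_subset hF hx2 (Or.inl ⟨v, rfl⟩)
  obtain ⟨x, hxF, hx⟩ := pick F hF hv
  obtain ⟨x', hxF', hx'⟩ := pick F' hF' hv'
  have hpre := isPreconnected_ball_diff (γ.vmap v) r
  obtain ⟨z, ⟨hz, hzv⟩, hz1, hz2⟩ := isPreconnected_closed_iff.mp hpre (γ.reg S) (γ.reg Sᶜ)
    (Drawing.isClosed_reg htri S) (Drawing.isClosed_reg htri Sᶜ)
    (fun z _ => Drawing.reg_cover htri S z)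
    ⟨x, hx, by simp only [Drawing.reg, mem_iUnion]; exact ⟨F, ⟨hF, hFS⟩, subset_closure hxF⟩⟩
    ⟨x', hx', by simp only [Drawing.reg, mem_iUnion]; exact ⟨F', ⟨hF', hFS'⟩, subset_closure hxF'⟩⟩
  obtain ⟨A, hA, B, hB', hAS, hBS, -, -, ⟨w, rfl, -, -⟩ | ⟨e, he, hze, iA, iB⟩⟩ :=
    Drawing.reg_inter htri hz1 hz2
  · apply hB hz
    left
    exact ⟨w, fun h => hzv (by rw [mem_singleton_iff.mp h]; rfl), rfl⟩
  · by_cases hve : v ∈ e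
    · exact hBS (hS e he hve A hA B hB' iA iB hAS)
    · apply hB hz
      right
      simp only [mem_iUnion]
      exact ⟨e, ⟨he, hve⟩, Or.inl hze⟩

/-- The dual graph is connected. -/
lemma Drawing.dual_conn {γ : Drawing G} (htri : γ.IsPlaneTriangulation) {S : Set (Set Plane)}
    (hS : ∀ e ∈ G.edgeSet, ∀ F ∈ γ.faces, ∀ F' ∈ γ.faces, γ.inc e F → γ.inc e F' →
      F ∈ S → F' ∈ S) {F F' : Set Plane} (hF : F ∈ γ.faces) (hF' : F' ∈ γ.faces)
    (hFS : F ∈ S) : F' ∈ S := by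
  by_contra hFS'
  obtain ⟨x, hxF⟩ := Drawing.face_nonempty hF
  obtain ⟨x', hxF'⟩ := Drawing.face_nonempty hF'
  obtain ⟨z, -, hz1, hz2⟩ := isPreconnected_closed_iff.mp (isPreconnected_univ (α := Plane))
    (γ.reg S) (γ.reg Sᶜ)
    (Drawing.isClosed_reg htri S) (Drawing.isClosed_reg htri Sᶜ)
    (fun z _ => Drawing.reg_cover htri S z)
    ⟨x, mem_univ _, by
      simp only [Drawing.reg, mem_iUnion]; exact ⟨F, ⟨hF, hFS⟩, subset_closure hxF⟩⟩
    ⟨x', mem_univ _, by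
      simp only [Drawing.reg, mem_iUnion]; exact ⟨F', ⟨hF', hFS'⟩, subset_closure hxF'⟩⟩
  obtain ⟨A, hA, B, hB', hAS, hBS, -, -, ⟨w, rfl, wA, wB⟩ | ⟨e, he, hze, iA, iB⟩⟩ :=
    Drawing.reg_inter htri hz1 hz2
  · exact hBS (Drawing.link htri (fun e he _ => hS e he) hA hB' wA wB hAS)
  · exact hBS (hS e he A hA B hB' iA iB hAS)

/-- The region of a set of bounded faces whose boundary is covered by `C`. -/
lemma Drawing.region {γ : Drawing G} (htri : γ.IsPlaneTriangulation) {S : Set (Set Plane)}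
    {C : G.Subgraph} (hS : ∀ e ∈ G.edgeSet, ∀ F ∈ γ.faces, ∀ F' ∈ γ.faces, γ.inc e F →
      γ.inc e F' → F ∈ S → F' ∉ S → e ∈ C.edgeSet)
    (hb : ∀ F ∈ γ.faces, F ∈ S → IsBounded F) {F : Set Plane} (hF : F ∈ γ.faces) (hFS : F ∈ S) :
    closure F ⊆ closedRegion (γ.image C) := by
  intro z hz
  by_cases hzC : z ∈ γ.image C
  · exact Or.inl hzC
  right
  refine ⟨hzC, ?_⟩
  have hbd : IsBounded (γ.reg S) := by
    refine (isBounded_biUnion ((Drawing.faces_finite htri).subset inter_subset_left)).mpr ?_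
    intro F hF
    exact (hb F hF.1 hF.2).closure
  refine hbd.subset ?_
  by_contra hns
  rw [not_subset] at hns
  obtain ⟨y, hy, hyS⟩ := hns
  have hzS : z ∈ γ.reg S := by
    simp only [Drawing.reg, mem_iUnion]; exact ⟨F, ⟨hF, hFS⟩, hz⟩
  obtain ⟨w, hw, hw1, hw2⟩ := isPreconnected_closed_iff.mp
    (isPreconnected_connectedComponentIn (F := (γ.image C)ᶜ) (x := z))
    (γ.reg S) (γ.reg Sᶜ)
    (Drawing.isClosed_reg htri S) (Drawing.isClosed_reg htri Sᶜ)
    (fun z _ => Drawing.reg_cover htri S z) ⟨z, mem_connectedComponentIn hzC, hzS⟩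
    ⟨y, hy, (Drawing.reg_cover htri S y).resolve_left hyS⟩
  have hwC : w ∉ γ.image C := connectedComponentIn_subset _ _ hw
  obtain ⟨A, hA, B, hB', hAS, hBS, -, -, ⟨v, rfl, wA, wB⟩ | ⟨e, he, hze, iA, iB⟩⟩ :=
    Drawing.reg_inter htri hw1 hw2
  · apply hBS
    refine Drawing.link htri ?_ hA hB' wA wB hAS
    intro e he hve F₁ hF₁ F₂ hF₂ i₁ i₂ hS₁
    by_contra hS₂
    apply hwC
    left
    refine ⟨v, ?_, rfl⟩
    have := hS e he F₁ hF₁ F₂ hF₂ i₁ i₂ hS₁ hS₂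
    exact C.mem_verts_of_mem_edge this hve
  · apply hwC
    right
    simp only [mem_iUnion]
    exact ⟨e, hS e he A hA B hB' iA iB hAS hBS, hze⟩

/-- The outer face. -/
lemma Drawing.exists_outer_face (γ : Drawing G) :
    ∃ o ∈ γ.faces, ∀ F ∈ γ.faces, F ≠ o → IsBounded F := by
  obtain ⟨x, hx, hu, h⟩ := exists_outer γ.isCompact_total.isBounded
  refine ⟨_, ⟨x, hx, rfl⟩, ?_⟩
  rintro _ ⟨y, hy, rfl⟩ hne
  apply h y hy
  intro hyx
  exact hne (connectedComponentIn_eq hyx).symm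

end Part6


section Part7
section SignLift
variable {E : Type} [NormedAddCommGroup E] [NormedSpace ℝ E]

/-- Nonzero vectors. -/
abbrev NZ (E : Type) [Zero E] : Type := {p : E // p ≠ 0}

instance signAct : MulAction ℤˣ (NZ E) where
  smul s p := ⟨(s : ℤ) • p.1, by
    rcases Int.units_eq_one_or s with rfl | rfl
    · simpa using p.2
    · simpa using p.2⟩
  one_smul p := Subtype.ext (by change ((1 : ℤˣ) : ℤ) • p.1 = p.1; simp)
  mul_smul s t p := Subtype.ext (by
    change ((s * t : ℤˣ) : ℤ) • p.1 = (s : ℤ) • (t : ℤ) • p.1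
    rw [smul_smul]; simp)

lemma signAct_val (s : ℤˣ) (p : NZ E) : (s • p).1 = (s : ℤ) • p.1 := rfl

lemma sign_cov : IsQuotientCoveringMap
    (Quotient.mk (MulAction.orbitRel ℤˣ (NZ E))) ℤˣ := by
  refine ⟨isQuotientMap_quotient_mk', ⟨fun s => ?_⟩, ?_, ?_⟩
  · refine Continuous.subtype_mk (f := fun p : NZ E => (s : ℤ) • p.1) ?_ _
    exact (continuous_const_smul (s : ℤ)).comp continuous_subtype_val
  · intro a b
    rw [Quotient.eq]; rfl
  · intro p
    refine ⟨{q | ‖q.1 - p.1‖ < ‖p.1‖}, ?_, ?_⟩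
    · refine IsOpen.mem_nhds ?_ ?_
      · exact isOpen_lt (by fun_prop) continuous_const
      · simpa using p.2
    · rintro g ⟨_, ⟨q, hq, rfl⟩, hq'⟩
      rcases Int.units_eq_one_or g with rfl | rfl
      · rfl
      · exfalso
        simp only [mem_ofPred_eq, signAct_val] at hq hq'
        have : ‖(2:ℝ) • p.1‖ < 2 * ‖p.1‖ := by
          have e : (2:ℝ) • p.1 = -(q.1 - p.1) - ((-1 : ℤˣ) • q.1 - p.1) := by
            rw [two_smul]; simp; abel
          rw [e]
          have := norm_sub_le (-(q.1 - p.1)) ((-1 : ℤˣ) • q.1 - p.1)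
          rw [norm_neg] at this
          have h2 : ‖(-1 : ℤˣ) • q.1 - p.1‖ < ‖p.1‖ := hq'
          linarith
        rw [norm_smul] at this; norm_num at this

lemma sign_lift {ι : Type} [Finite ι] (A : ι → Set Plane) (hA : ∀ i, IsClosed (A i))
    (hcov : ∀ z, ∃ i, z ∈ A i) (H : ι → Plane → E) (hH : ∀ i, ContinuousOn (H i) (A i))
    (h0 : ∀ i, ∀ z ∈ A i, H i z ≠ 0)
    (hc : ∀ i j z, z ∈ A i → z ∈ A j → H i z = H j z ∨ H i z = - H j z) :
    ∃ L : Plane → E, Continuous L ∧ ∀ i, ∀ z ∈ A i, L z = H i z ∨ L z = - H i z := by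
  classical
  let q := Quotient.mk (MulAction.orbitRel ℤˣ (NZ E))
  choose c hcc using hcov
  let f : Plane → Quotient (MulAction.orbitRel ℤˣ (NZ E)) :=
    fun z => q ⟨H (c z) z, h0 _ _ (hcc z)⟩
  have hq : ∀ a b : NZ E, q a = q b ↔ a.1 = b.1 ∨ a.1 = - b.1 := by
    intro a b
    rw [sign_cov.apply_eq_iff_mem_orbit]
    constructor
    · rintro ⟨s, rfl⟩
      rcases Int.units_eq_one_or s with rfl | rfl <;> simp [signAct_val]
    · rintro (h | h)
      · exact ⟨1, Subtype.ext (by simp [h])⟩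
      · exact ⟨-1, Subtype.ext (by simp [h, signAct_val])⟩
  have hf : ∀ i z (hz : z ∈ A i), f z = q ⟨H i z, h0 i z hz⟩ := by
    intro i z hz
    exact (hq _ _).2 (hc _ _ _ (hcc z) hz)
  have hcont : Continuous f := by
    refine LocallyFinite.continuous (f := A) (locallyFinite_of_finite A) ?_ hA ?_
    · exact eq_univ_of_forall fun z => mem_iUnion.2 ⟨c z, hcc z⟩
    · intro i
      rw [continuousOn_iff_continuous_restrict]
      have : (A i).domRestrict f = fun z : A i => q ⟨H i z, h0 i z z.2⟩ := by
        funext z; exact hf i z z.2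
      rw [this]
      exact continuous_quotient_mk'.comp
        (Continuous.subtype_mk (continuousOn_iff_continuous_restrict.1 (hH i)) _)
  obtain ⟨L, ⟨-, hL⟩, -⟩ := sign_cov.isCoveringMap.existsUnique_continuousMap_lifts
    (⟨f, hcont⟩ : C(Plane, _)) 0 ⟨H (c 0) 0, h0 _ _ (hcc 0)⟩ rfl
  refine ⟨fun z => (L z).1, by fun_prop, fun i z hz => ?_⟩
  have := congrFun hL z
  simp only [Function.comp, ContinuousMap.coe_mk] at this
  rw [hf i z hz] at this
  exact (hq _ _).1 this

end SignLift

end Part7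


section Part8
variable {V : Type} {G : SimpleGraph V} [Finite V]

/-- Everything in the drawing off the open star of `v`. -/
def Drawing.Av (γ : Drawing G) (v : V) : Set Plane :=
  γ.vmap '' {w | w ≠ v} ∪ ⋃ e ∈ {e | e ∈ G.edgeSet ∧ v ∉ e}, γ.cl e

/-- The barycentric-like coordinate. -/
def Drawing.lam (γ : Drawing G) (v : V) (x : Plane) : ℝ := Metric.infDist x (γ.Av v)

lemma Drawing.isClosed_Av (γ : Drawing G) (v : V) : IsClosed (γ.Av v) := by
  refine ((toFinite _).isClosed).union ?_
  exact (toFinite _).isClosed_biUnion fun e he => (γ.isCompact_cl he.1).isClosed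

lemma Drawing.lam_continuous (γ : Drawing G) (v : V) : Continuous (γ.lam v) :=
  Metric.continuous_infDist_pt _

lemma Drawing.lam_nonneg (γ : Drawing G) (v : V) (x : Plane) : 0 ≤ γ.lam v x :=
  Metric.infDist_nonneg

lemma Drawing.lam_zero {γ : Drawing G} {v : V} {x : Plane} (h : x ∈ γ.Av v) : γ.lam v x = 0 :=
  Metric.infDist_zero_of_mem h

lemma Drawing.lam_pos {γ : Drawing G} (hV : 3 < Nat.card V) {v : V} {x : Plane}
    (h : x ∉ γ.Av v) : 0 < γ.lam v x := by
  haveI : Nontrivial V := Finite.one_lt_card_iff_nontrivial.1 (by omega)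
  obtain ⟨w, hw⟩ := exists_ne v
  exact ((γ.isClosed_Av v).notMem_iff_infDist_pos ⟨γ.vmap w, Or.inl ⟨w, hw, rfl⟩⟩).1 h

lemma Drawing.vmap_notMem_Av (γ : Drawing G) (v : V) : γ.vmap v ∉ γ.Av v := by
  rintro (⟨w, hw, h⟩ | h)
  · exact hw (γ.vmap_inj h)
  · simp only [mem_iUnion] at h
    obtain ⟨e, ⟨he, hv⟩, h⟩ := h
    exact hv ((γ.vmap_mem_cl he).1 h)

lemma Drawing.emap_notMem_Av {γ : Drawing G} (hX : γ.crossings = ∅) {e : Sym2 V}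
    (he : e ∈ G.edgeSet) {v : V} (hv : v ∈ e) {z : Plane} (hz : z ∈ γ.emap e) : z ∉ γ.Av v := by
  rintro (⟨w, hw, rfl⟩ | h)
  · exact γ.avoid e he w hz
  · simp only [mem_iUnion] at h
    obtain ⟨e', ⟨he', hv'⟩, h⟩ := h
    rcases h with h | ⟨w, hw, rfl⟩
    · exact hv' (Drawing.emap_disj hX he he' hz h ▸ hv)
    · exact γ.avoid e he w hz

lemma sigma_exists {γ : Drawing G} (htri : γ.IsPlaneTriangulation) (s : Sym2 V → ℤˣ)
    (hs : ∀ F ∈ γ.faces, ∀ a ∈ γ.fv F, ∀ b ∈ γ.fv F, ∀ c ∈ γ.fv F, a ≠ b → b ≠ c → a ≠ c →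
      s s(a, b) * s s(b, c) * s s(a, c) = 1) {F : Set Plane} (hF : F ∈ γ.faces) :
    ∃ σ : V → ℤˣ, ∀ a ∈ γ.fv F, ∀ b ∈ γ.fv F, a ≠ b → s s(a, b) = σ a * σ b := by
  classical
  have h3 := (Drawing.face_spec htri hF).1
  obtain ⟨x, hx⟩ : (γ.fv F).Nonempty := nonempty_of_ncard_ne_zero (by omega)
  refine ⟨fun v => if v = x then 1 else s s(x, v), fun a ha b hb hab => ?_⟩
  by_cases h1 : a = x
  · subst h1; simp [hab.symm]
  by_cases h2 : b = x
  · subst h2; simp [hab, Sym2.eq_swap]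
  · have := hs F hF x hx a ha b hb (Ne.symm h1) hab (Ne.symm h2)
    simp only [h1, h2, if_false]
    have e1 := Int.units_mul_self (s s(x, a))
    have e2 := Int.units_mul_self (s s(x, b))
    calc s s(a, b) = s s(x,a) * (s s(x, a) * s s(a, b) * s s(x, b)) * s s(x, b) := by
          rw [show s s(x,a) * (s s(x, a) * s s(a, b) * s s(x, b)) * s s(x, b) =
            (s s(x,a) * s s(x,a)) * s s(a,b) * (s s(x, b) * s s(x, b)) by ac_rfl, e1, e2]; simp
      _ = _ := by rw [this]; simp

lemma unit_real (t : ℤˣ) : (((t : ℤ) : ℝ) = 1 ∨ ((t : ℤ) : ℝ) = -1) := by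
  rcases Int.units_eq_one_or t with rfl | rfl <;> simp

/-- The local model map. -/
def Drawing.Hm (γ : Drawing G) (F : Set Plane) (σ : V → ℤˣ) (x : Plane) : (V → ℝ) × ℝ := by
  classical
  exact (fun v => if v ∈ γ.fv F then ((σ v : ℤ) : ℝ) * γ.lam v x else 0,
    Metric.infDist x γ.totalImage)

lemma Drawing.Hm_fst (γ : Drawing G) {F : Set Plane} (σ : V → ℤˣ) (x : Plane) {v : V}
    (hv : v ∈ γ.fv F) : (γ.Hm F σ x).1 v = ((σ v : ℤ) : ℝ) * γ.lam v x := by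
  simp [Drawing.Hm, hv]

lemma Drawing.Hm_zero (γ : Drawing G) {F : Set Plane} (σ : V → ℤˣ) {x : Plane} {v : V}
    (hv : γ.lam v x = 0) : (γ.Hm F σ x).1 v = 0 := by
  simp [Drawing.Hm, hv]

lemma Drawing.Hm_cont (γ : Drawing G) (F : Set Plane) (σ : V → ℤˣ) : Continuous (γ.Hm F σ) := by
  unfold Drawing.Hm
  refine Continuous.prodMk (continuous_pi fun v => ?_) (Metric.continuous_infDist_pt _)
  by_cases h : v ∈ γ.fv F
  · simp only [h, if_true]; exact continuous_const.mul (γ.lam_continuous v)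
  · simp only [h, if_false]; exact continuous_const

lemma Drawing.frontier_cases {γ : Drawing G} (htri : γ.IsPlaneTriangulation) {F : Set Plane}
    (hF : F ∈ γ.faces) {z : Plane} (hz : z ∈ frontier F) :
    (∃ v ∈ γ.fv F, z = γ.vmap v) ∨ ∃ e, γ.inc e F ∧ z ∈ γ.emap e := by
  rw [(Drawing.face_spec htri hF).2.2] at hz
  rcases hz with ⟨v, hv, rfl⟩ | hz
  · exact Or.inl ⟨v, hv, rfl⟩
  · simp only [mem_iUnion] at hz
    obtain ⟨e, he, h⟩ := hz
    exact Or.inr ⟨e, he, h⟩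

lemma Drawing.Hm_ne {γ : Drawing G} (htri : γ.IsPlaneTriangulation) (hV : 3 < Nat.card V)
    {F : Set Plane} (hF : F ∈ γ.faces) (σ : V → ℤˣ) {z : Plane} (hz : z ∈ closure F) :
    γ.Hm F σ z ≠ 0 := by
  intro h
  have key : ∀ v ∈ γ.fv F, z ∉ γ.Av v → False := by
    intro v hv hzv
    have h1 := γ.Hm_fst σ z hv
    rw [h] at h1
    have := Drawing.lam_pos hV hzv
    rcases unit_real (σ v) with e | e <;> rw [e] at h1 <;> simp at h1 <;> linarith
  by_cases hzt : z ∈ γ.totalImage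
  · rcases Drawing.frontier_cases htri hF (Drawing.mem_frontier_of_closure hF hz hzt) with
      ⟨v, hv, rfl⟩ | ⟨e, he, hze⟩
    · exact key v hv (γ.vmap_notMem_Av v)
    · induction e with | _ a b =>
      exact key a (he.2 a (by simp)) (Drawing.emap_notMem_Av htri.1 he.1 (by simp) hze)
  · have : 0 < Metric.infDist z γ.totalImage := by
      refine (γ.isClosed_total.notMem_iff_infDist_pos ?_).1 hzt
      haveI : Nontrivial V := Finite.one_lt_card_iff_nontrivial.1 (by omega)
      obtain ⟨w⟩ : Nonempty V := inferInstance
      exact ⟨_, Or.inl ⟨w, rfl⟩⟩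
    have h2 := congrArg Prod.snd h
    simp [Drawing.Hm] at h2
    linarith

lemma unit_ratio (a b c d : ℤˣ) (h : a * b = c * d) :
    (a = c ∧ b = d) ∨ (a = -c ∧ b = -d) := by
  revert a b c d; decide

lemma Drawing.Hm_compat {γ : Drawing G} (htri : γ.IsPlaneTriangulation)
    {F F' : Set Plane} (hF : F ∈ γ.faces) (hF' : F' ∈ γ.faces) (hFF : F ≠ F')
    {σ σ' : V → ℤˣ} {s : Sym2 V → ℤˣ}
    (h1 : ∀ a ∈ γ.fv F, ∀ b ∈ γ.fv F, a ≠ b → s s(a, b) = σ a * σ b)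
    (h2 : ∀ a ∈ γ.fv F', ∀ b ∈ γ.fv F', a ≠ b → s s(a, b) = σ' a * σ' b)
    {z : Plane} (hz : z ∈ closure F) (hz' : z ∈ closure F') :
    γ.Hm F σ z = γ.Hm F' σ' z ∨ γ.Hm F σ z = - γ.Hm F' σ' z := by
  have hzt : z ∈ γ.totalImage := by
    by_contra h
    exact hFF (Drawing.face_eq_of_mem hF hF' (Drawing.mem_face_of_closure hF hz h)
      (Drawing.mem_face_of_closure hF' hz' h))
  have hd : Metric.infDist z γ.totalImage = 0 := Metric.infDist_zero_of_mem hzt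
  have f := Drawing.mem_frontier_of_closure hF hz hzt
  have f' := Drawing.mem_frontier_of_closure hF' hz' hzt
  have fin : ∀ t : ℤˣ, (∀ v, (γ.Hm F σ z).1 v = ((t : ℤ) : ℝ) * (γ.Hm F' σ' z).1 v) →
      γ.Hm F σ z = γ.Hm F' σ' z ∨ γ.Hm F σ z = - γ.Hm F' σ' z := by
    intro t ht
    rcases unit_real t with e | e <;> rw [e] at ht
    · left
      refine Prod.ext (funext fun v => by rw [ht v, one_mul]) ?_
      simp [Drawing.Hm]
    · right
      refine Prod.ext (funext fun v => by rw [ht v]; simp) ?_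
      simp [Drawing.Hm, hd]
  rcases Drawing.frontier_cases htri hF f with ⟨v, hv, rfl⟩ | ⟨e, he, hze⟩
  · have hv' : v ∈ γ.fv F' := f'
    refine fin (σ v * σ' v) fun w => ?_
    by_cases hw : w = v
    · subst hw
      rw [γ.Hm_fst _ _ hv, γ.Hm_fst _ _ hv']
      have := Int.units_mul_self (σ' w)
      rcases unit_real (σ' w) with e | e <;> push_cast <;> rw [e] <;> ring
    · have : γ.lam w (γ.vmap v) = 0 := Drawing.lam_zero (Or.inl ⟨v, Ne.symm hw, rfl⟩)
      rw [γ.Hm_zero _ this, γ.Hm_zero _ this, mul_zero]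
  · have he' := Drawing.inc_of_mem htri hF' he.1 hze f'
    induction e with | _ a b =>
    have hab : a ≠ b := G.ne_of_adj he.1
    have ha := he.2 a (by simp)
    have hb := he.2 b (by simp)
    have ha' := he'.2 a (by simp)
    have hb' := he'.2 b (by simp)
    have hr := unit_ratio _ _ _ _ ((h1 a ha b hb hab).symm.trans (h2 a ha' b hb' hab))
    have hz0 : ∀ w, w ≠ a → w ≠ b → γ.lam w z = 0 := by
      intro w h1 h2
      refine Drawing.lam_zero (Or.inr ?_)
      simp only [mem_iUnion]
      exact ⟨s(a,b), ⟨he.1, by simp [h1, h2]⟩, Or.inl hze⟩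
    rcases hr with ⟨r1, r2⟩ | ⟨r1, r2⟩
    · refine fin 1 fun w => ?_
      by_cases hwa : w = a
      · subst hwa; rw [γ.Hm_fst _ _ ha, γ.Hm_fst _ _ ha', r1]; simp
      by_cases hwb : w = b
      · subst hwb; rw [γ.Hm_fst _ _ hb, γ.Hm_fst _ _ hb', r2]; simp
      rw [γ.Hm_zero _ (hz0 w hwa hwb), γ.Hm_zero _ (hz0 w hwa hwb), mul_zero]
    · refine fin (-1) fun w => ?_
      by_cases hwa : w = a
      · subst hwa; rw [γ.Hm_fst _ _ ha, γ.Hm_fst _ _ ha', r1]; simp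
      by_cases hwb : w = b
      · subst hwb; rw [γ.Hm_fst _ _ hb, γ.Hm_fst _ _ hb', r2]; simp
      rw [γ.Hm_zero _ (hz0 w hwa hwb), γ.Hm_zero _ (hz0 w hwa hwb), mul_zero]

/-- The first cohomology of the triangulated plane with signs vanishes. -/
lemma Drawing.coboundary {γ : Drawing G} (htri : γ.IsPlaneTriangulation) (hV : 3 < Nat.card V)
    (s : Sym2 V → ℤˣ)
    (hs : ∀ F ∈ γ.faces, ∀ a ∈ γ.fv F, ∀ b ∈ γ.fv F, ∀ c ∈ γ.fv F, a ≠ b → b ≠ c → a ≠ c →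
      s s(a, b) * s s(b, c) * s s(a, c) = 1) :
    ∃ g : V → ℤˣ, ∀ u v, G.Adj u v → s s(u, v) = g u * g v := by
  classical
  haveI : Fintype V := Fintype.ofFinite V
  have hσ := fun F : γ.faces => sigma_exists htri s hs F.2
  choose σ hσ using hσ
  haveI : Finite γ.faces := (Drawing.faces_finite htri).to_subtype
  obtain ⟨L, hL, hLH⟩ := sign_lift (E := (V → ℝ) × ℝ) (fun F : γ.faces => closure F.1)
    (fun _ => isClosed_closure)
    (fun z => by obtain ⟨F, hF, h⟩ := Drawing.cover htri z; exact ⟨⟨F, hF⟩, h⟩)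
    (fun F => γ.Hm F.1 (σ F)) (fun F => (γ.Hm_cont _ _).continuousOn)
    (fun F z hz => Drawing.Hm_ne htri hV F.2 _ hz)
    (fun F F' z hz hz' => by
      by_cases h : F = F'
      · subst h; exact Or.inl rfl
      · exact Drawing.Hm_compat htri F.2 F'.2 (fun h' => h (Subtype.ext h')) (hσ F) (hσ F') hz hz')
  refine ⟨fun v => if 0 < (L (γ.vmap v)).1 v then 1 else -1, fun u v huv => ?_⟩
  obtain ⟨F, hF, hi⟩ := Drawing.exists_inc htri (e := s(u,v)) huv
  have hu := hi.2 u (by simp)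
  have hv := hi.2 v (by simp)
  have hsub : γ.cl s(u,v) ⊆ closure F := by
    rintro z (hz | ⟨w, hw, rfl⟩)
    · exact frontier_subset_closure (Drawing.emap_subset_frontier htri hF hi hz)
    · exact frontier_subset_closure (hi.2 w hw)
  set H := γ.Hm F (σ ⟨F, hF⟩) with hH
  have hHc : Continuous H := γ.Hm_cont _ _
  have hmu : γ.vmap u ∈ γ.cl s(u,v) := (γ.vmap_mem_cl huv).2 (by simp)
  have hmv : γ.vmap v ∈ γ.cl s(u,v) := (γ.vmap_mem_cl huv).2 (by simp)
  have ht : ∃ t : ℤˣ, ∀ z ∈ γ.cl s(u,v), L z = ((t : ℤ) : ℝ) • H z := by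
    by_contra hcon
    push Not at hcon
    obtain ⟨z1, hz1, n1⟩ := hcon 1
    obtain ⟨z2, hz2, n2⟩ := hcon (-1)
    have b1 := (hLH ⟨F, hF⟩ z1 (hsub hz1)).resolve_left (by simpa using n1)
    have b2 := (hLH ⟨F, hF⟩ z2 (hsub hz2)).resolve_right (by simpa using n2)
    obtain ⟨z, hz, e1, e2⟩ := isPreconnected_closed_iff.1 (γ.isPreconnected_cl huv)
      {z | L z = H z} {z | L z = - H z} (isClosed_eq hL hHc) (isClosed_eq hL hHc.neg)
      (fun z hz => hLH ⟨F, hF⟩ z (hsub hz)) ⟨z2, hz2, b2⟩ ⟨z1, hz1, b1⟩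
    have h0 := Drawing.Hm_ne htri hV hF (σ ⟨F, hF⟩) (hsub hz)
    simp only [mem_ofPred_eq] at e1 e2
    rw [e1] at e2
    exact h0 (self_eq_neg.1 e2)
  obtain ⟨t, ht⟩ := ht
  have fin : ∀ w, w ∈ γ.fv F → γ.vmap w ∈ γ.cl s(u,v) →
      (if 0 < (L (γ.vmap w)).1 w then (1 : ℤˣ) else -1) = t * σ ⟨F, hF⟩ w := by
    intro w hw hm
    have e1 : (L (γ.vmap w)).1 w = ((t : ℤ) : ℝ) * (((σ ⟨F, hF⟩ w : ℤ) : ℝ) * γ.lam w (γ.vmap w)) := by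
      rw [ht _ hm, ← γ.Hm_fst _ _ hw]; rfl
    have hp := Drawing.lam_pos hV (γ.vmap_notMem_Av w)
    rw [e1]
    rcases Int.units_eq_one_or t with rfl | rfl <;>
      rcases Int.units_eq_one_or (σ ⟨F, hF⟩ w) with e | e <;> rw [e] <;> simp <;> linarith
  beta_reduce
  rw [fin u hu hmu, fin v hv hmv, hσ ⟨F, hF⟩ u hu v hv (G.ne_of_adj huv),
    show t * σ ⟨F, hF⟩ u * (t * σ ⟨F, hF⟩ v) = (t * t) * (σ ⟨F, hF⟩ u * σ ⟨F, hF⟩ v) by ac_rfl,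
    Int.units_mul_self, one_mul]

end Part8


section Part9
/-- A combinatorial triangulation of the sphere with vanishing first cohomology, with a
marked outer face. -/
structure Tri {V : Type} (G : SimpleGraph V) (Φ : Type) where
  fv : Φ → Finset V
  card3 : ∀ F, (fv F).card = 3
  clique : ∀ F, ∀ a ∈ fv F, ∀ b ∈ fv F, a ≠ b → G.Adj a b
  two : ∀ u v, G.Adj u v → ∃ F F', F ≠ F' ∧ ∀ X, (u ∈ fv X ∧ v ∈ fv X) ↔ (X = F ∨ X = F')
  link : ∀ (v : V) (S : Set Φ), (∀ u, G.Adj u v → ∀ F F', u ∈ fv F → v ∈ fv F → u ∈ fv F' →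
    v ∈ fv F' → F ∈ S → F' ∈ S) → ∀ F F', v ∈ fv F → v ∈ fv F' → F ∈ S → F' ∈ S
  dual : ∀ (S : Set Φ), (∀ u v, G.Adj u v → ∀ F F', u ∈ fv F → v ∈ fv F → u ∈ fv F' →
    v ∈ fv F' → F ∈ S → F' ∈ S) → ∀ F F', F ∈ S → F' ∈ S
  cob : ∀ s : Sym2 V → ZMod 2, (∀ F, ∀ a ∈ fv F, ∀ b ∈ fv F, ∀ c ∈ fv F, a ≠ b → b ≠ c →
    a ≠ c → s s(a, b) + s s(b, c) + s s(a, c) = 0) →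
    ∃ g : V → ZMod 2, ∀ u v, G.Adj u v → s s(u, v) = g u + g v
  vert : ∀ v, ∃ F, v ∈ fv F
  o : Φ

section Chain
variable {V Φ : Type} [Fintype V] [Fintype Φ] {G : SimpleGraph V}

/-- Incidence of an edge and a face. -/
def Tri.inc (T : Tri G Φ) (e : Sym2 V) (F : Φ) : Prop := ¬ e.IsDiag ∧ ∀ v ∈ e, v ∈ T.fv F

lemma Tri.inc_mk (T : Tri G Φ) {a b : V} {F : Φ} :
    T.inc s(a, b) F ↔ a ≠ b ∧ a ∈ T.fv F ∧ b ∈ T.fv F := by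
  simp [Tri.inc]

open Classical in
/-- The boundary of a 2-chain. -/
def Tri.bdry (T : Tri G Φ) (x : Φ → ZMod 2) (e : Sym2 V) : ZMod 2 :=
  ∑ F, if T.inc e F then x F else 0

lemma Tri.bdry_add (T : Tri G Φ) (x y : Φ → ZMod 2) (e : Sym2 V) :
    T.bdry (x + y) e = T.bdry x e + T.bdry y e := by
  simp only [Tri.bdry, ← Finset.sum_add_distrib]
  refine Finset.sum_congr rfl fun F _ => ?_
  split_ifs <;> simp

lemma Tri.bdry_eq (T : Tri G Φ) {a b : V} (hab : G.Adj a b) {F F' : Φ} (hne : F ≠ F')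
    (h : ∀ X, (a ∈ T.fv X ∧ b ∈ T.fv X) ↔ (X = F ∨ X = F')) (x : Φ → ZMod 2) :
    T.bdry x s(a, b) = x F + x F' := by
  classical
  simp only [Tri.bdry, T.inc_mk, G.ne_of_adj hab, ne_eq, not_false_eq_true, true_and, h]
  rw [← Finset.sum_filter]
  have : (Finset.univ.filter fun X => X = F ∨ X = F') = {F, F'} := by ext; simp
  rw [this, Finset.sum_pair hne]

lemma zmod2_cases (x : ZMod 2) : x = 0 ∨ x = 1 := by revert x; decide
lemma zmod2_self (x : ZMod 2) : x + x = 0 := by revert x; decide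
lemma zmod2_ne {x : ZMod 2} (h : x ≠ 0) : x = 1 := (zmod2_cases x).resolve_left h
lemma zmod2_add_eq_zero {x y : ZMod 2} : x + y = 0 ↔ x = y := by revert x y; decide
lemma zmod2_add_eq_one {x y : ZMod 2} : x + y = 1 ↔ x ≠ y := by revert x y; decide

lemma Tri.bdry_notEdge (T : Tri G Φ) (x : Φ → ZMod 2) {e : Sym2 V} (he : e ∉ G.edgeSet) :
    T.bdry x e = 0 := by
  classical
  refine Finset.sum_eq_zero fun F _ => if_neg ?_
  induction e with | _ a b =>
  rw [T.inc_mk]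
  rintro ⟨h1, h2, h3⟩
  exact he (T.clique F a h2 b h3 h1)

/-- A boundary edge separates a face inside from a face outside. -/
lemma Tri.bdry_one_iff (T : Tri G Φ) {a b : V} (x : Φ → ZMod 2) :
    T.bdry x s(a, b) = 1 ↔ G.Adj a b ∧ ∃ F F', a ∈ T.fv F ∧ b ∈ T.fv F ∧ a ∈ T.fv F' ∧
      b ∈ T.fv F' ∧ x F = 1 ∧ x F' = 0 := by
  constructor
  · intro h
    have hab : G.Adj a b := by
      by_contra hc
      rw [T.bdry_notEdge x (e := s(a,b)) hc] at h
      exact absurd h (by decide)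
    refine ⟨hab, ?_⟩
    obtain ⟨F, F', hne, hX⟩ := T.two a b hab
    rw [T.bdry_eq hab hne hX] at h
    have h1 := (hX F).2 (Or.inl rfl)
    have h2 := (hX F').2 (Or.inr rfl)
    rcases zmod2_cases (x F) with e | e <;> rcases zmod2_cases (x F') with e' | e' <;>
      rw [e, e'] at h
    · exact absurd h (by decide)
    · exact ⟨F', F, h2.1, h2.2, h1.1, h1.2, e', e⟩
    · exact ⟨F, F', h1.1, h1.2, h2.1, h2.2, e, e'⟩
    · exact absurd h (by decide)
  · rintro ⟨hab, F1, F2, h1, h2, h3, h4, e1, e2⟩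
    obtain ⟨F, F', hne, hX⟩ := T.two a b hab
    rw [T.bdry_eq hab hne hX]
    have k1 := (hX F1).1 ⟨h1, h2⟩
    have k2 := (hX F2).1 ⟨h3, h4⟩
    rcases k1 with rfl | rfl <;> rcases k2 with rfl | rfl <;> simp_all

lemma Tri.bdry_even (T : Tri G Φ) (x : Φ → ZMod 2) (v : V) : ∑ u, T.bdry x s(v, u) = 0 := by
  classical
  simp only [Tri.bdry]
  rw [Finset.sum_comm]
  refine Finset.sum_eq_zero fun F _ => ?_
  rw [← Finset.sum_filter, Finset.sum_const]
  by_cases hv : v ∈ T.fv F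
  · have : (Finset.univ.filter fun u => T.inc s(v, u) F) = (T.fv F).erase v := by
      ext u; simp [T.inc_mk, hv, eq_comm]
    rw [this, Finset.card_erase_of_mem hv, T.card3]
    simp only [Nat.add_one_sub_one, two_nsmul]; exact zmod2_self _
  · have : (Finset.univ.filter fun u => T.inc s(v, u) F) = ∅ := by
      ext u; simp [T.inc_mk, hv]
    rw [this]; simp

lemma Tri.bdry_zero (T : Tri G Φ) {x : Φ → ZMod 2} (h : ∀ e, T.bdry x e = 0) (F F' : Φ) :
    x F = x F' := by
  refine T.dual {X | x F = x X} ?_ F F' rfl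
  intro u v huv X X' h1 h2 h3 h4 hX
  simp only [mem_ofPred_eq] at hX ⊢
  rw [hX]
  by_contra hne
  have : T.bdry x s(u, v) = 1 := by
    rw [T.bdry_one_iff]
    refine ⟨huv, ?_⟩
    rcases zmod2_cases (x X) with e | e <;> rcases zmod2_cases (x X') with e' | e'
    · rw [e, e'] at hne; exact absurd rfl hne
    · exact ⟨X', X, h3, h4, h1, h2, e', e⟩
    · exact ⟨X, X', h1, h2, h3, h4, e, e'⟩
    · rw [e, e'] at hne; exact absurd rfl hne
  rw [h] at this
  exact absurd this (by decide)

lemma Tri.bdry_inj (T : Tri G Φ) {x y : Φ → ZMod 2} (h : ∀ e, T.bdry x e = T.bdry y e)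
    (ho : x T.o = y T.o) : x = y := by
  funext F
  have := T.bdry_zero (x := x + y) (fun e => by rw [T.bdry_add, h, zmod2_self]) F T.o
  simp only [Pi.add_apply] at this
  rw [ho, zmod2_self] at this
  exact zmod2_add_eq_zero.1 this

open Classical in
/-- The 1-chain of a walk. -/
def chain {G : SimpleGraph V} {a b : V} (w : G.Walk a b) (e : Sym2 V) : ZMod 2 :=
  (w.edges.count e : ZMod 2)

open Classical in
lemma chain_cons {a b c : V} (h : G.Adj a b) (w : G.Walk b c) (e : Sym2 V) :
    chain (SimpleGraph.Walk.cons h w) e = (if e = s(a, b) then 1 else 0) + chain w e := by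
  simp only [chain, SimpleGraph.Walk.edges_cons, List.count_cons]
  by_cases he : e = s(a, b)
  · subst he; simp [add_comm]
  · have : s(a,b) ≠ e := Ne.symm he
    simp [he, this]

lemma chain_append {a b c : V} (w : G.Walk a b) (w' : G.Walk b c) (e : Sym2 V) :
    chain (w.append w') e = chain w e + chain w' e := by
  simp [chain, SimpleGraph.Walk.edges_append, List.count_append]

lemma chain_notMem {a b : V} {w : G.Walk a b} {e : Sym2 V} (h : e ∉ w.edges) : chain w e = 0 := by
  classical
  simp [chain, List.count_eq_zero.2 h]

open Classical in
lemma chain_trail {a b : V} {w : G.Walk a b} (hw : w.IsTrail) (e : Sym2 V) :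
    chain w e = if e ∈ w.edges then 1 else 0 := by
  split_ifs with h
  · simp [chain, List.count_eq_one_of_mem hw.edges_nodup h]
  · exact chain_notMem h

open Classical in
lemma chain_even {a b : V} (w : G.Walk a b) (v : V) :
    ∑ u, chain w s(v, u) = (if v = a then 1 else 0) + (if v = b then 1 else 0) := by
  induction w with
  | nil => simp [chain, zmod2_self]
  | @cons a b c h w ih =>
    simp only [chain_cons, Finset.sum_add_distrib, ih]
    have hne := G.ne_of_adj h
    have : ∑ u, (if s(v, u) = s(a, b) then (1 : ZMod 2) else 0) =
        (if v = a then 1 else 0) + (if v = b then 1 else 0) := by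
      by_cases h1 : v = a
      · subst h1
        have : ∀ u, (s(v, u) = s(v, b)) ↔ u = b := by intro u; simp; grind
        simp [this, hne]
      · by_cases h2 : v = b
        · subst h2
          have : ∀ u, (s(v, u) = s(a, v)) ↔ u = a := by
            intro u; rw [Sym2.eq_swap (a := a)]; simp; grind
          simp [this, h1]
        · simp [h1, h2]
    rw [this]
    have := zmod2_self (if v = b then (1 : ZMod 2) else 0)
    linear_combination this

/-- A chain supported on a cycle with even degrees is zero or everything. -/
lemma cycle_even {H : G.Subgraph} (hH : IsCycleSubgraph H) (f : Sym2 V → ZMod 2)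
    (hs : ∀ e, f e ≠ 0 → e ∈ H.edgeSet) (he : ∀ v, ∑ u, f s(v, u) = 0) :
    (∀ e, f e = 0) ∨ ∀ e ∈ H.edgeSet, f e = 1 := by
  classical
  by_cases h0 : ∀ e, f e = 0
  · exact Or.inl h0
  right
  push Not at h0
  obtain ⟨e0, he0⟩ := h0
  -- local claim
  have loc : ∀ v u w, H.Adj v u → H.Adj v w → f s(v, u) = f s(v, w) := by
    intro v u w hu hw
    by_cases huw : u = w
    · rw [huw]
    have h2 := hH.2.2 v (H.edge_vert hu)
    have hset : H.neighborSet v = {u, w} := by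
      symm
      apply Set.eq_of_subset_of_ncard_le
      · rintro x (rfl | rfl)
        · exact hu
        · exact hw
      · rw [h2, Set.ncard_pair huw]
      · exact toFinite _
    have := he v
    have hsub : ∑ x, f s(v, x) = ∑ x ∈ ({u, w} : Finset V), f s(v, x) := by
      symm
      refine Finset.sum_subset (Finset.subset_univ _) ?_
      intro x _ hx
      by_contra hfx
      have : x ∈ H.neighborSet v := hs _ hfx
      rw [hset] at this
      simp at this hx
      tauto
    rw [hsub, Finset.sum_pair huw] at this
    exact zmod2_add_eq_zero.1 this
  -- propagate
  have prop : ∀ a b : H.verts, H.coe.Reachable a b → (∀ u, H.Adj a u → f s(a.1, u) = 1) →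
      ∀ u, H.Adj b u → f s(b.1, u) = 1 := by
    rintro a b ⟨w⟩
    induction w with
    | nil => exact fun h => h
    | @cons a b c h w ih =>
      intro ha
      apply ih
      intro u hu
      have hab : H.Adj a b := h
      rw [loc b u a hu hab.symm, Sym2.eq_swap]
      exact ha b hab
  induction e0 with | _ a b =>
  have hab : H.Adj a b := hs _ he0
  have ha : ∀ u, H.Adj a u → f s(a, u) = 1 := by
    intro u hu
    rw [loc a u b hu hab]; exact zmod2_ne he0
  intro e
  induction e with | _ c d =>
  intro hcd
  exact prop ⟨a, H.edge_vert hab⟩ ⟨c, H.edge_vert hcd⟩ (hH.1.preconnected _ _) ha d hcd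

lemma isCycleSubgraph_of_walk {a : V} {c : G.Walk a a} (hc : c.IsCycle) :
    IsCycleSubgraph c.toSubgraph :=
  ⟨c.toSubgraph_connected, toFinite _, fun v hv =>
    hc.ncard_neighborSet_toSubgraph_eq_two ((c.mem_verts_toSubgraph).1 hv)⟩

/-- Any nonzero even chain contains a cycle. -/
lemma exists_cycle_of_even (f : Sym2 V → ZMod 2) (hG : ∀ e, f e ≠ 0 → e ∈ G.edgeSet)
    (he : ∀ v, ∑ u, f s(v, u) = 0) (h0 : ∃ e, f e ≠ 0) :
    ∃ (a : V) (c : G.Walk a a), c.IsCycle ∧ ∀ e ∈ c.edges, f e = 1 := by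
  classical
  let K : SimpleGraph V := SimpleGraph.fromEdgeSet {e | f e ≠ 0}
  have hKG : K ≤ G := by
    intro a b hab
    exact hG _ ((SimpleGraph.fromEdgeSet_adj _).1 hab).1
  by_cases hK : K.IsAcyclic
  · exfalso
    obtain ⟨e, he0⟩ := h0
    induction e with | _ a b =>
    have hab : K.Adj a b :=
      (SimpleGraph.fromEdgeSet_adj _).2 ⟨he0, G.ne_of_adj (hG _ he0)⟩
    haveI : Nonempty V := ⟨a⟩
    obtain ⟨u, v, p, hp, hmax⟩ := SimpleGraph.Walk.exists_isPath_forall_isPath_length_le_length K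
    have hlen : 1 ≤ p.length := by
      simpa using hmax _ _ (SimpleGraph.Walk.cons hab SimpleGraph.Walk.nil) (by simp [hab.ne])
    have hnil : ¬ p.Nil := by
      intro h; have := SimpleGraph.Walk.nil_iff_length_eq.1 h; omega
    have hpen := (p.adj_penultimate hnil).symm
    have : ∃ w, w ≠ p.penultimate ∧ f s(v, w) ≠ 0 := by
      by_contra hcon
      push Not at hcon
      have h1 := he v
      rw [Finset.sum_eq_single p.penultimate (fun w _ hw => hcon w hw) (by simp)] at h1
      exact ((SimpleGraph.fromEdgeSet_adj _).1 hpen).1 h1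
    obtain ⟨w, hw, hfw⟩ := this
    have hvw : K.Adj v w :=
      (SimpleGraph.fromEdgeSet_adj _).2 ⟨hfw, G.ne_of_adj (hG _ hfw)⟩
    have hns : w ∉ p.support := fun h => hw (hK.eq_penultimate_of_adj_end hp hvw h)
    have := hmax _ _ (p.concat hvw) (hp.concat hns hvw)
    simp at this
  · simp only [SimpleGraph.IsAcyclic] at hK
    push Not at hK
    obtain ⟨a, c, hc⟩ := hK
    refine ⟨a, c.mapLe hKG, (SimpleGraph.Walk.isCycle_mapLe hKG).2 hc, ?_⟩
    intro e he
    have : e ∈ c.edges := by simpa using he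
    have h2 := c.edges_subset_edgeSet this
    exact zmod2_ne ((SimpleGraph.edgeSet_fromEdgeSet _ ▸ h2).1)

end Chain

end Part9


section Part10
section Disk
variable {V Φ : Type} [Fintype V] [Fintype Φ] {G : SimpleGraph V}

lemma Tri.fv_eq (T : Tri G Φ) {F : Φ} {a b c : V} (ha : a ∈ T.fv F) (hb : b ∈ T.fv F)
    (hc : c ∈ T.fv F) (hab : a ≠ b) (hbc : b ≠ c) (hac : a ≠ c) {v : V} (hv : v ∈ T.fv F) :
    v = a ∨ v = b ∨ v = c := by
  classical
  have h : ({a, b, c} : Finset V) = T.fv F := by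
    apply Finset.eq_of_subset_of_card_le
    · intro x hx; simp at hx; rcases hx with rfl | rfl | rfl <;> assumption
    · rw [T.card3, Finset.card_eq_three.2 ⟨a, b, c, hab, hac, hbc, rfl⟩]
  rw [← h] at hv
  simpa using hv

lemma Tri.exists_fv (T : Tri G Φ) (F : Φ) : ∃ a b c, a ∈ T.fv F ∧ b ∈ T.fv F ∧ c ∈ T.fv F ∧
    a ≠ b ∧ b ≠ c ∧ a ≠ c := by
  classical
  obtain ⟨a, b, c, h1, h2, h3, h⟩ := Finset.card_eq_three.1 (T.card3 F)
  exact ⟨a, b, c, by simp [h], by simp [h], by simp [h], h1, h3, h2⟩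

lemma Tri.exists_third (T : Tri G Φ) {F : Φ} {a b : V} (ha : a ∈ T.fv F) (hb : b ∈ T.fv F)
    (hab : a ≠ b) : ∃ c ∈ T.fv F, b ≠ c ∧ a ≠ c := by
  classical
  by_contra hcon
  push Not at hcon
  have : T.fv F ⊆ {a, b} := by
    intro c hc
    have := hcon c hc
    by_cases h : b = c
    · simp [h]
    · simp [this h]
  have h2 := Finset.card_le_card this
  rw [T.card3, Finset.card_pair hab] at h2
  omega

open Classical in
lemma Tri.sum_inc (T : Tri G Φ) {F : Φ} {a b c : V} (ha : a ∈ T.fv F) (hb : b ∈ T.fv F)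
    (hc : c ∈ T.fv F) (hab : a ≠ b) (hbc : b ≠ c) (hac : a ≠ c) (s : Sym2 V → ZMod 2) :
    ∑ e, (if T.inc e F then s e else 0) = s s(a, b) + s s(b, c) + s s(a, c) := by
  rw [← Finset.sum_filter]
  have : (Finset.univ.filter fun e => T.inc e F) = {s(a, b), s(b, c), s(a, c)} := by
    ext e
    induction e with | _ u v =>
    simp only [Finset.mem_filter, Finset.mem_univ, true_and, Finset.mem_insert,
      Finset.mem_singleton, T.inc_mk]
    constructor
    · rintro ⟨huv, hu, hv⟩
      rcases T.fv_eq ha hb hc hab hbc hac hu with rfl | rfl | rfl <;>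
        rcases T.fv_eq ha hb hc hab hbc hac hv with rfl | rfl | rfl <;> simp_all
    · simp only [Sym2.eq_iff]
      rintro ((⟨rfl, rfl⟩ | ⟨rfl, rfl⟩) | (⟨rfl, rfl⟩ | ⟨rfl, rfl⟩) | (⟨rfl, rfl⟩ | ⟨rfl, rfl⟩)) <;>
        simp_all [Ne.symm]
  rw [this, Finset.sum_insert, Finset.sum_insert, Finset.sum_singleton, add_assoc]
  · simp only [Finset.mem_singleton, Sym2.eq_iff]; grind
  · simp only [Finset.mem_insert, Finset.mem_singleton, Sym2.eq_iff]; grind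

/-- The boundary map. -/
def Tri.bdryL (T : Tri G Φ) : (Φ → ZMod 2) →ₗ[ZMod 2] (Sym2 V → ZMod 2) where
  toFun x := T.bdry x
  map_add' x y := funext fun e => T.bdry_add x y e
  map_smul' r x := by
    funext e
    simp [Tri.bdry, Finset.mul_sum]

open Classical in
lemma Tri.pairing (T : Tri G Φ) (x : Φ → ZMod 2) (s : Sym2 V → ZMod 2) :
    ∑ e, T.bdry x e * s e = ∑ F, x F * ∑ e, (if T.inc e F then s e else 0) := by
  simp only [Tri.bdry, Finset.sum_mul, Finset.mul_sum]
  rw [Finset.sum_comm]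
  refine Finset.sum_congr rfl fun F _ => Finset.sum_congr rfl fun e _ => ?_
  split_ifs <;> simp

lemma sum_chain (s : Sym2 V → ZMod 2) (g : V → ZMod 2)
    (h : ∀ u v, G.Adj u v → s s(u, v) = g u + g v) {a b : V} (w : G.Walk a b) :
    ∑ e, chain w e * s e = g a + g b := by
  classical
  induction w with
  | nil => simp [chain, zmod2_self]
  | @cons a b c hab w ih =>
    simp only [chain_cons, add_mul, Finset.sum_add_distrib, ih]
    simp only [ite_mul, one_mul, zero_mul, Finset.sum_ite_eq', Finset.mem_univ, if_true]
    rw [h a b hab]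
    have := zmod2_self (g b)
    linear_combination this

lemma Tri.bdry_const (T : Tri G Φ) (e : Sym2 V) : T.bdry (fun _ => 1) e = 0 := by
  rcases zmod2_cases (T.bdry (fun _ => 1) e) with h | h
  · exact h
  · induction e with | _ a b =>
    obtain ⟨-, F, F', -, -, -, -, -, h⟩ := (T.bdry_one_iff _).1 h
    exact absurd h (by decide)

/-- Every closed walk bounds. -/
lemma Tri.exists_fill (T : Tri G Φ) {a : V} (c : G.Walk a a) :
    ∃ x : Φ → ZMod 2, x T.o = 0 ∧ ∀ e, T.bdry x e = chain c e := by
  classical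
  have key : (chain c : Sym2 V → ZMod 2) ∈ LinearMap.range T.bdryL := by
    by_contra hcon
    obtain ⟨φ, hφ, hle⟩ := Submodule.exists_le_ker_of_notMem hcon
    let s : Sym2 V → ZMod 2 := fun e => φ (Pi.single e 1)
    have hs : ∀ f, φ f = ∑ e, f e * s e := by
      intro f
      have := LinearMap.pi_apply_eq_sum_univ φ f
      rw [this]
      refine Finset.sum_congr rfl fun e _ => ?_
      rw [smul_eq_mul]
      congr 2
      funext j
      simp [Pi.single_apply, eq_comm]
    obtain ⟨g, hg⟩ := T.cob s (by
      intro F a ha b hb c hc hab hbc hac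
      have h1 : φ (T.bdryL (Pi.single F 1)) = 0 := hle ⟨_, rfl⟩
      rw [hs] at h1
      have h2 := T.pairing (Pi.single F 1) s
      change ∑ e, T.bdry (Pi.single F 1) e * s e = 0 at h1
      rw [h1] at h2
      rw [Finset.sum_eq_single F (by intro X _ hX; simp [hX]) (by simp)] at h2
      rw [T.sum_inc ha hb hc hab hbc hac] at h2
      simpa using h2.symm)
    apply hφ
    rw [hs, sum_chain s g hg, zmod2_self]
  obtain ⟨x, hx⟩ := key
  have hx' : ∀ e, T.bdry x e = chain c e := fun e => congrFun hx e
  rcases zmod2_cases (x T.o) with h | h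
  · exact ⟨x, h, hx'⟩
  · refine ⟨x + fun _ => 1, ?_, fun e => ?_⟩
    · simp [h]; decide
    · rw [T.bdry_add, T.bdry_const, add_zero, hx']

structure Disk (T : Tri G Φ) where
  base : V
  c : G.Walk base base
  isC : c.IsCycle
  x : Φ → ZMod 2
  xo : x T.o = 0
  bd : ∀ e, T.bdry x e = chain c e

variable {T : Tri G Φ}

lemma exists_disk (T : Tri G Φ) {a : V} {c : G.Walk a a} (hc : c.IsCycle) :
    ∃ D : Disk T, (∀ v, v ∈ D.c.support ↔ v ∈ c.support) ∧ (∀ e, e ∈ D.c.edges ↔ e ∈ c.edges) ∧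
      D.c.length = c.length := by
  obtain ⟨x, xo, bd⟩ := T.exists_fill c
  exact ⟨⟨a, c, hc, x, xo, bd⟩, fun _ => Iff.rfl, fun _ => Iff.rfl, rfl⟩

lemma Disk.bd_one (D : Disk T) {e : Sym2 V} : T.bdry D.x e = 1 ↔ e ∈ D.c.edges := by
  classical
  rw [D.bd, chain_trail D.isC.isTrail]
  split_ifs with h <;> simp [h]

lemma Disk.sub_cyc (D : Disk T) : IsCycleSubgraph D.c.toSubgraph := isCycleSubgraph_of_walk D.isC

/-- An edge of the cycle has a face inside and a face outside. -/
lemma Disk.faces_of_edge (D : Disk T) {a b : V} (h : s(a, b) ∈ D.c.edges) :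
    ∃ F F', a ∈ T.fv F ∧ b ∈ T.fv F ∧ a ∈ T.fv F' ∧ b ∈ T.fv F' ∧ D.x F = 1 ∧ D.x F' = 0 :=
  ((T.bdry_one_iff _).1 (D.bd_one.2 h)).2

/-- Crossing an edge not on the cycle. -/
lemma Disk.same (D : Disk T) {a b : V} (hab : G.Adj a b) (h : s(a, b) ∉ D.c.edges) {F F' : Φ}
    (h1 : a ∈ T.fv F) (h2 : b ∈ T.fv F) (h3 : a ∈ T.fv F') (h4 : b ∈ T.fv F') : D.x F = D.x F' := by
  by_contra hne
  apply h
  rw [← D.bd_one, T.bdry_one_iff]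
  refine ⟨hab, ?_⟩
  rcases zmod2_cases (D.x F) with e | e <;> rcases zmod2_cases (D.x F') with e' | e'
  · rw [e, e'] at hne; exact absurd rfl hne
  · exact ⟨F', F, h3, h4, h1, h2, e', e⟩
  · exact ⟨F, F', h1, h2, h3, h4, e, e'⟩
  · rw [e, e'] at hne; exact absurd rfl hne

/-- Around a vertex off the cycle all faces are on the same side. -/
lemma Disk.link (D : Disk T) {v : V} (hv : v ∉ D.c.support) {F F' : Φ} (h1 : v ∈ T.fv F)
    (h2 : v ∈ T.fv F') : D.x F = D.x F' := by
  refine T.link v {X | D.x F = D.x X} ?_ F F' h1 h2 rfl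
  intro u huv X X' a1 a2 a3 a4 hX
  simp only [mem_ofPred_eq] at hX ⊢
  rw [hX]
  refine D.same huv ?_ a1 a2 a3 a4
  intro h
  exact hv (D.c.snd_mem_support_of_mem_edges h)

/-- Every vertex of the cycle is on an edge of the cycle. -/
lemma Disk.exists_edge (D : Disk T) {v : V} (hv : v ∈ D.c.support) : ∃ u, s(v, u) ∈ D.c.edges := by
  have h := D.sub_cyc.2.2 v (by simpa using hv)
  obtain ⟨u, hu⟩ := nonempty_of_ncard_ne_zero (s := D.c.toSubgraph.neighborSet v) (by omega)
  exact ⟨u, by simpa [SimpleGraph.Walk.adj_toSubgraph_iff_mem_edges] using hu⟩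

/-- The vertices of the region. -/
def Disk.Reg (D : Disk T) : Set V := {v | ∃ F, D.x F = 1 ∧ v ∈ T.fv F}

lemma Disk.support_reg (D : Disk T) {v : V} (hv : v ∈ D.c.support) : v ∈ D.Reg := by
  obtain ⟨u, hu⟩ := D.exists_edge hv
  obtain ⟨F, F', h1, h2, h3, h4, h5, h6⟩ := D.faces_of_edge hu
  exact ⟨F, h5, h1⟩

/-- The graph of the region. -/
def Disk.R (D : Disk T) : SimpleGraph V where
  Adj u v := u ≠ v ∧ ∃ F, D.x F = 1 ∧ u ∈ T.fv F ∧ v ∈ T.fv F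
  symm := ⟨fun _ _ ⟨h, F, h1, h2, h3⟩ => ⟨h.symm, F, h1, h3, h2⟩⟩
  loopless := ⟨fun _ h => h.1 rfl⟩

lemma Disk.R_le (D : Disk T) : D.R ≤ G := fun _ _ ⟨h, F, _, h2, h3⟩ => T.clique F _ h2 _ h3 h

lemma Disk.edge_R (D : Disk T) {a b : V} (h : s(a, b) ∈ D.c.edges) : D.R.Adj a b := by
  obtain ⟨F, F', h1, h2, h3, h4, h5, h6⟩ := D.faces_of_edge h
  exact ⟨G.ne_of_adj (D.c.adj_of_mem_edges h), F, h5, h1, h2⟩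

lemma Disk.even_sub (D : Disk T) (y : Φ → ZMod 2)
    (h : ∀ a b, T.bdry y s(a, b) = 1 → s(a, b) ∈ D.c.edges) (hy : y T.o = 0) :
    y = 0 ∨ y = D.x := by
  rcases cycle_even D.sub_cyc (T.bdry y) (fun e he => by
    induction e with | _ a b =>
    rw [SimpleGraph.Walk.mem_edges_toSubgraph]
    exact h a b (zmod2_ne he)) (T.bdry_even y) with h0 | h1
  · left
    funext F
    rw [T.bdry_zero h0 F T.o, hy]; rfl
  · right
    refine T.bdry_inj (fun e => ?_) (hy.trans D.xo.symm)
    by_cases he : e ∈ D.c.edges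
    · rw [h1 e (by rwa [SimpleGraph.Walk.mem_edges_toSubgraph]), D.bd_one.2 he]
    · have a1 : T.bdry D.x e = 0 := by
        by_contra hne; exact he (D.bd_one.1 (zmod2_ne hne))
      have a2 : T.bdry y e = 0 := by
        by_contra hne
        induction e with | _ a b => exact he (h a b (zmod2_ne hne))
      rw [a1, a2]

lemma Disk.exists_in (D : Disk T) : ∃ F, D.x F = 1 := by
  obtain ⟨F, h, -⟩ := D.support_reg D.c.start_mem_support
  exact ⟨F, h⟩

/-- A cycle in the region of another one encloses fewer faces. -/
lemma Disk.sub (D D' : Disk T) (h : ∀ a b, s(a, b) ∈ D'.c.edges → D.R.Adj a b) {F : Φ}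
    (hF : D'.x F = 1) : D.x F = 1 := by
  classical
  let y : Φ → ZMod 2 := fun X => if D'.x X = 1 ∧ D.x X = 0 then 1 else 0
  have hy1 : ∀ X, y X = 1 → D'.x X = 1 ∧ D.x X = 0 := by
    intro X hX; by_contra hc; simp [y, hc] at hX
  have hy0 : ∀ X, y X = 0 → ¬ (D'.x X = 1 ∧ D.x X = 0) := by
    intro X hX hc; simp [y, hc] at hX
  have := D.even_sub y (by
    intro a b hab
    by_contra hne
    obtain ⟨hG, X, X', h1, h2, h3, h4, e1, e2⟩ := (T.bdry_one_iff _).1 hab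
    have hs := D.same hG hne h1 h2 h3 h4
    have k1 := hy1 _ e1
    have k2 := hy0 _ e2
    have k3 : D'.x X' ≠ 1 := fun hh => k2 ⟨hh, hs ▸ k1.2⟩
    have k4 : s(a, b) ∈ D'.c.edges := by
      by_contra hn
      exact k3 ((D'.same hG hn h1 h2 h3 h4) ▸ k1.1)
    obtain ⟨-, Y, hY, y1, y2⟩ := h a b k4
    rw [D.same hG hne y1 y2 h1 h2, k1.2] at hY
    exact absurd hY (by decide)) (by simp [y, D'.xo])
  rcases this with h0 | h1
  · by_contra hn
    have : D.x F = 0 := (zmod2_cases _).resolve_right hn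
    have h2 : y F = 1 := by simp [y, hF, this]
    rw [h0] at h2
    simp at h2
  · obtain ⟨X, hX⟩ := D.exists_in
    have := (hy1 X (by rw [h1]; exact hX)).2
    rw [hX] at this
    exact absurd this (by decide)

/-- Extraction of a cycle around a face from a boundary. -/
lemma Tri.extract (T : Tri G Φ) (F0 : Φ) (n : ℕ) : ∀ (y : Φ → ZMod 2), y F0 = 1 → y T.o = 0 →
    {e | T.bdry y e = 1}.ncard = n →
    ∃ D : Disk T, D.x F0 = 1 ∧ ∀ e ∈ D.c.edges, T.bdry y e = 1 := by
  induction n using Nat.strong_induction_on with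
  | _ n ih =>
    intro y h1 ho hn
    obtain ⟨a, c, hc, hce⟩ := exists_cycle_of_even (G := G) (T.bdry y)
      (fun e he => by by_contra hh; exact he (T.bdry_notEdge y hh)) (T.bdry_even y) (by
        by_contra hcon
        push Not at hcon
        have := T.bdry_zero hcon F0 T.o
        rw [h1, ho] at this
        exact absurd this (by decide))
    obtain ⟨D, hv, he, hl⟩ := exists_disk T hc
    rcases zmod2_cases (D.x F0) with h0 | h0
    · have hlt : {e | T.bdry (y + D.x) e = 1}.ncard < n := by
        rw [← hn]
        refine ncard_lt_ncard ?_ (toFinite _)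
        refine ⟨fun e hh => ?_, fun hsub => ?_⟩
        · simp only [mem_ofPred_eq] at hh ⊢
          rw [T.bdry_add] at hh
          by_contra hc0
          have : T.bdry y e = 0 := (zmod2_cases _).resolve_right hc0
          rw [this, zero_add] at hh
          exact hc0 (hce e ((he e).1 (D.bd_one.1 hh)))
        · obtain ⟨u, hu⟩ := D.exists_edge D.c.start_mem_support
          have h2 := hce _ ((he _).1 hu)
          have h3 := hsub (a := s(D.base, u)) h2
          simp only [mem_ofPred_eq] at h3
          rw [T.bdry_add, h2, D.bd_one.2 hu] at h3
          exact absurd h3 (by decide)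
      obtain ⟨D', hD1, hD2⟩ := ih _ hlt (y + D.x) (by simp [h1, h0]) (by simp [ho, D.xo]) rfl
      refine ⟨D', hD1, fun e hee => ?_⟩
      have := hD2 e hee
      rw [T.bdry_add] at this
      by_contra hc0
      have h4 : T.bdry y e = 0 := (zmod2_cases _).resolve_right hc0
      rw [h4, zero_add] at this
      exact hc0 (hce e ((he e).1 (D.bd_one.1 this)))
    · exact ⟨D, h0, fun e hee => hce e ((he e).1 hee)⟩

end Disk

end Part10


section Part11
section Nest
variable {V Φ : Type} [Fintype V] [Fintype Φ] {G : SimpleGraph V} {T : Tri G Φ}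

lemma Disk.R_mono {D D' : Disk T} (h : ∀ F, D'.x F = 1 → D.x F = 1) : D'.R ≤ D.R :=
  fun _ _ ⟨h1, F, h2, h3, h4⟩ => ⟨h1, F, h F h2, h3, h4⟩

lemma Disk.Reg_mono {D D' : Disk T} (h : ∀ F, D'.x F = 1 → D.x F = 1) : D'.Reg ⊆ D.Reg :=
  fun _ ⟨F, h2, h3⟩ => ⟨F, h F h2, h3⟩

/-- A vertex of the outer cycle in the region of the inner one is on the inner one. -/
lemma Disk.support_of_reg {D D' : Disk T} (h : ∀ F, D'.x F = 1 → D.x F = 1) {v : V}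
    (hv : v ∈ D.c.support) (hv' : v ∈ D'.Reg) : v ∈ D'.c.support := by
  by_contra hn
  obtain ⟨u, hu⟩ := D.exists_edge hv
  obtain ⟨F, F', h1, h2, h3, h4, h5, h6⟩ := D.faces_of_edge hu
  obtain ⟨X, hX, hvX⟩ := hv'
  rw [D'.link hn hvX h3] at hX
  rw [h _ hX] at h6
  exact absurd h6 (by decide)

lemma Disk.nest_step (D : Disk T) (m : ℕ) {v0 : V} (h0 : v0 ∈ D.Reg)
    (hd : ∀ u ∈ D.c.support, ∀ w : D.R.Walk v0 u, m + 2 ≤ w.length) :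
    ∃ D' : Disk T, v0 ∈ D'.Reg ∧ (∀ F, D'.x F = 1 → D.x F = 1) ∧
      (∀ v ∈ D'.Reg, v ∉ D.c.support) ∧
      ∀ u ∈ D'.c.support, ∀ w : D'.R.Walk v0 u, m + 1 ≤ w.length := by
  classical
  obtain ⟨F0, hF0, hv0⟩ := h0
  let y : Φ → ZMod 2 := fun F => if D.x F = 1 ∧ ∃ w ∈ T.fv F, w ∉ D.c.support ∧
    ∀ u ∈ D.c.support, ¬ D.R.Adj w u then 1 else 0
  have hy : ∀ F, y F = 1 ↔ (D.x F = 1 ∧ ∃ w ∈ T.fv F, w ∉ D.c.support ∧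
    ∀ u ∈ D.c.support, ¬ D.R.Adj w u) := by
    intro F; simp only [y]; split_ifs with h <;> simp [h]
  have hmix : ∀ a b, T.bdry y s(a, b) = 1 → D.R.Adj a b ∧ a ∉ D.c.support ∧
      ∃ u ∈ D.c.support, D.R.Adj a u := by
    intro a b hab
    obtain ⟨hG, X, X', h1, h2, h3, h4, e1, e2⟩ := (T.bdry_one_iff _).1 hab
    obtain ⟨k1, w, k2, k3, k4⟩ := (hy X).1 e1
    have hnc : ∀ z ∈ T.fv X, z ∉ D.c.support := by
      intro z hz hzs
      by_cases hzw : w = z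
      · exact k3 (hzw ▸ hzs)
      · exact k4 z hzs ⟨hzw, X, k1, k2, hz⟩
    have ha := hnc a h1
    refine ⟨⟨G.ne_of_adj hG, X, k1, h1, h2⟩, ha, ?_⟩
    by_contra hcon
    push Not at hcon
    have : y X' = 1 := (hy X').2 ⟨by rw [← D.link ha h1 h3]; exact k1, a, h3, ha, hcon⟩
    rw [this] at e2
    exact absurd e2 (by decide)
  obtain ⟨D', hD1, hD2⟩ := T.extract F0 _ y ((hy F0).2 ⟨hF0, v0, hv0, fun h => by
      simpa using hd v0 h SimpleGraph.Walk.nil, fun u hu hadj => by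
      simpa using hd u hu (SimpleGraph.Walk.cons hadj SimpleGraph.Walk.nil)⟩) (by
      by_contra hne
      have := ((hy T.o).1 (zmod2_ne hne)).1
      rw [D.xo] at this
      exact absurd this (by decide)) rfl
  have hs : ∀ F, D'.x F = 1 → D.x F = 1 := fun F hF =>
    D.sub D' (fun a b h => (hmix a b (hD2 _ h)).1) hF
  have hsup : ∀ v ∈ D'.c.support, v ∉ D.c.support ∧ ∃ u ∈ D.c.support, D.R.Adj v u := by
    intro v hv
    obtain ⟨u, hu⟩ := D'.exists_edge hv
    exact (hmix v u (hD2 _ hu)).2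
  refine ⟨D', ⟨F0, hD1, hv0⟩, hs, ?_, ?_⟩
  · intro v hv hvs
    exact (hsup v (Disk.support_of_reg hs hvs hv)).1 hvs
  · intro u hu w
    obtain ⟨-, z, hz, hadj⟩ := hsup u hu
    have := hd z hz ((w.mapLe (Disk.R_mono hs)).append
      (SimpleGraph.Walk.cons hadj SimpleGraph.Walk.nil))
    simp at this
    omega

lemma Disk.nest (m : ℕ) : ∀ (D : Disk T) {v0 : V}, v0 ∈ D.Reg →
    (∀ u ∈ D.c.support, ∀ w : D.R.Walk v0 u, m + 1 ≤ w.length) →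
    ∃ E : ℕ → Disk T, E 0 = D ∧ (∀ i F, (E (i + 1)).x F = 1 → (E i).x F = 1) ∧
      ∀ i j, i < j → j ≤ m → ∀ v ∈ (E i).c.support, v ∉ (E j).c.support := by
  induction m with
  | zero =>
    intro D v0 h0 hd
    exact ⟨fun _ => D, rfl, fun _ _ h => h, fun i j h1 h2 => by omega⟩
  | succ m ih =>
    intro D v0 h0 hd
    obtain ⟨D', h1, h2, h3, h4⟩ := D.nest_step m h0 hd
    obtain ⟨E, hE0, hE1, hE2⟩ := ih D' h1 h4
    have hsub : ∀ i F, (E i).x F = 1 → D'.x F = 1 := by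
      intro i
      induction i with
      | zero => intro F hF; rwa [hE0] at hF
      | succ i ih' => exact fun F hF => ih' F (hE1 i F hF)
    refine ⟨fun i => Nat.casesOn i D E, rfl, ?_, ?_⟩
    · rintro (_ | i) F hF
      · exact h2 F (hsub 0 F hF)
      · exact hE1 i F hF
    · rintro (_ | i) (_ | j) hij hj v hv hv'
      · omega
      · exact h3 v (Disk.Reg_mono (hsub j) (Disk.support_reg _ hv')) hv
      · omega
      · exact hE2 i j (by omega) (by omega) v hv hv'

end Nest

end Part11


section Part12
section Shortcut
variable {V Φ : Type} [Fintype V] [Fintype Φ] {G : SimpleGraph V} {T : Tri G Φ}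

/-- A short closed walk on a cycle has zero chain. -/
lemma Disk.short_closed (D : Disk T) {a : V} (w : G.Walk a a) (hw : ∀ e ∈ w.edges, e ∈ D.c.edges)
    (hl : w.length < D.c.length) (e : Sym2 V) : chain w e = 0 := by
  classical
  rcases cycle_even D.sub_cyc (chain w) (fun e he => by
    rw [SimpleGraph.Walk.mem_edges_toSubgraph]
    apply hw
    by_contra hn
    exact he (chain_notMem hn)) (fun v => by rw [chain_even, zmod2_self]) with h | h
  · exact h e
  · exfalso
    have hsub : D.c.edges ⊆ w.edges := by
      intro e he
      by_contra hn
      have := h e (by rwa [SimpleGraph.Walk.mem_edges_toSubgraph])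
      rw [chain_notMem hn] at this
      exact absurd this (by decide)
    have := (List.subperm_of_subset D.isC.isTrail.edges_nodup hsub).length_le
    rw [SimpleGraph.Walk.length_edges, SimpleGraph.Walk.length_edges] at this
    omega

lemma Disk.shortcut_aux (D : Disk T) (k : ℕ) (hk : 1 ≤ k) (hL : D.c.length = 6 * k)
    (hd : ∀ v ∈ D.Reg, ∃ u ∈ D.c.support, ∃ w : D.R.Walk v u, w.length ≤ k - 1)
    (hs : ∀ u ∈ D.c.support, ∀ v ∈ D.c.support, ∀ w : D.R.Walk u v, ∃ w' : G.Walk u v,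
      (∀ e ∈ w'.edges, e ∈ D.c.edges) ∧ w'.length ≤ w.length) : False := by
  classical
  have hp : ∀ v, ∃ p, v ∈ D.Reg → p ∈ D.c.support ∧ (∃ w : D.R.Walk v p, w.length ≤ k - 1) ∧
      (v ∈ D.c.support → p = v) := by
    intro v
    by_cases hv : v ∈ D.c.support
    · exact ⟨v, fun _ => ⟨hv, ⟨SimpleGraph.Walk.nil, by simp⟩, fun _ => rfl⟩⟩
    · by_cases hr : v ∈ D.Reg
      · obtain ⟨u, h1, h2⟩ := hd v hr
        exact ⟨u, fun _ => ⟨h1, h2, fun h => absurd h hv⟩⟩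
      · exact ⟨v, fun h => absurd h hr⟩
  choose p hp using hp
  have hreg : ∀ {a b}, D.R.Adj a b → a ∈ D.Reg := fun {a b} ⟨_, F, h1, h2, _⟩ => ⟨F, h1, h2⟩
  have hh : ∀ x y, D.R.Adj x y → ∃ w : G.Walk (p x) (p y), (∀ e ∈ w.edges, e ∈ D.c.edges) ∧
      w.length ≤ 2 * k - 1 := by
    intro x y hxy
    obtain ⟨h1, ⟨w, hw⟩, -⟩ := hp x (hreg hxy)
    obtain ⟨h2, ⟨w', hw'⟩, -⟩ := hp y (hreg hxy.symm)
    obtain ⟨z, hz1, hz2⟩ := hs _ h1 _ h2 (w.reverse.append (SimpleGraph.Walk.cons hxy w'))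
    refine ⟨z, hz1, hz2.trans ?_⟩
    simp
    omega
  choose h hh1 hh2 using hh
  obtain ⟨u0, he0⟩ := D.exists_edge D.c.start_mem_support
  set e0 := s(D.base, u0)
  have hsym : ∀ x y (hxy : D.R.Adj x y), chain (h x y hxy) e0 = chain (h y x hxy.symm) e0 := by
    intro x y hxy
    rw [← zmod2_add_eq_zero, ← chain_append]
    apply D.short_closed
    · intro e he
      rw [SimpleGraph.Walk.edges_append, List.mem_append] at he
      rcases he with he | he
      · exact hh1 _ _ _ _ he
      · exact hh1 _ _ _ _ he
    · have := hh2 x y hxy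
      have := hh2 y x hxy.symm
      rw [SimpleGraph.Walk.length_append]
      omega
  have hs' : ∀ e : Sym2 V, ∃ z : ZMod 2, ∀ x y (hxy : D.R.Adj x y), e = s(x, y) →
      z = chain (h x y hxy) e0 := by
    intro e
    by_cases hex : ∃ x y, D.R.Adj x y ∧ e = s(x, y)
    · obtain ⟨x, y, hxy, rfl⟩ := hex
      refine ⟨chain (h x y hxy) e0, ?_⟩
      intro a b hab hE
      rcases Sym2.eq_iff.1 hE with ⟨rfl, rfl⟩ | ⟨rfl, rfl⟩
      · rfl
      · exact hsym _ _ _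
    · exact ⟨0, fun x y hxy hE => absurd ⟨x, y, hxy, hE⟩ hex⟩
  choose s hs' using hs'
  have htri : ∀ F, D.x F = 1 → ∑ e, (if T.inc e F then s e else 0) = 0 := by
    intro F hF
    obtain ⟨a, b, c, ha, hb, hc, hab, hbc, hac⟩ := T.exists_fv F
    rw [T.sum_inc ha hb hc hab hbc hac]
    have r1 : D.R.Adj a b := ⟨hab, F, hF, ha, hb⟩
    have r2 : D.R.Adj b c := ⟨hbc, F, hF, hb, hc⟩
    have r3 : D.R.Adj c a := ⟨hac.symm, F, hF, hc, ha⟩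
    rw [hs' _ a b r1 rfl, hs' _ b c r2 rfl, hs' _ c a r3 Sym2.eq_swap, ← chain_append,
      ← chain_append]
    apply D.short_closed
    · intro e he
      simp only [SimpleGraph.Walk.edges_append, List.mem_append] at he
      rcases he with (he | he) | he <;> exact hh1 _ _ _ _ he
    · have := hh2 a b r1
      have := hh2 b c r2
      have := hh2 c a r3
      simp only [SimpleGraph.Walk.length_append]
      omega
  have hedge : ∀ e ∈ D.c.edges, s e = if e = e0 then 1 else 0 := by
    intro e
    induction e with | _ a b =>
    intro he
    have r := D.edge_R he
    rw [hs' _ a b r rfl]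
    have pa := (hp a (hreg r)).2.2 (D.c.fst_mem_support_of_mem_edges he)
    have pb := (hp b (hreg r.symm)).2.2 (D.c.snd_mem_support_of_mem_edges he)
    have hadj : G.Adj (p b) (p a) := by rw [pa, pb]; exact (D.R_le r).symm
    have hz := D.short_closed ((h a b r).append (SimpleGraph.Walk.cons hadj SimpleGraph.Walk.nil)) (by
      intro e he'
      simp only [SimpleGraph.Walk.edges_append, List.mem_append, SimpleGraph.Walk.edges_cons,
        SimpleGraph.Walk.edges_nil, List.mem_singleton] at he'
      rcases he' with he' | he'
      · exact hh1 _ _ _ _ he'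
      · rw [he', pa, pb, Sym2.eq_swap]; exact he) (by
      have := hh2 a b r
      simp
      omega) e0
    have hnil : chain (SimpleGraph.Walk.nil : G.Walk (p a) (p a)) e0 = 0 := chain_notMem (by simp)
    have hcond : s(p b, p a) = s(b, a) := by rw [pa, pb]
    rw [chain_append, zmod2_add_eq_zero, chain_cons, hnil, add_zero, hcond] at hz
    rw [hz]
    have : (e0 = s(b, a)) ↔ (s(a, b) = e0) := by
      rw [Sym2.eq_swap (a := b)]; exact eq_comm
    simp only [this]
  have hpair := T.pairing D.x s
  have e1 : ∑ e, T.bdry D.x e * s e = 1 := by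
    rw [Finset.sum_eq_single e0]
    · rw [D.bd_one.2 he0, hedge _ he0]; simp
    · intro e _ hne
      by_cases he : e ∈ D.c.edges
      · rw [hedge _ he]; simp [hne]
      · rw [D.bd, chain_notMem he]; simp
    · simp
  have e2 : ∑ F, D.x F * ∑ e, (if T.inc e F then s e else 0) = 0 := by
    refine Finset.sum_eq_zero fun F _ => ?_
    rcases zmod2_cases (D.x F) with hF | hF
    · rw [hF, zero_mul]
    · rw [htri F hF, mul_zero]
  rw [e1, e2] at hpair
  exact absurd hpair (by decide)

/-- A minimal shortcut. -/
lemma Disk.shortcut (D : Disk T) (k : ℕ) (hk : 1 ≤ k) (hL : D.c.length = 6 * k)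
    (hd : ∀ v ∈ D.Reg, ∃ u ∈ D.c.support, ∃ w : D.R.Walk v u, w.length ≤ k - 1) :
    ∃ u ∈ D.c.support, ∃ v ∈ D.c.support, u ≠ v ∧ ∃ P : D.R.Walk u v, P.IsPath ∧
      (∀ z ∈ P.support, z ∈ D.c.support → z = u ∨ z = v) ∧
      ∀ w' : G.Walk u v, (∀ e ∈ w'.edges, e ∈ D.c.edges) → P.length < w'.length := by
  classical
  have hex : ∃ n, ∃ u ∈ D.c.support, ∃ v ∈ D.c.support, ∃ w : D.R.Walk u v, w.length = n ∧
      ∀ w' : G.Walk u v, (∀ e ∈ w'.edges, e ∈ D.c.edges) → w.length < w'.length := by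
    by_contra hcon
    push Not at hcon
    refine D.shortcut_aux k hk hL hd fun u hu v hv w => ?_
    exact hcon w.length u hu v hv w rfl
  obtain ⟨u, hu, v, hv, w, hwl, hw⟩ := Nat.find_spec hex
  have hmin : ∀ a ∈ D.c.support, ∀ b ∈ D.c.support, ∀ q : D.R.Walk a b, q.length < w.length →
      ∃ w' : G.Walk a b, (∀ e ∈ w'.edges, e ∈ D.c.edges) ∧ w'.length ≤ q.length := by
    intro a ha b hb q hq
    by_contra hcon
    push Not at hcon
    rw [hwl] at hq
    exact Nat.find_min hex hq ⟨a, ha, b, hb, q, rfl, hcon⟩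
  have hle := w.length_bypass_le
  have hlt : ∀ w' : G.Walk u v, (∀ e ∈ w'.edges, e ∈ D.c.edges) → w.bypass.length < w'.length :=
    fun w' h => hle.trans_lt (hw w' h)
  have hpath := w.bypass_isPath
  refine ⟨u, hu, v, hv, ?_, w.bypass, hpath, ?_, hlt⟩
  · rintro rfl
    have := hw SimpleGraph.Walk.nil (by simp)
    simp at this
  · intro z hz hzC
    by_contra hcon
    push Not at hcon
    have hsum := congrArg SimpleGraph.Walk.length (w.bypass.take_spec hz)
    rw [SimpleGraph.Walk.length_append] at hsum
    have p1 : (w.bypass.takeUntil z hz).length ≠ 0 := fun h0 =>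
      hcon.1 (SimpleGraph.Walk.eq_of_length_eq_zero h0).symm
    have p2 : (w.bypass.dropUntil z hz).length ≠ 0 := fun h0 =>
      hcon.2 (SimpleGraph.Walk.eq_of_length_eq_zero h0)
    obtain ⟨q1, a1, a2⟩ := hmin u hu z hzC (w.bypass.takeUntil z hz) (by omega)
    obtain ⟨q2, b1, b2⟩ := hmin z hzC v hv (w.bypass.dropUntil z hz) (by omega)
    have := hlt (q1.append q2) (by
      intro e he
      rw [SimpleGraph.Walk.edges_append, List.mem_append] at he
      exact he.elim (a1 e) (b1 e))
    rw [SimpleGraph.Walk.length_append] at this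
    omega

end Shortcut

end Part12


section Part13
section Split
variable {V Φ : Type} [Fintype V] [Fintype Φ] {G : SimpleGraph V} {T : Tri G Φ}

lemma cycle_of_paths {u v : V} {p q : G.Walk u v} (hp : p.IsPath) (hq : q.IsPath)
    (h : ∀ z ∈ p.support, z ∈ q.support → z = u ∨ z = v) (hl : 1 < p.length ∨ 1 < q.length) :
    (p.append q.reverse).IsCycle := by
  refine hp.isCycle_append hq.reverse ?_ (by simpa using hl)
  intro z hz1 hz2
  have m1 : z ∈ p.support := List.mem_of_mem_tail hz1
  have m2 : z ∈ q.support := by simpa using List.mem_of_mem_tail hz2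
  have n1 := hp.support_nodup
  have n2 := hq.reverse.support_nodup
  rw [← SimpleGraph.Walk.cons_tail_support, List.nodup_cons] at n1 n2
  rcases h z m1 m2 with rfl | rfl
  · exact n1.1 hz1
  · exact n2.1 hz2

lemma edge_of_length_le_one {u v : V} (huv : u ≠ v) (p : G.Walk u v) (h : p.length ≤ 1) :
    s(u, v) ∈ p.edges := by
  cases p with
  | nil => exact absurd rfl huv
  | cons h1 p =>
    cases p with
    | nil => simp
    | cons h2 p => simp at h

lemma chain_reverse {u v : V} (p : G.Walk u v) (e : Sym2 V) : chain p.reverse e = chain p e := by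
  simp [chain]

lemma Disk.split (D : Disk T) {u v : V} (hu : u ∈ D.c.support) (hv : v ∈ D.c.support)
    (huv : u ≠ v) (P : D.R.Walk u v) (hP : P.IsPath)
    (hPC : ∀ z ∈ P.support, z ∈ D.c.support → z = u ∨ z = v)
    (hE : s(u, v) ∈ D.c.edges → 2 ≤ P.length) :
    ∃ (D1 D2 : Disk T) (α β : G.Walk u v), (∀ e ∈ α.edges, e ∈ D.c.edges) ∧
      (∀ e ∈ β.edges, e ∈ D.c.edges) ∧ α.length + β.length = D.c.length ∧
      D1.c.length = α.length + P.length ∧ D2.c.length = β.length + P.length ∧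
      (∀ z, (z ∈ D1.c.support ∨ z ∈ D2.c.support) ↔ (z ∈ D.c.support ∨ z ∈ P.support)) ∧
      (∀ F, D.x F = D1.x F + D2.x F) ∧ (∀ F, D1.x F = 1 → D.x F = 1) ∧
      (∀ F, D2.x F = 1 → D.x F = 1) := by
  classical
  set c' := D.c.rotate u hu with hc'
  have hcyc : c'.IsCycle := D.isC.rotate hu
  have hv' : v ∈ c'.support := (D.c.mem_support_rotate_iff u hu).2 hv
  have hedges : ∀ e, e ∈ c'.edges ↔ e ∈ D.c.edges := fun e => (D.c.rotate_edges u hu).mem_iff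
  have hspec := c'.take_spec hv'
  set α := c'.takeUntil v hv' with hα
  set β := (c'.dropUntil v hv').reverse with hβ
  have hspec' : α.append β.reverse = c' := by rw [hβ, SimpleGraph.Walk.reverse_reverse, hspec]
  have pα : α.IsPath := hcyc.isPath_takeUntil hv'
  have pβ : β.IsPath := by
    apply SimpleGraph.Walk.IsPath.reverse
    rw [← hspec] at hcyc
    exact hcyc.isPath_of_append_right (SimpleGraph.Walk.not_nil_of_ne huv)
  set Q : G.Walk u v := P.mapLe D.R_le with hQ
  have pQ : Q.IsPath := hP.mapLe D.R_le
  have Qs : Q.support = P.support := SimpleGraph.Walk.support_mapLe_eq_support _ _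
  have Qe : Q.edges = P.edges := SimpleGraph.Walk.edges_mapLe_eq_edges _ _
  have Ql : Q.length = P.length := by simp [hQ]
  have ac : ∀ e, e ∈ D.c.edges ↔ (e ∈ α.edges ∨ e ∈ β.edges) := by
    intro e
    rw [← hedges, ← hspec', SimpleGraph.Walk.edges_append, List.mem_append]
    simp
  have as : ∀ z, z ∈ D.c.support ↔ (z ∈ α.support ∨ z ∈ β.support) := by
    intro z
    rw [← D.c.mem_support_rotate_iff u hu, ← hc', ← hspec', SimpleGraph.Walk.mem_support_append_iff]
    simp
  have hlen : ∀ p : G.Walk u v, (∀ e ∈ p.edges, e ∈ D.c.edges) → (1 < p.length ∨ 1 < Q.length) := by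
    intro p hp
    by_contra hcon
    push Not at hcon
    have := hE (hp _ (edge_of_length_le_one huv p hcon.1))
    omega
  have eα : ∀ e ∈ α.edges, e ∈ D.c.edges := fun e he => (ac e).2 (Or.inl he)
  have eβ : ∀ e ∈ β.edges, e ∈ D.c.edges := fun e he => (ac e).2 (Or.inr he)
  have c1 : (α.append Q.reverse).IsCycle := cycle_of_paths pα pQ
    (fun z h1 h2 => hPC z (Qs ▸ h2) ((as z).2 (Or.inl h1))) (hlen α eα)
  have c2 : (β.append Q.reverse).IsCycle := cycle_of_paths pβ pQ
    (fun z h1 h2 => hPC z (Qs ▸ h2) ((as z).2 (Or.inr h1))) (hlen β eβ)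
  obtain ⟨x1, o1, b1⟩ := T.exists_fill (α.append Q.reverse)
  obtain ⟨x2, o2, b2⟩ := T.exists_fill (β.append Q.reverse)
  have sub : ∀ (E : Disk T), (∀ e ∈ E.c.edges, e ∈ D.c.edges ∨ e ∈ P.edges) →
      ∀ F, E.x F = 1 → D.x F = 1 := by
    intro E hEe F hF
    refine D.sub E (fun a b hab => ?_) hF
    rcases hEe _ hab with h | h
    · exact D.edge_R h
    · exact P.adj_of_mem_edges h
  refine ⟨⟨u, _, c1, x1, o1, b1⟩, ⟨u, _, c2, x2, o2, b2⟩, α, β, eα, eβ, ?_, ?_, ?_, ?_, ?_, ?_, ?_⟩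
  · have := congrArg SimpleGraph.Walk.length hspec'
    rw [hc', SimpleGraph.Walk.length_rotate] at this
    simpa using this
  · simp [Ql]
  · simp [Ql]
  · intro z
    simp only [SimpleGraph.Walk.mem_support_append_iff, as, SimpleGraph.Walk.support_reverse,
      List.mem_reverse, Qs]
    tauto
  · have : D.x = x1 + x2 := by
      refine T.bdry_inj (fun e => ?_) (by simp [o1, o2, D.xo])
      rw [T.bdry_add, b1, b2, D.bd, chain_append, chain_append, chain_trail D.isC.isTrail]
      simp only [← hedges]
      rw [← chain_trail hcyc.isTrail, ← hspec', chain_append]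
      simp only [chain_reverse]
      have := zmod2_self (chain Q e)
      linear_combination -this
    intro F
    rw [this]; rfl
  · exact sub _ (fun e he => by
      simp only [SimpleGraph.Walk.edges_append, SimpleGraph.Walk.edges_reverse, List.mem_append,
        List.mem_reverse, Qe] at he
      exact he.imp (eα e) id)
  · exact sub _ (fun e he => by
      simp only [SimpleGraph.Walk.edges_append, SimpleGraph.Walk.edges_reverse, List.mem_append,
        List.mem_reverse, Qe] at he
      exact he.imp (eβ e) id)

end Split

end Part13


section Part14
section Step
variable {V Φ : Type} [Fintype V] [Fintype Φ] {G : SimpleGraph V} {T : Tri G Φ}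

/-- The vertex set of the cycle. -/
def Disk.vs (D : Disk T) : Set V := {v | v ∈ D.c.support}

lemma Disk.vs_ncard (D : Disk T) : D.vs.ncard ≤ D.c.length := by
  classical
  have h : D.vs ⊆ (D.c.support.tail.toFinset : Set V) := by
    intro v hv
    simp only [List.coe_toFinset, mem_ofPred_eq]
    have hv' : v ∈ D.c.support := hv
    rw [SimpleGraph.Walk.mem_support_iff] at hv'
    rcases hv' with rfl | h
    · exact SimpleGraph.Walk.end_mem_tail_support D.isC.not_nil
    · exact h
  refine (ncard_le_ncard h (toFinite _)).trans ?_
  rw [ncard_coe_finset]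
  refine (List.toFinset_card_le _).trans ?_
  simp

/-- Splitting data. -/
def Disk.Splits (D : Disk T) (L : ℕ) (D1 D2 : Disk T) : Prop :=
  D1.c.length ≤ L ∧ D2.c.length ≤ L ∧ D.vs ⊆ D1.vs ∪ D2.vs ∧ (∀ F, D.x F = D1.x F + D2.x F) ∧
    (∀ F, D1.x F = 1 → D.x F = 1) ∧ (∀ F, D2.x F = 1 → D.x F = 1)

lemma Disk.split' (D : Disk T) (L : ℕ) {u v : V} (hu : u ∈ D.c.support) (hv : v ∈ D.c.support)
    (huv : u ≠ v) (P : D.R.Walk u v) (hP : P.IsPath)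
    (hPC : ∀ z ∈ P.support, z ∈ D.c.support → z = u ∨ z = v)
    (hE : s(u, v) ∈ D.c.edges → 2 ≤ P.length)
    (hl : ∀ α β : G.Walk u v, (∀ e ∈ α.edges, e ∈ D.c.edges) → (∀ e ∈ β.edges, e ∈ D.c.edges) →
      α.length + β.length = D.c.length → α.length + P.length ≤ L) :
    ∃ D1 D2, D.Splits L D1 D2 := by
  obtain ⟨D1, D2, α, β, h1, h2, h3, h4, h5, h6, h7, h8, h9⟩ := D.split hu hv huv P hP hPC hE
  refine ⟨D1, D2, ?_, ?_, ?_, h7, h8, h9⟩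
  · rw [h4]; exact hl α β h1 h2 h3
  · rw [h5]; exact hl β α h2 h1 (by omega)
  · intro z hz
    exact (h6 z).2 (Or.inl hz)

lemma Disk.step (D : Disk T) (k : ℕ) (hk : 1 ≤ k) (hL : D.c.length ≤ 6 * k)
    (hd : ∀ v ∈ D.Reg, ∃ u ∈ D.c.support, ∃ w : D.R.Walk v u, w.length ≤ k - 1) :
    (∃ F, D.x F = 1 ∧ ∀ X, D.x X = 1 → X = F) ∨ ∃ D1 D2, D.Splits (6 * k) D1 D2 := by
  classical
  rcases hL.lt_or_eq with hlt | heq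
  · have pos : ∀ {u v : V} (huv : u ≠ v) (p : G.Walk u v), 1 ≤ p.length := by
      intro u v huv p
      by_contra h
      exact huv (SimpleGraph.Walk.eq_of_length_eq_zero (p := p) (by omega))
    have chord : ∀ a b, a ∈ D.c.support → b ∈ D.c.support → D.R.Adj a b → s(a, b) ∉ D.c.edges →
        ∃ D1 D2, D.Splits (6 * k) D1 D2 := by
      intro a b ha hb hab hne
      refine D.split' (6 * k) ha hb (D.R.ne_of_adj hab) hab.toWalk ?_ ?_ (fun h => absurd h hne) ?_
      · simp [SimpleGraph.Adj.toWalk, D.R.ne_of_adj hab]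
      · intro z hz _
        simpa [SimpleGraph.Adj.toWalk] using hz
      · intro α β _ _ h
        have := pos (D.R.ne_of_adj hab) β
        simp [SimpleGraph.Adj.toWalk]
        omega
    obtain ⟨a, b, hb⟩ : ∃ a b, s(a, b) ∈ D.c.edges :=
      ⟨_, D.exists_edge D.c.start_mem_support⟩
    obtain ⟨F, F', h1, h2, h3, h4, h5, h6⟩ := D.faces_of_edge hb
    have hab : a ≠ b := G.ne_of_adj (D.c.adj_of_mem_edges hb)
    obtain ⟨w, hw, hbw, haw⟩ := T.exists_third h1 h2 hab
    have ha' : a ∈ D.c.support := D.c.fst_mem_support_of_mem_edges hb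
    have hb' : b ∈ D.c.support := D.c.snd_mem_support_of_mem_edges hb
    have raw : D.R.Adj a w := ⟨haw, F, h5, h1, hw⟩
    have rwb : D.R.Adj w b := ⟨hbw.symm, F, h5, hw, h2⟩
    by_cases hwC : w ∈ D.c.support
    · by_cases e1 : s(a, w) ∈ D.c.edges
      · by_cases e2 : s(w, b) ∈ D.c.edges
        · left
          let y : Φ → ZMod 2 := fun X => if X = F then 1 else 0
          rcases D.even_sub y (by
            intro p q hpq
            obtain ⟨hG, X, X', k1, k2, k3, k4, k5, k6⟩ := (T.bdry_one_iff _).1 hpq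
            have : X = F := by
              by_contra hne
              simp [y, hne] at k5
            subst this
            have hpq := G.ne_of_adj hG
            rcases T.fv_eq h1 h2 hw hab hbw haw k1 with r1 | r1 | r1 <;>
              rcases T.fv_eq h1 h2 hw hab hbw haw k2 with r2 | r2 | r2 <;>
              first | exact absurd (r1.trans r2.symm) hpq | (rw [r1, r2]; assumption) |
                (rw [r1, r2, Sym2.eq_swap]; assumption)) (by
            have : T.o ≠ F := by
              intro h
              have := D.xo
              rw [h, h5] at this
              exact absurd this (by decide)
            simp [y, this]) with h0 | h0
          · have := congrFun h0 F
            simp [y] at this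
          · refine ⟨F, h5, fun X hX => ?_⟩
            by_contra hne
            rw [← h0] at hX
            simp [y, hne] at hX
        · exact Or.inr (chord w b hwC hb' rwb e2)
      · exact Or.inr (chord a w ha' hwC raw e1)
    · right
      refine D.split' (6 * k) ha' hb' hab (SimpleGraph.Walk.cons raw rwb.toWalk) ?_ ?_ ?_ ?_
      · simp [SimpleGraph.Adj.toWalk, haw, hab, hbw.symm]
      · intro z hz hzC
        simp [SimpleGraph.Adj.toWalk] at hz
        rcases hz with rfl | rfl | rfl
        · exact Or.inl rfl
        · exact absurd hzC hwC
        · exact Or.inr rfl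
      · intro _; simp [SimpleGraph.Adj.toWalk]
      · intro α β _ _ h
        have := pos hab β
        simp [SimpleGraph.Adj.toWalk]
        omega
  · right
    obtain ⟨u, hu, v, hv, huv, P, hP, hPC, hshort⟩ := D.shortcut k hk heq hd
    refine D.split' (6 * k) hu hv huv P hP hPC ?_ ?_
    · intro he
      have := hshort (SimpleGraph.Walk.cons (D.c.adj_of_mem_edges he) SimpleGraph.Walk.nil)
        (by simpa using he)
      exfalso
      apply huv
      apply SimpleGraph.Walk.eq_of_length_eq_zero (p := P)
      rw [SimpleGraph.Walk.length_cons, SimpleGraph.Walk.length_nil] at this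
      omega
    · intro α β h1 h2 h3
      have := hshort β h2
      omega

end Step

end Part14


section Part15
section Decomposition
variable {V Φ : Type} [Fintype V] [Fintype Φ] {G : SimpleGraph V} {T : Tri G Φ}

/-- A rooted decomposition of a disk. -/
structure Dec (D : Disk T) (N : ℕ) : Type 1 where
  τ : Type
  r : τ
  par : τ → τ
  depth : τ → ℕ
  ring : τ → Disk T
  W : τ → Set V
  depth_r : depth r = 0
  depth_par : ∀ t, t ≠ r → depth t = depth (par t) + 1
  ring_r : ring r = D
  ring_sub : ∀ t, (ring t).vs ⊆ W t
  W_reg : ∀ t, W t ⊆ (ring t).Reg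
  card : ∀ t, (W t).ncard ≤ N
  inter : ∀ t, t ≠ r → (ring t).vs = W t ∩ W (par t)
  nest : ∀ t, t ≠ r → ∀ F, (ring t).x F = 1 → (ring (par t)).x F = 1
  strict : ∀ t, t ≠ r → ∃ F, (ring (par t)).x F = 1 ∧ (ring t).x F = 0
  cover : ∀ F, D.x F = 1 → ∃ t, ∀ v ∈ T.fv F, v ∈ W t
  top : ∀ t t' v, v ∈ W t → v ∈ W t' → (t = r ∨ v ∉ W (par t)) → (t' = r ∨ v ∉ W (par t')) →
    t = t'

lemma Dec.sub {D : Disk T} {N : ℕ} (d : Dec D N) (n : ℕ) : ∀ t, d.depth t = n → ∀ F,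
    (d.ring t).x F = 1 → D.x F = 1 := by
  induction n with
  | zero =>
    intro t ht F hF
    by_cases h : t = d.r
    · rwa [h, d.ring_r] at hF
    · have := d.depth_par t h
      omega
  | succ n ih =>
    intro t ht F hF
    by_cases h : t = d.r
    · rwa [h, d.ring_r] at hF
    · have := d.depth_par t h
      exact ih (d.par t) (by omega) F (d.nest t h F hF)

lemma Dec.reg {D : Disk T} {N : ℕ} (d : Dec D N) {t : d.τ} {v : V} (hv : v ∈ d.W t) : v ∈ D.Reg :=
  Disk.Reg_mono (d.sub _ t rfl) (d.W_reg t hv)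

lemma Disk.sep {D : Disk T} (E : Bool → Disk T) (hx : ∀ F, D.x F = (E false).x F + (E true).x F)
    (hs : ∀ i F, (E i).x F = 1 → D.x F = 1) {i : Bool} {F : Φ}
    (h1 : (E i).x F = 1) (h2 : (E (!i)).x F = 1) : False := by
  have h3 := hs i F h1
  rw [hx] at h3
  cases i <;> simp only [Bool.not_true, Bool.not_false] at h2 <;> rw [h1, h2] at h3 <;>
    exact absurd h3 (by decide)

lemma Disk.reg_inter {D : Disk T} (E : Bool → Disk T)
    (hx : ∀ F, D.x F = (E false).x F + (E true).x F)
    (hs : ∀ i F, (E i).x F = 1 → D.x F = 1) {i : Bool} {v : V} (h1 : v ∈ (E i).Reg)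
    (h2 : v ∈ (E (!i)).Reg) : v ∈ (E i).vs := by
  by_contra hn
  obtain ⟨F, a1, a2⟩ := h1
  obtain ⟨F', b1, b2⟩ := h2
  rw [(E i).link hn a2 b2] at a1
  exact Disk.sep E hx hs a1 b1

open Classical in
/-- Gluing. -/
def Dec.glue {D : Disk T} {N : ℕ} (E : Bool → Disk T) (d : ∀ i, Dec (E i) N)
    (hx : ∀ F, D.x F = (E false).x F + (E true).x F)
    (hs : ∀ i F, (E i).x F = 1 → D.x F = 1)
    (hv : D.vs ⊆ (E false).vs ∪ (E true).vs)
    (hc : ((E false).vs ∪ (E true).vs).ncard ≤ N) : Dec D N where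
  τ := Option (Σ i, (d i).τ)
  r := none
  par := fun t => t.elim none fun s => if s.2 = (d s.1).r then none else some ⟨s.1, (d s.1).par s.2⟩
  depth := fun t => t.elim 0 fun s => (d s.1).depth s.2 + 1
  ring := fun t => t.elim D fun s => (d s.1).ring s.2
  W := fun t => t.elim ((E false).vs ∪ (E true).vs) fun s => (d s.1).W s.2
  depth_r := rfl
  depth_par := by
    rintro (_ | ⟨i, t⟩) h
    · exact absurd rfl h
    · by_cases ht : t = (d i).r
      · simp [ht, (d i).depth_r]
      · simp [ht, (d i).depth_par t ht]
  ring_r := rfl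
  ring_sub := by
    rintro (_ | ⟨i, t⟩)
    · exact hv
    · exact (d i).ring_sub t
  W_reg := by
    rintro (_ | ⟨i, t⟩)
    · rintro v (h | h)
      · exact Disk.Reg_mono (hs _) (Disk.support_reg _ h)
      · exact Disk.Reg_mono (hs _) (Disk.support_reg _ h)
    · exact (d i).W_reg t
  card := by
    rintro (_ | ⟨i, t⟩)
    · exact hc
    · exact (d i).card t
  inter := by
    rintro (_ | ⟨i, t⟩) h
    · exact absurd rfl h
    · by_cases ht : t = (d i).r
      · subst ht
        simp only [Option.elim_some, if_true, Option.elim_none, (d i).ring_r]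
        apply Subset.antisymm
        · intro v hv
          refine ⟨(d i).ring_sub _ (by rwa [(d i).ring_r]), ?_⟩
          cases i
          · exact Or.inl hv
          · exact Or.inr hv
        · rintro v ⟨h1, h2⟩
          have h3 := (d i).reg h1
          cases i
          · rcases h2 with h2 | h2
            · exact h2
            · exact Disk.reg_inter E hx hs (i := false) h3 (Disk.support_reg _ h2)
          · rcases h2 with h2 | h2
            · exact Disk.reg_inter E hx hs (i := true) h3 (Disk.support_reg _ h2)
            · exact h2
      · simp only [Option.elim_some, ht, if_false]
        exact (d i).inter t ht
  nest := by
    rintro (_ | ⟨i, t⟩) h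
    · exact absurd rfl h
    · by_cases ht : t = (d i).r
      · subst ht
        simp only [Option.elim_some, if_true, Option.elim_none, (d i).ring_r]
        exact hs i
      · simp only [Option.elim_some, ht, if_false]
        exact (d i).nest t ht
  strict := by
    rintro (_ | ⟨i, t⟩) h
    · exact absurd rfl h
    · by_cases ht : t = (d i).r
      · subst ht
        simp only [Option.elim_some, if_true, Option.elim_none, (d i).ring_r]
        obtain ⟨F, hF⟩ := (E (!i)).exists_in
        refine ⟨F, hs _ F hF, ?_⟩
        by_contra hne
        exact Disk.sep E hx hs (zmod2_ne hne) hF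
      · simp only [Option.elim_some, ht, if_false]
        exact (d i).strict t ht
  cover := by
    intro F hF
    rw [hx] at hF
    have : ∃ i, (E i).x F = 1 := by
      by_contra hcon
      push Not at hcon
      rw [(zmod2_cases _).resolve_right (hcon false), (zmod2_cases _).resolve_right (hcon true)] at hF
      exact absurd hF (by decide)
    obtain ⟨i, hi⟩ := this
    obtain ⟨t, ht⟩ := (d i).cover F hi
    exact ⟨some ⟨i, t⟩, ht⟩
  top := by
    have hW : ∀ i v, v ∈ (E i).vs → v ∈ (E false).vs ∪ (E true).vs := by
      intro i v h; cases i
      · exact Or.inl h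
      · exact Or.inr h
    have hA : ∀ i v, v ∈ (E false).vs ∪ (E true).vs → v ∈ (E i).Reg → v ∈ (E i).vs := by
      intro i v h2 h3
      cases i
      · rcases h2 with h2 | h2
        · exact h2
        · exact Disk.reg_inter E hx hs (i := false) h3 (Disk.support_reg _ h2)
      · rcases h2 with h2 | h2
        · exact Disk.reg_inter E hx hs (i := true) h3 (Disk.support_reg _ h2)
        · exact h2
    have hpar : ∀ i (t : (d i).τ) (v : V), (some (⟨i, t⟩ : Σ i, (d i).τ) = none ∨ v ∉ Option.elim
        (if t = (d i).r then none else some (⟨i, (d i).par t⟩ : Σ i, (d i).τ))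
        ((E false).vs ∪ (E true).vs) fun s => (d s.1).W s.2) →
        (t = (d i).r ∧ v ∉ (E false).vs ∪ (E true).vs) ∨ (t ≠ (d i).r ∧ v ∉ (d i).W ((d i).par t)) := by
      intro i t v h
      have h := h.resolve_left (by simp)
      by_cases ht : t = (d i).r
      · left; refine ⟨ht, ?_⟩; simpa only [ht, if_true, Option.elim_none] using h
      · right; refine ⟨ht, ?_⟩; simpa only [ht, if_false, Option.elim_some] using h
    have hC : ∀ i (t : (d i).τ) (v : V), v ∈ (d i).W t → v ∈ (E false).vs ∪ (E true).vs →
        ((t = (d i).r ∧ v ∉ (E false).vs ∪ (E true).vs) ∨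
          (t ≠ (d i).r ∧ v ∉ (d i).W ((d i).par t))) → False := by
      rintro i t v h1 h2 (⟨-, h⟩ | ⟨h3, h4⟩)
      · exact h h2
      · have h5 := hA i v h2 ((d i).reg h1)
        exact h3 ((d i).top t (d i).r v h1 ((d i).ring_sub _ (by rwa [(d i).ring_r])) (Or.inr h4)
          (Or.inl rfl))
    rintro (_ | ⟨i, t⟩) (_ | ⟨j, t'⟩) v h1 h2 h3 h4
    · rfl
    · exact (hC j t' v h2 h1 (hpar j t' v h4)).elim
    · exact (hC i t v h1 h2 (hpar i t v h3)).elim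
    · have k3 := hpar i t v h3
      have k4 := hpar j t' v h4
      by_cases hij : i = j
      · subst hij
        rw [(d i).top t t' v h1 h2 (k3.imp (·.1) (·.2)) (k4.imp (·.1) (·.2))]
      · exfalso
        have hj : j = !i := by cases i <;> cases j <;> simp_all
        subst hj
        exact hC i t v h1 (hW i v (Disk.reg_inter E hx hs ((d i).reg h1) ((d (!i)).reg h2))) k3

/-- A decomposition with one bag. -/
def Dec.leaf {D : Disk T} {N : ℕ} (hN : 3 ≤ N) {F : Φ} (hF : D.x F = 1)
    (h : ∀ X, D.x X = 1 → X = F) : Dec D N where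
  τ := Unit
  r := ()
  par := fun _ => ()
  depth := fun _ => 0
  ring := fun _ => D
  W := fun _ => T.fv F
  depth_r := rfl
  depth_par := fun t ht => absurd rfl ht
  ring_r := rfl
  ring_sub := fun _ v hv => by
    obtain ⟨X, h1, h2⟩ := D.support_reg hv
    rw [h X h1] at h2
    exact h2
  W_reg := fun _ v hv => ⟨F, hF, hv⟩
  card := fun _ => by rw [ncard_coe_finset, T.card3]; exact hN
  inter := fun t ht => absurd rfl ht
  nest := fun t ht => absurd rfl ht
  strict := fun t ht => absurd rfl ht
  cover := fun X hX => ⟨(), fun v hv => by rw [h X hX] at hv; exact hv⟩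
  top := fun _ _ _ _ _ _ _ => rfl

lemma Dec.exists (k : ℕ) (hk : 1 ≤ k)
    (hd : ∀ D : Disk T, ∀ v ∈ D.Reg, ∃ u ∈ D.c.support, ∃ w : D.R.Walk v u, w.length ≤ k - 1)
    (n : ℕ) : ∀ D : Disk T, D.c.length ≤ 6 * k → {F | D.x F = 1}.ncard = n →
      Nonempty (Dec D (12 * k)) := by
  induction n using Nat.strong_induction_on with
  | _ n ih =>
    intro D hL hn
    rcases D.step k hk hL (hd D) with ⟨F, hF, h⟩ | ⟨D1, D2, l1, l2, hv, hx, s1, s2⟩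
    · exact ⟨Dec.leaf (by omega) hF h⟩
    · let E : Bool → Disk T := fun i => cond i D2 D1
      have hs : ∀ i F, (E i).x F = 1 → D.x F = 1 := by
        rintro (_ | _)
        · exact s1
        · exact s2
      have hx' : ∀ F, D.x F = (E false).x F + (E true).x F := hx
      have hl : ∀ i, (E i).c.length ≤ 6 * k := by
        rintro (_ | _)
        · exact l1
        · exact l2
      have hlt : ∀ i, {F | (E i).x F = 1}.ncard < n := by
        intro i
        rw [← hn]
        refine ncard_lt_ncard ⟨fun F hF => hs i F hF, fun hsub => ?_⟩ (toFinite _)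
        obtain ⟨F, hF⟩ := (E (!i)).exists_in
        exact Disk.sep E hx' hs (hsub (hs _ F hF)) hF
      have hE : ∀ i, Nonempty (Dec (E i) (12 * k)) := fun i => ih _ (hlt i) (E i) (hl i) rfl
      refine ⟨Dec.glue E (fun i => (hE i).some) hx' hs hv ?_⟩
      refine (ncard_union_le _ _).trans ?_
      have a1 := (E false).vs_ncard
      have a2 := (E true).vs_ncard
      have := hl false
      have := hl true
      omega

end Decomposition

end Part15


section Part16
section Rooted
variable {V Φ : Type} [Fintype V] [Fintype Φ] {G : SimpleGraph V} {T : Tri G Φ}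
variable {D : Disk T} {N : ℕ}

/-- The tree of a rooted decomposition. -/
def Dec.tree (d : Dec D N) : SimpleGraph d.τ where
  Adj t t' := (t ≠ d.r ∧ d.par t = t') ∨ (t' ≠ d.r ∧ d.par t' = t)
  symm := ⟨fun _ _ h => h.symm⟩
  loopless := ⟨fun t h => by
    have : t ≠ d.r ∧ d.par t = t := h.elim id id
    have h2 := d.depth_par t this.1
    rw [this.2] at h2
    omega⟩

lemma Dec.adj_par (d : Dec D N) {t : d.τ} (h : t ≠ d.r) : d.tree.Adj (d.par t) t := Or.inr ⟨h, rfl⟩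

lemma Dec.adj_depth (d : Dec D N) {t t' : d.τ} (h : d.tree.Adj t t') (hd : d.depth t ≤ d.depth t') :
    t' ≠ d.r ∧ d.par t' = t := by
  rcases h with ⟨h1, h2⟩ | h
  · have := d.depth_par t h1
    rw [h2] at this
    omega
  · exact h

lemma Dec.adj_depth_lt (d : Dec D N) {t t' : d.τ} (h : d.tree.Adj t t')
    (hd : d.depth t ≤ d.depth t') : d.depth t < d.depth t' := by
  obtain ⟨h1, h2⟩ := d.adj_depth h hd
  have := d.depth_par t' h1
  rw [h2] at this
  omega

lemma Dec.acyclic (d : Dec D N) : d.tree.IsAcyclic := by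
  classical
  intro v c hc
  obtain ⟨m, hm, hmax⟩ := c.support.toFinset.exists_max_image d.depth ⟨v, by simp⟩
  simp only [List.mem_toFinset] at hm hmax
  have hc' := hc.rotate hm
  have hne := hc'.snd_ne_penultimate
  have hnn := hc'.not_nil
  set c' := c.rotate m hm with hcdef
  have a1 := c'.adj_snd hnn
  have a2 := c'.adj_penultimate hnn
  have m1 : d.depth c'.snd ≤ d.depth m := hmax _ ((c.mem_support_rotate_iff m hm).1
    (c'.getVert_mem_support _))
  have m2 : d.depth c'.penultimate ≤ d.depth m := hmax _ ((c.mem_support_rotate_iff m hm).1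
    (c'.getVert_mem_support _))
  exact hne ((d.adj_depth a1.symm m1).2.symm.trans (d.adj_depth a2 m2).2)

/-- The walk from the root. -/
lemma Dec.anc (d : Dec D N) (n : ℕ) : ∀ u, d.depth u = n → ∃ p : d.tree.Walk d.r u, p.IsPath ∧
    (∀ s ∈ p.support, d.depth s ≤ n) ∧
    (u ≠ d.r → p.edges.getLast? = some s(d.par u, u)) ∧
    ∀ e ∈ p.edges, ∃ x, x ≠ d.r ∧ e = s(d.par x, x) ∧
      (∀ F, (d.ring u).x F = 1 → (d.ring x).x F = 1) ∧
      (x = u ∨ ∃ F, (d.ring x).x F = 1 ∧ (d.ring u).x F = 0) := by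
  induction n with
  | zero =>
    intro u hu
    have : u = d.r := by
      by_contra h
      have := d.depth_par u h
      omega
    subst this
    exact ⟨SimpleGraph.Walk.nil, by simp, by simp [hu], by simp, by simp⟩
  | succ n ih =>
    intro u hu
    have hr : u ≠ d.r := by
      rintro rfl
      rw [d.depth_r] at hu
      omega
    have hdp := d.depth_par u hr
    obtain ⟨p, h1, h2, h3, h4⟩ := ih (d.par u) (by omega)
    refine ⟨p.concat (d.adj_par hr), ?_, ?_, ?_, ?_⟩
    · refine h1.concat ?_ _
      intro h
      have := h2 _ h
      omega
    · intro s hs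
      rw [SimpleGraph.Walk.support_concat, List.mem_append,
        List.mem_singleton] at hs
      rcases hs with hs | rfl
      · have := h2 s hs; omega
      · omega
    · intro _
      rw [SimpleGraph.Walk.edges_concat]
      simp
    · intro e he
      rw [SimpleGraph.Walk.edges_concat, List.concat_eq_append, List.mem_append,
        List.mem_singleton] at he
      obtain ⟨F0, hF0, hF0'⟩ := d.strict u hr
      rcases he with he | rfl
      · obtain ⟨x, x1, x2, x3, x4⟩ := h4 e he
        exact ⟨x, x1, x2, fun F hF => x3 F (d.nest u hr F hF), Or.inr ⟨F0, x3 F0 hF0, hF0'⟩⟩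
      · exact ⟨u, hr, rfl, fun F hF => hF, Or.inl rfl⟩

lemma Dec.isTree (d : Dec D N) : d.tree.IsTree := by
  refine ⟨?_, d.acyclic⟩
  haveI : Nonempty d.τ := ⟨d.r⟩
  refine ⟨fun a b => ?_⟩
  obtain ⟨p, -⟩ := d.anc _ a rfl
  obtain ⟨q, -⟩ := d.anc _ b rfl
  exact ⟨p.reverse.append q⟩

/-- The walk up to the top node. -/
lemma Dec.up (d : Dec D N) (v : V) (n : ℕ) : ∀ t, d.depth t = n → v ∈ d.W t →
    ∃ s, (s = d.r ∨ v ∉ d.W (d.par s)) ∧ v ∈ d.W s ∧ ∃ p : d.tree.Walk t s,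
      ∀ x ∈ p.support, v ∈ d.W x := by
  induction n with
  | zero =>
    intro t ht hv
    have : t = d.r := by
      by_contra h
      have := d.depth_par t h
      omega
    exact ⟨t, Or.inl this, hv, SimpleGraph.Walk.nil, by simpa using hv⟩
  | succ n ih =>
    intro t ht hv
    by_cases h : t = d.r ∨ v ∉ d.W (d.par t)
    · exact ⟨t, h, hv, SimpleGraph.Walk.nil, by simpa using hv⟩
    · push Not at h
      have hdp := d.depth_par t h.1
      obtain ⟨s, h1, h2, p, hp⟩ := ih (d.par t) (by omega) h.2
      refine ⟨s, h1, h2, SimpleGraph.Walk.cons (d.adj_par h.1).symm p, ?_⟩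
      intro x hx
      rw [SimpleGraph.Walk.support_cons, List.mem_cons] at hx
      rcases hx with rfl | hx
      · exact hv
      · exact hp x hx

lemma Dec.path_eq (d : Dec D N) {a b : d.τ} {p q : d.tree.Walk a b} (hp : p.IsPath)
    (hq : q.IsPath) : p = q := by
  have := d.acyclic.path_unique ⟨p, hp⟩ ⟨q, hq⟩
  simpa using this

lemma Dec.conn (d : Dec D N) {t t'' : d.τ} (p : d.tree.Walk t t'') (hp : p.IsPath) {t' : d.τ}
    (ht' : t' ∈ p.support) : d.W t ∩ d.W t'' ⊆ d.W t' := by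
  classical
  rintro v ⟨h1, h2⟩
  obtain ⟨s, a1, a2, q, a3⟩ := d.up v _ t rfl h1
  obtain ⟨s', b1, b2, q', b3⟩ := d.up v _ t'' rfl h2
  obtain rfl := d.top s s' v a2 b2 a1 b1
  have : p = (q.append q'.reverse).bypass := d.path_eq hp (SimpleGraph.Walk.bypass_isPath _)
  rw [this] at ht'
  have := SimpleGraph.Walk.support_bypass_subset _ ht'
  rw [SimpleGraph.Walk.mem_support_append_iff] at this
  rcases this with h | h
  · exact a3 _ h
  · exact b3 _ (by simpa using h)

/-- The ring of a tree edge. -/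
def Dec.rg (d : Dec D N) (t t' : d.τ) : Disk T :=
  if d.depth t < d.depth t' then d.ring t' else d.ring t

lemma Dec.rg_par (d : Dec D N) {a b x : d.τ} (hx : x ≠ d.r) (h : s(a, b) = s(d.par x, x)) :
    d.rg a b = d.ring x := by
  have := d.depth_par x hx
  rcases Sym2.eq_iff.1 h with ⟨rfl, rfl⟩ | ⟨rfl, rfl⟩
  · rw [Dec.rg, if_pos (by omega)]
  · rw [Dec.rg, if_neg (by omega)]

lemma Dec.edge_par (d : Dec D N) {a b : d.τ} (h : d.tree.Adj a b) :
    ∃ x, x ≠ d.r ∧ s(a, b) = s(d.par x, x) := by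
  rcases h with ⟨h1, h2⟩ | ⟨h1, h2⟩
  · exact ⟨a, h1, by rw [h2, Sym2.eq_swap]⟩
  · exact ⟨b, h1, by rw [h2]⟩

lemma Dec.rg_symm (d : Dec D N) {a b : d.τ} (h : d.tree.Adj a b) : d.rg a b = d.rg b a := by
  obtain ⟨x, hx, he⟩ := d.edge_par h
  rw [d.rg_par hx he, d.rg_par hx (Sym2.eq_swap.trans he)]

lemma Dec.rg_vs (d : Dec D N) {a b : d.τ} (h : d.tree.Adj a b) : (d.rg a b).vs = d.W a ∩ d.W b := by
  obtain ⟨x, hx, he⟩ := d.edge_par h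
  rw [d.rg_par hx he, d.inter x hx]
  rcases Sym2.eq_iff.1 he with ⟨rfl, rfl⟩ | ⟨rfl, rfl⟩
  · rw [inter_comm]
  · rfl

lemma Dec.rg_nest (d : Dec D N) {u : d.τ} {p : d.tree.Walk d.r u} (hp : p.IsPath) {a b c : d.τ}
    (h1 : s(a, b) ∈ p.edges) (h2 : p.edges.getLast? = some s(c, u)) (h3 : s(a, b) ≠ s(c, u)) :
    (∀ F, (d.rg c u).x F = 1 → (d.rg a b).x F = 1) ∧
      ∃ F, (d.rg a b).x F = 1 ∧ (d.rg c u).x F = 0 := by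
  obtain ⟨q, q1, q2, q3, q4⟩ := d.anc _ u rfl
  obtain rfl := d.path_eq hp q1
  have hu : u ≠ d.r := by
    rintro rfl
    have : p = SimpleGraph.Walk.nil := by simpa using hp
    rw [this] at h1
    simp at h1
  have hcu : s(c, u) = s(d.par u, u) := by
    have := q3 hu
    rw [h2] at this
    exact Option.some.inj this
  obtain ⟨x, x1, x2, x3, x4⟩ := q4 _ h1
  rw [d.rg_par hu hcu, d.rg_par x1 x2]
  refine ⟨x3, x4.resolve_left ?_⟩
  rintro rfl
  exact h3 (x2.trans hcu.symm)

end Rooted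

end Part16


section Instantiate
variable {V : Type} [Fintype V] {G : SimpleGraph V}

/-- The sign of an element of `ZMod 2`. -/
def sgn2 (z : ZMod 2) : ℤˣ := if z = 0 then 1 else -1

lemma sgn2_add : ∀ a b : ZMod 2, sgn2 (a + b) = sgn2 a * sgn2 b := by decide
lemma sgn2_inj : ∀ a b : ZMod 2, sgn2 a = sgn2 b → a = b := by decide
lemma sgn2_surj : ∀ g : ℤˣ, ∃ a : ZMod 2, sgn2 a = g := by decide
lemma sgn2_zero : sgn2 0 = 1 := by decide

lemma Drawing.inc_mk' {γ : Drawing G} {u v : V} {F : Set Plane} (h : G.Adj u v) (hu : u ∈ γ.fv F)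
    (hv : v ∈ γ.fv F) : γ.inc s(u, v) F := by
  refine ⟨h, ?_⟩
  intro w hw
  rcases Sym2.mem_iff.1 hw with rfl | rfl <;> assumption

open Classical in
/-- The combinatorial triangulation of a plane triangulation. -/
def Drawing.toTri {γ : Drawing G} (htri : γ.IsPlaneTriangulation) (hV : 3 < Nat.card V) :
    Tri G γ.faces where
  fv F := (γ.fv F.1).toFinset
  card3 F := by
    rw [← (Drawing.face_spec htri F.2).1, Set.ncard_eq_toFinset_card']
  clique F a ha b hb hab := by
    exact (Drawing.face_spec htri F.2).2.1 a (by simpa using ha) b (by simpa using hb) hab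
  two u v huv := by
    obtain ⟨F, hF, hi⟩ := Drawing.exists_inc htri (e := s(u, v)) huv
    obtain ⟨F', hF', hi', hne⟩ := Drawing.at_least_two htri hV hF hi
    refine ⟨⟨F, hF⟩, ⟨F', hF'⟩, fun h => hne (Subtype.ext_iff.1 h).symm, ?_⟩
    rintro ⟨X, hX⟩
    simp only [Set.mem_toFinset, Subtype.mk.injEq]
    constructor
    · rintro ⟨h1, h2⟩
      by_contra hcon
      push Not at hcon
      exact Drawing.at_most_two htri hX hF hF' (Drawing.inc_mk' huv h1 h2) hi hi' hcon.1 hcon.2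
        hne.symm
    · rintro (rfl | rfl)
      · exact ⟨hi.2 u (by simp), hi.2 v (by simp)⟩
      · exact ⟨hi'.2 u (by simp), hi'.2 v (by simp)⟩
  link v S hS F F' hv hv' hFS := by
    have := Drawing.link htri (S := {X | ∃ h : X ∈ γ.faces, (⟨X, h⟩ : γ.faces) ∈ S}) (v := v) ?_
      F.2 F'.2 (by simpa using hv) (by simpa using hv') ⟨F.2, hFS⟩
    · exact this.2
    · rintro e he hve X hX X' hX' hi hi' ⟨_, hXS⟩
      obtain ⟨u, rfl⟩ := hve
      refine ⟨hX', hS u (SimpleGraph.Adj.symm he) ⟨X, hX⟩ ⟨X', hX'⟩ ?_ ?_ ?_ ?_ hXS⟩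
      · simpa using hi.2 u (by simp)
      · simpa using hi.2 v (by simp)
      · simpa using hi'.2 u (by simp)
      · simpa using hi'.2 v (by simp)
  dual S hS F F' hFS := by
    have := Drawing.dual_conn htri (S := {X | ∃ h : X ∈ γ.faces, (⟨X, h⟩ : γ.faces) ∈ S}) ?_
      F.2 F'.2 ⟨F.2, hFS⟩
    · exact this.2
    · rintro e he X hX X' hX' hi hi' ⟨_, hXS⟩
      induction e with | _ u v =>
      refine ⟨hX', hS u v he ⟨X, hX⟩ ⟨X', hX'⟩ ?_ ?_ ?_ ?_ hXS⟩
      · simpa using hi.2 u (by simp)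
      · simpa using hi.2 v (by simp)
      · simpa using hi'.2 u (by simp)
      · simpa using hi'.2 v (by simp)
  cob s hs := by
    obtain ⟨g, hg⟩ := Drawing.coboundary htri hV (fun e => sgn2 (s e)) (by
      intro F hF a ha b hb c hc h1 h2 h3
      have := hs ⟨F, hF⟩ a (by simpa using ha) b (by simpa using hb) c (by simpa using hc) h1 h2 h3
      rw [← sgn2_add, ← sgn2_add, this, sgn2_zero])
    choose g' hg' using fun v => sgn2_surj (g v)
    refine ⟨g', fun u v huv => sgn2_inj _ _ ?_⟩
    rw [sgn2_add, hg', hg']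
    exact hg u v huv
  vert v := by
    obtain ⟨F, hF, h⟩ := Drawing.cover htri (γ.vmap v)
    refine ⟨⟨F, hF⟩, ?_⟩
    simp only [Set.mem_toFinset]
    exact Drawing.mem_frontier_of_closure hF h (Or.inl ⟨v, rfl⟩)
  o := ⟨γ.exists_outer_face.choose, γ.exists_outer_face.choose_spec.1⟩

lemma Drawing.toTri_mem {γ : Drawing G} (htri : γ.IsPlaneTriangulation) (hV : 3 < Nat.card V)
    {v : V} {F : γ.faces} : v ∈ (Drawing.toTri htri hV).fv F ↔ v ∈ γ.fv F.1 := by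
  simp [Drawing.toTri]

lemma Drawing.toTri_bdd {γ : Drawing G} (htri : γ.IsPlaneTriangulation) (hV : 3 < Nat.card V)
    {F : γ.faces} (h : F ≠ (Drawing.toTri htri hV).o) : IsBounded F.1 := by
  refine γ.exists_outer_face.choose_spec.2 F.1 F.2 ?_
  intro h'
  exact h (Subtype.ext h')

lemma Drawing.image_disk {γ : Drawing G} (htri : γ.IsPlaneTriangulation) (hV : 3 < Nat.card V)
    [Fintype γ.faces] {D D' : Disk (Drawing.toTri htri hV)} (h : ∀ F, D'.x F = 1 → D.x F = 1) :
    γ.image D'.c.toSubgraph ⊆ closedRegion (γ.image D.c.toSubgraph) := by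
  have key : ∀ F : γ.faces, D'.x F = 1 →
      closure F.1 ⊆ closedRegion (γ.image D.c.toSubgraph) := by
    intro F hF
    refine Drawing.region htri (S := {X | ∃ h : X ∈ γ.faces, D.x ⟨X, h⟩ = 1}) ?_ ?_ F.2
      ⟨F.2, h F hF⟩
    · rintro e he X hX X' hX' hi hi' ⟨_, h1⟩ h2
      induction e with | _ u v =>
      rw [SimpleGraph.Walk.mem_edges_toSubgraph]
      by_contra hcon
      have := D.same (F := ⟨X, hX⟩) (F' := ⟨X', hX'⟩) he hcon
        ((toTri_mem htri hV).2 (hi.2 u (by simp))) ((toTri_mem htri hV).2 (hi.2 v (by simp)))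
        ((toTri_mem htri hV).2 (hi'.2 u (by simp))) ((toTri_mem htri hV).2 (hi'.2 v (by simp)))
      exact h2 ⟨hX', this ▸ h1⟩
    · rintro X hX ⟨_, h1⟩
      refine toTri_bdd htri hV (F := ⟨X, hX⟩) ?_
      intro h2
      rw [h2, D.xo] at h1
      exact absurd h1 (by decide)
  rintro z (⟨v, hv, rfl⟩ | hz)
  · obtain ⟨F, hF, hvF⟩ := D'.support_reg (v := v) (by simpa using hv)
    exact key F hF (frontier_subset_closure ((toTri_mem htri hV).1 hvF))
  · simp only [mem_iUnion] at hz
    obtain ⟨e, he, hz⟩ := hz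
    induction e with | _ u v =>
    rw [SimpleGraph.Walk.mem_edges_toSubgraph] at he
    obtain ⟨F, F', h1, h2, -, -, h3, -⟩ := D'.faces_of_edge he
    refine key F h3 (frontier_subset_closure ?_)
    exact Drawing.emap_subset_frontier htri F.2 (Drawing.inc_mk' (D'.c.adj_of_mem_edges he)
      ((toTri_mem htri hV).1 h1) ((toTri_mem htri hV).1 h2)) hz

lemma Disk.x_eq_of_sub {Φ : Type} [Fintype Φ] {T : Tri G Φ} {D D' : Disk T}
    (h : D.c.toSubgraph = D'.c.toSubgraph) : D.x = D'.x := by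
  refine T.bdry_inj (fun e => ?_) (D.xo.trans D'.xo.symm)
  have h1 : e ∈ D.c.edges ↔ e ∈ D'.c.edges := by
    rw [← SimpleGraph.Walk.mem_edges_toSubgraph, h, SimpleGraph.Walk.mem_edges_toSubgraph]
  rcases zmod2_cases (T.bdry D.x e) with h0 | h0 <;>
    rcases zmod2_cases (T.bdry D'.x e) with h0' | h0'
  · rw [h0, h0']
  · have := D.bd_one.2 (h1.2 (D'.bd_one.1 h0'))
    rw [this, h0']
  · have := D'.bd_one.2 (h1.1 (D.bd_one.1 h0))
    rw [this, h0]
  · rw [h0, h0']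

lemma Tri.exists_outer_disk {Φ : Type} [Fintype Φ] (T : Tri G Φ) :
    ∃ D : Disk T, D.c.length = 3 ∧ ∀ F, F ≠ T.o → D.x F = 1 := by
  classical
  obtain ⟨a, b, c, ha, hb, hc, hab, hbc, hac⟩ := T.exists_fv T.o
  have h1 := T.clique _ a ha b hb hab
  have h2 := T.clique _ b hb c hc hbc
  have h3 := T.clique _ c hc a ha hac.symm
  let w : G.Walk a a := .cons h1 (.cons h2 (.cons h3 .nil))
  have hw : w.IsCycle := by
    simp [w, SimpleGraph.Walk.cons_isCycle_iff, SimpleGraph.Walk.cons_isPath_iff, hab, hbc, hac,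
      hab.symm, hbc.symm, hac.symm]
  obtain ⟨D, -, hD, hl⟩ := exists_disk T hw
  refine ⟨D, by rw [hl]; rfl, ?_⟩
  have key : D.x = fun F => if F = T.o then 0 else 1 := by
    refine T.bdry_inj (fun e => ?_) (by rw [D.xo]; simp)
    have h : T.bdry D.x e = 1 ↔ T.bdry (fun F => if F = T.o then (0 : ZMod 2) else 1) e = 1 := by
      rw [D.bd_one, hD]
      induction e with | _ u v =>
      rw [T.bdry_one_iff]
      constructor
      · intro he
        have huv := w.adj_of_mem_edges he
        have hin : u ∈ T.fv T.o ∧ v ∈ T.fv T.o := by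
          simp only [w, SimpleGraph.Walk.edges_cons, SimpleGraph.Walk.edges_nil, List.mem_cons,
            Sym2.eq_iff, List.not_mem_nil, or_false] at he
          rcases he with (⟨rfl, rfl⟩ | ⟨rfl, rfl⟩) | (⟨rfl, rfl⟩ | ⟨rfl, rfl⟩) |
            (⟨rfl, rfl⟩ | ⟨rfl, rfl⟩) <;> constructor <;> assumption
        obtain ⟨F, F', hne, hX⟩ := T.two u v huv
        refine ⟨huv, ?_⟩
        rcases (hX T.o).1 hin with h | h
        · have := (hX F').2 (Or.inr rfl)
          refine ⟨F', T.o, this.1, this.2, hin.1, hin.2, ?_, by simp⟩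
          rw [if_neg]; rw [h]; exact hne.symm
        · have := (hX F).2 (Or.inl rfl)
          refine ⟨F, T.o, this.1, this.2, hin.1, hin.2, ?_, by simp⟩
          rw [if_neg]; rw [h]; exact hne
      · rintro ⟨huv, F, F', -, -, hu, hv, -, h0⟩
        have hF' : F' = T.o := by
          by_contra hcon
          rw [if_neg hcon] at h0
          exact absurd h0 (by decide)
        subst hF'
        have hne := G.ne_of_adj huv
        simp only [w, SimpleGraph.Walk.edges_cons, SimpleGraph.Walk.edges_nil, List.mem_cons,
            Sym2.eq_iff, List.not_mem_nil, or_false]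
        have e1 := T.fv_eq ha hb hc hab hbc hac hu
        have e2 := T.fv_eq ha hb hc hab hbc hac hv
        grind
    rcases zmod2_cases (T.bdry D.x e) with h0 | h0
    · rcases zmod2_cases (T.bdry (fun F => if F = T.o then (0 : ZMod 2) else 1) e) with h1 | h1
      · rw [h0, h1]
      · rw [h.2 h1, h1]
    · rw [h0, h.1 h0]
  intro F hF
  rw [key]
  simp [hF]

lemma Disk.snest {γ : Drawing G} (htri : γ.IsPlaneTriangulation) (hV : 3 < Nat.card V)
    [Fintype γ.faces] {k : ℕ} (hk : 1 ≤ k) (D : Disk (Drawing.toTri htri hV)) {v0 : V}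
    (h0 : v0 ∈ D.Reg) (h : ∀ u ∈ D.c.support, ∀ w : D.R.Walk v0 u, k ≤ w.length) :
    ∃ C : Fin k → G.Subgraph, γ.IsSNest 0 C := by
  obtain ⟨E, -, hE, hd⟩ := Disk.nest (k - 1) D h0 (fun u hu w => by have := h u hu w; omega)
  have hdis : ∀ i j : Fin k, i ≠ j → ∀ v, v ∈ (E i).c.support → v ∈ (E j).c.support → False := by
    intro i j hij v hi hj
    rcases lt_or_gt_of_ne hij with hlt | hlt
    · exact hd i j hlt (by omega) v hi hj
    · exact hd j i hlt (by omega) v hj hi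
  refine ⟨fun i => (E i).c.toSubgraph, ⟨fun i => (E i).sub_cyc, ?_, ?_, ?_⟩, ∅, finite_empty,
    ncard_empty _, ?_⟩
  · intro i j hij
    rw [Set.disjoint_left]
    intro e h1 h2
    induction e with | _ u v =>
    rw [SimpleGraph.Walk.mem_edges_toSubgraph] at h1 h2
    exact hdis i j hij u ((E i).c.fst_mem_support_of_mem_edges h1)
      ((E j).c.fst_mem_support_of_mem_edges h2)
  · intro i e he e' he' hne
    rw [Set.eq_empty_iff_forall_notMem]
    rintro z ⟨hz, hz'⟩
    have : z ∈ γ.crossings := ⟨e, (E i).c.toSubgraph.edgeSet_subset he, e', he', hne, hz, hz'⟩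
    rw [htri.1] at this
    exact this
  · intro i hi
    exact Drawing.image_disk htri hV (hE i)
  · intro i j hij
    rw [Set.eq_empty_iff_forall_notMem]
    rintro v ⟨h1, h2⟩
    exact hdis i j hij v (by simpa using h1) (by simpa using h2)

end Instantiate

/-- **Lemma 3 of the paper.** Let `k ≥ 1` and let `G` be a triangulation
of the plane. Then `G` has either a `0`-nest of size `k`, or a standard
tree-decomposition of width at most `12k − 1` (i.e. all bags of size at most `12k`).
The tree-decomposition data consist of a tree `T` with root `r`, bags `W t`, and for
every tree-edge `t t'` a ring: a cycle of `G` with vertex set `W t ∩ W t'`; whenever a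
tree-edge lies on the path in `T` from `r` to another tree-edge, the ring of the
latter is distinct from the ring of the former and is drawn inside the closed disk it
bounds. -/
theorem statement2 {V : Type} [Fintype V] (k : ℕ) (hk : 1 ≤ k)
    (G : SimpleGraph V) (γ : Drawing G) (htri : γ.IsPlaneTriangulation) :
    (∃ C : Fin k → G.Subgraph, γ.IsSNest 0 C) ∨
    (∃ (τ : Type) (T : SimpleGraph τ) (_ : T.IsTree) (r : τ) (W : τ → Set V)
       (ring : ∀ t t' : τ, T.Adj t t' → G.Subgraph),
       -- (T1): every vertex of `G` and both ends of every edge of `G` lie in some bag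
       (∀ v : V, ∃ t, v ∈ W t) ∧
       (∀ u v : V, G.Adj u v → ∃ t, u ∈ W t ∧ v ∈ W t) ∧
       -- (T2): bags are nested along paths of `T`
       (∀ (t t'' : τ) (p : T.Walk t t''), p.IsPath →
          ∀ t' ∈ p.support, W t ∩ W t'' ⊆ W t') ∧
       -- width at most `12k - 1`
       (∀ t, (W t).ncard ≤ 12 * k) ∧
       -- (T3): for every tree-edge `t t'`, `W t ∩ W t'` is the vertex set of a
       -- cycle (the ring) of `G`
       (∀ (t t' : τ) (h : T.Adj t t'),
          IsCycleSubgraph (ring t t' h) ∧ (ring t t' h).verts = W t ∩ W t') ∧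
       (∀ (t t' : τ) (h : T.Adj t t'), ring t t' h = ring t' t h.symm) ∧
       -- (T4): if the tree-edge `a b` lies on the path of `T` from `r` ending with
       -- the tree-edge `c u`, and the two edges are distinct, then the rings differ
       -- and the latter ring lies in the closed disk bounded by the former
       (∀ (u : τ) (p : T.Walk r u), p.IsPath →
          ∀ (a b : τ) (hab : T.Adj a b) (c : τ) (hcu : T.Adj c u),
            s(a, b) ∈ p.edges → p.edges.getLast? = some s(c, u) →
            s(a, b) ≠ s(c, u) →
            ring c u hcu ≠ ring a b hab ∧
              γ.image (ring c u hcu) ⊆ closedRegion (γ.image (ring a b hab)))) := by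
  classical
  by_cases hV : Nat.card V ≤ 12 * k
  · right
    refine ⟨Unit, ⊥, SimpleGraph.IsTree.of_subsingleton, (), fun _ => univ, fun t t' h => h.elim,
      fun v => ⟨(), trivial⟩, fun u v _ => ⟨(), trivial, trivial⟩, fun _ _ _ _ _ _ _ _ => trivial,
      fun _ => by rwa [ncard_univ], fun _ _ h => h.elim, fun _ _ h => h.elim, ?_⟩
    intro u p hp a b hab
    exact hab.elim
  have hV : 3 < Nat.card V := by omega
  haveI : Fintype γ.faces := (Drawing.faces_finite htri).fintype
  by_cases hn : ∃ C : Fin k → G.Subgraph, γ.IsSNest 0 C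
  · exact Or.inl hn
  right
  have hd : ∀ D : Disk (Drawing.toTri htri hV), ∀ v ∈ D.Reg, ∃ u ∈ D.c.support,
      ∃ w : D.R.Walk v u, w.length ≤ k - 1 := by
    intro D v hv
    by_contra hcon
    push Not at hcon
    exact hn (Disk.snest htri hV hk D hv fun u hu w => by have := hcon u hu w; omega)
  obtain ⟨D, hD3, hD⟩ := (Drawing.toTri htri hV).exists_outer_disk
  obtain ⟨d⟩ := Dec.exists k hk hd _ D (by omega) rfl
  have hadj : ∀ u v, G.Adj u v → ∃ t, u ∈ d.W t ∧ v ∈ d.W t := by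
    intro u v huv
    obtain ⟨F, F', hne, hX⟩ := (Drawing.toTri htri hV).two u v huv
    have : ∃ X, X ≠ (Drawing.toTri htri hV).o ∧ (X = F ∨ X = F') := by
      by_cases h : F = (Drawing.toTri htri hV).o
      · exact ⟨F', fun h' => hne (h.trans h'.symm), Or.inr rfl⟩
      · exact ⟨F, h, Or.inl rfl⟩
    obtain ⟨X, hXo, hXF⟩ := this
    obtain ⟨t, ht⟩ := d.cover X (hD X hXo)
    obtain ⟨h1, h2⟩ := (hX X).2 hXF
    exact ⟨t, ht u h1, ht v h2⟩
  refine ⟨d.τ, d.tree, d.isTree, d.r, d.W, fun t t' _ => (d.rg t t').c.toSubgraph, ?_, hadj, ?_,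
    d.card, ?_, ?_, ?_⟩
  · intro v
    obtain ⟨F, hF⟩ := (Drawing.toTri htri hV).vert v
    obtain ⟨a, b, c, ha, hb, hc, hab, -, -⟩ := (Drawing.toTri htri hV).exists_fv F
    have : ∃ u, G.Adj v u := by
      by_cases h : v = a
      · exact ⟨b, (Drawing.toTri htri hV).clique F v hF b hb (h ▸ hab)⟩
      · exact ⟨a, (Drawing.toTri htri hV).clique F v hF a ha h⟩
    obtain ⟨u, hu⟩ := this
    obtain ⟨t, ht, -⟩ := hadj v u hu
    exact ⟨t, ht⟩
  · intro t t'' p hp t' ht'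
    exact d.conn p hp ht'
  · intro t t' h
    refine ⟨Disk.sub_cyc _, ?_⟩
    rw [← d.rg_vs h]
    ext v
    simp [Disk.vs]
  · intro t t' h
    exact congrArg (fun E : Disk (Drawing.toTri htri hV) => E.c.toSubgraph) (d.rg_symm h)
  · intro u p hp a b hab c hcu h1 h2 h3
    obtain ⟨h4, F, h5, h6⟩ := d.rg_nest hp h1 h2 h3
    refine ⟨?_, Drawing.image_disk htri hV h4⟩
    intro heq
    have := congrFun (Disk.x_eq_of_sub heq) F
    rw [h5, h6] at this
    exact absurd this (by decide)

end CrossingPaper
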